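/- arXiv:2409.04804 — 5 statements merged into one kernel-verified Lean document; each statement's English description precedes it below -/
import Mathlib

section
/- Let u be a solution of problem (1D). If there exist real numbers 0 ≤ t0 < t1 < +∞ such that u′(t) ≠ 0 for all t ∈ (t0, t1) and u′(t1) = 0, then u(t) = u(2t1 − t) for all t ∈ (t0, t1). -/
open Real Filter Set Topology MeasureTheory

/-- `Fint f t = ∫_0^t f(s) ds`. -/
noncomputable def Fint (f : ℝ → ℝ) (t : ℝ) : ℝ := ∫ s in (0:ℝ)..t, f s

/-- The zero set of `f` in `[0,∞)`. -/
def Zf (f : ℝ → ℝ) : Set ℝ := {z : ℝ | 0 ≤ z ∧ f z = 0}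

/-- `f` is locally Lipschitz on the set `s`. -/
def LocLipOn (f : ℝ → ℝ) (s : Set ℝ) : Prop :=
  ∀ x ∈ s, ∃ K : NNReal, ∃ t ∈ nhdsWithin x s, LipschitzOnWith K f t

/-- Condition (SMP): at every zero `z` of `f`,
`liminf_{t→z⁺} f(t)/(t−z)^{p−1} > −∞` and `limsup_{t→z⁻} f(t)/(z−t)^{p−1} < +∞`. -/
def SMP (p : ℝ) (f : ℝ → ℝ) : Prop :=
  ∀ z ∈ Zf f,
    (⊥ : EReal) <
      Filter.liminf (fun t : ℝ => ((f t / (t - z) ^ (p - 1) : ℝ) : EReal))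
        (nhdsWithin z (Set.Ioi z)) ∧
    Filter.limsup (fun t : ℝ => ((f t / (z - t) ^ (p - 1) : ℝ) : EReal))
      (nhdsWithin z (Set.Ico 0 z)) < (⊤ : EReal)

/-- A solution of problem (1D): a bounded nonnegative `C¹` function `u` on `[0,∞)`
with `u(0)=0`, derivative `u'`, such that `t ↦ |u'(t)|^{p−2} u'(t)` is differentiable
on `(0,∞)` with derivative `−f(u(t))` there. -/
structure Sol1D (p : ℝ) (f : ℝ → ℝ) (u u' : ℝ → ℝ) : Prop where
  hasDeriv : ∀ t ∈ Set.Ici (0:ℝ), HasDerivWithinAt u (u' t) (Set.Ici (0:ℝ)) t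
  derivCont : ContinuousOn u' (Set.Ici (0:ℝ))
  bounded : ∃ M : ℝ, ∀ t ∈ Set.Ici (0:ℝ), |u t| ≤ M
  zeroAtZero : u 0 = 0
  nonneg : ∀ t ∈ Set.Ici (0:ℝ), 0 ≤ u t
  ode : ∀ t ∈ Set.Ioi (0:ℝ),
    HasDerivAt (fun s : ℝ => |u' s| ^ (p - 2) * u' s) (-(f (u t))) t

/-- The reciprocal of a continuous function has an antiderivative on every order-connected set
on which the function does not vanish. -/
lemma exists_antideriv_inv {g : ℝ → ℝ} (hg : Continuous g) {J : Set ℝ} (hJ : J.OrdConnected)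
    (hgJ : ∀ x ∈ J, g x ≠ 0) : ∃ Φ : ℝ → ℝ, ∀ x ∈ J, HasDerivAt Φ (g x)⁻¹ x := by
  rcases J.eq_empty_or_nonempty with rfl | ⟨a, ha⟩
  · exact ⟨0, by simp⟩
  refine ⟨fun x => ∫ s in a..x, (g s)⁻¹, fun x hx => ?_⟩
  refine intervalIntegral.integral_hasDerivAt_right ?_ ?_ (hg.continuousAt.inv₀ (hgJ x hx))
  · exact ContinuousOn.intervalIntegrable
      (hg.continuousOn.inv₀ fun y hy => hgJ y (hJ.uIcc_subset ha hx hy))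
  · exact hg.measurable.inv.stronglyMeasurable.stronglyMeasurableAtFilter

/-- An antiderivative of `1 / g` is the time variable, up to a constant, along a
solution of `y' = g y`. -/
lemma exists_antideriv_comp_eq_add_const {g Φ y y' : ℝ → ℝ} {a b : ℝ}
    (hΦ : ∀ s ∈ Ioo a b, HasDerivAt Φ (g (y s))⁻¹ (y s))
    (hy : ∀ s ∈ Ioo a b, HasDerivAt y (y' s) s)
    (hyg : ∀ s ∈ Ioo a b, y' s = g (y s)) (hpos : ∀ s ∈ Ioo a b, 0 < y' s) :
    ∃ c, ∀ s ∈ Ioo a b, Φ (y s) = s + c := by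
  have hd : ∀ s ∈ Ioo a b, HasDerivAt (fun r => Φ (y r) - r) 0 s := by
    intro s hs
    have h := ((hΦ s hs).comp s (hy s hs)).sub (hasDerivAt_id s)
    rw [← hyg s hs, inv_mul_cancel₀ (hpos s hs).ne', sub_self] at h
    exact h
  obtain ⟨c, hc⟩ := isOpen_Ioo.exists_is_const_of_deriv_eq_zero isPreconnected_Ioo
    (fun s hs => (hd s hs).differentiableAt.differentiableWithinAt) (fun s hs => (hd s hs).deriv)
  exact ⟨c, fun s hs => by linarith [hc s hs]⟩

/-- Two solutions of `|y'| = g y` starting at the same point coincide as long as one of them is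
strictly increasing, provided the other one is initially increasing. -/
lemma eqOn_of_abs_deriv_eq {g V V' Y Y' : ℝ → ℝ} {T : ℝ} (hg : Continuous g)
    (hV : ∀ s ∈ Ico 0 T, HasDerivAt V (V' s) s) (hY : ∀ s ∈ Ico 0 T, HasDerivAt Y (Y' s) s)
    (hVc : ContinuousOn V' (Ico 0 T)) (hYc : ContinuousOn Y' (Ico 0 T))
    (hVpos : ∀ s ∈ Ioo 0 T, 0 < V' s)
    (hVg : ∀ s ∈ Ioo 0 T, |V' s| = g (V s)) (hYg : ∀ s ∈ Ioo 0 T, |Y' s| = g (Y s))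
    (h0 : Y 0 = V 0) (h0' : Y' 0 = V' 0) (hY0 : ∀ᶠ s in 𝓝[>] 0, 0 < Y' s) :
    EqOn Y V (Ico 0 T) := by
  have hVcont : ContinuousOn V (Ico 0 T) := fun s hs => (hV s hs).continuousAt.continuousWithinAt
  have hYcont : ContinuousOn Y (Ico 0 T) := fun s hs => (hY s hs).continuousAt.continuousWithinAt
  have hmono : StrictMonoOn V (Ico 0 T) := by
    refine strictMonoOn_of_deriv_pos (convex_Ico 0 T) hVcont fun s hs => ?_
    rw [interior_Ico] at hs
    rw [(hV s (Ioo_subset_Ico_self hs)).deriv]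
    exact hVpos s hs
  have hJ : (V '' Ioo 0 T).OrdConnected :=
    (isPreconnected_Ioo.image V (hVcont.mono Ioo_subset_Ico_self)).ordConnected
  obtain ⟨Φ, hΦ⟩ := exists_antideriv_inv hg hJ (by
    rintro _ ⟨s, hs, rfl⟩
    rw [← hVg s hs]
    exact (abs_pos.2 (hVpos s hs).ne').ne')
  obtain ⟨d, hd⟩ := exists_antideriv_comp_eq_add_const (a := 0) (b := T) (y := V) (y' := V')
    (fun s hs => hΦ _ (mem_image_of_mem V hs)) (fun s hs => hV s (Ioo_subset_Ico_self hs))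
    (fun s hs => by rw [← hVg s hs, abs_of_pos (hVpos s hs)]) hVpos
  have step : ∀ x ∈ Ico 0 T, Y x = V x → (∀ᶠ s in 𝓝[>] x, 0 < Y' s) →
      ∃ δ > x, δ ≤ T ∧ ∀ s ∈ Ioo x δ, Y s = V s := by
    intro x hx hxe hpos
    obtain ⟨b, hxb, hbT⟩ := exists_between hx.2
    have hbmem : b ∈ Ico 0 T := ⟨hx.1.trans hxb.le, hbT⟩
    have hlt : ∀ᶠ s in 𝓝[>] x, Y s < V b :=
      ((hY x hx).continuousAt.eventually_lt continuousAt_const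
        (hxe.trans_lt (hmono hx hbmem hxb))).filter_mono nhdsWithin_le_nhds
    obtain ⟨δ, hδ, hδs⟩ := (mem_nhdsGT_iff_exists_Ioo_subset' hx.2).1
      ((hpos.and hlt).and (Ioo_mem_nhdsGT hx.2))
    have hsub : Ioo x δ ⊆ Ioo 0 T := fun s hs => ⟨hx.1.trans_lt hs.1, (hδs hs).2.2⟩
    have hYmono : StrictMonoOn Y (Ico x δ) := by
      refine strictMonoOn_of_deriv_pos (convex_Ico x δ) (hYcont.mono fun s hs => ?_) fun s hs => ?_
      · rcases hs.1.eq_or_lt with rfl | h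
        · exact hx
        · exact Ioo_subset_Ico_self (hsub ⟨h, hs.2⟩)
      · rw [interior_Ico] at hs
        rw [(hY s (Ioo_subset_Ico_self (hsub hs))).deriv]
        exact (hδs hs).1.1
    have himg : ∀ s ∈ Ioo x δ, ∃ r ∈ Ioo 0 T, V r = Y s := by
      intro s hs
      have h1 : V x < Y s := hxe ▸ hYmono ⟨le_rfl, hδ⟩ (Ioo_subset_Ico_self hs) hs.1
      obtain ⟨r, hr, hre⟩ := intermediate_value_Ioo hxb.le
        (hVcont.mono fun y hy => ⟨hx.1.trans hy.1, hy.2.trans_lt hbT⟩) ⟨h1, (hδs hs).1.2⟩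
      exact ⟨r, ⟨hx.1.trans_lt hr.1, hr.2.trans hbT⟩, hre⟩
    obtain ⟨c, hc⟩ := exists_antideriv_comp_eq_add_const (a := x) (b := δ) (y := Y) (y' := Y')
      (fun s hs => by obtain ⟨r, hr, hre⟩ := himg s hs; exact hΦ _ ⟨r, hr, hre⟩)
      (fun s hs => hY s (Ioo_subset_Ico_self (hsub hs)))
      (fun s hs => by rw [← hYg s (hsub hs), abs_of_pos (hδs hs).1.1]) (fun s hs => (hδs hs).1.1)
    have hshift : ∀ s ∈ Ioo x δ, s + (c - d) ∈ Ioo 0 T ∧ V (s + (c - d)) = Y s := by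
      intro s hs
      obtain ⟨r, hr, hre⟩ := himg s hs
      have : r = s + (c - d) := by
        have h1 := hc s hs
        have h2 := hd r hr
        rw [hre] at h2
        linarith
      exact this ▸ ⟨hr, hre⟩
    have hev : ∀ᶠ s in 𝓝[>] x, s ∈ Ioo x δ := Ioo_mem_nhdsGT hδ
    have hlim : Tendsto (fun s => s + (c - d)) (𝓝[>] x) (𝓝 (x + (c - d))) :=
      (continuous_id.add continuous_const).continuousAt.continuousWithinAt
    have hmem : x + (c - d) ∈ Ico 0 T := by
      obtain ⟨m, hm⟩ := exists_between (mem_Ioi.1 hδ)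
      refine ⟨ge_of_tendsto hlim (hev.mono fun s hs => (hshift s hs).1.1.le), ?_⟩
      linarith [(hshift m hm).1.2, hm.1]
    have hVx : V (x + (c - d)) = V x := by
      rw [← hxe]
      refine tendsto_nhds_unique (((hV _ hmem).continuousAt.tendsto.comp hlim).congr' ?_)
        ((hY x hx).continuousAt.tendsto.mono_left nhdsWithin_le_nhds)
      exact hev.mono fun s hs => (hshift s hs).2
    have hcd : c - d = 0 := by linarith [hmono.injOn hmem hx hVx]
    refine ⟨δ, hδ, ?_, fun s hs => ?_⟩
    · by_contra! h
      obtain ⟨m, hm⟩ := exists_between (max_lt h hδ)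
      linarith [(hsub ⟨(le_max_right _ _).trans_lt hm.1, hm.2⟩).2, le_max_left T x, hm.1]
    · rw [← (hshift s hs).2, hcd, add_zero]
  intro b hb
  have hsub : Icc 0 b ⊆ Ico 0 T := fun s hs => ⟨hs.1, hs.2.trans_lt hb.2⟩
  have key : Icc 0 b ⊆ {s | Y s = V s ∧ Y' s = V' s} := by
    refine IsClosed.Icc_subset_of_forall_mem_nhdsWithin ?_ ⟨h0, h0'⟩ ?_
    · have : {s | Y s = V s ∧ Y' s = V' s} ∩ Icc 0 b =
          {s ∈ Icc 0 b | (Y s, Y' s) = (V s, V' s)} := by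
        ext s
        simp [and_comm]
      rw [this]
      exact isClosed_Icc.isClosed_eq ((hYcont.mono hsub).prodMk (hYc.mono hsub))
        ((hVcont.mono hsub).prodMk (hVc.mono hsub))
    · rintro x ⟨⟨hxe, hxe'⟩, hx⟩
      have hxT : x ∈ Ico 0 T := hsub (Ico_subset_Icc_self hx)
      have hpos : ∀ᶠ s in 𝓝[>] x, 0 < Y' s := by
        rcases hx.1.eq_or_lt with rfl | h
        · exact hY0
        · have hx0 : 0 < Y' x := hxe' ▸ hVpos x ⟨h, hxT.2⟩
          exact ((hYc.continuousAt (Ico_mem_nhds h hxT.2)).eventually_const_lt hx0).filter_mono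
            nhdsWithin_le_nhds
      obtain ⟨δ, hδ, hδT, heq⟩ := step x hxT hxe hpos
      filter_upwards [Ioo_mem_nhdsGT hδ] with s hs
      have hs' : s ∈ Ico 0 T := ⟨hxT.1.trans hs.1.le, hs.2.trans_le hδT⟩
      refine ⟨heq s hs, ((hY s hs').congr_of_eventuallyEq ?_).unique (hV s hs')⟩
      filter_upwards [Ioo_mem_nhds hs.1 hs.2] with r hr using (heq r hr).symm
  exact (key ⟨hb.1, le_rfl⟩).1

/-- A function vanishing at `0` and satisfying `|V'| ^ p ≤ C * V ^ p` cannot become positive. -/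
lemma not_forall_pos_of_abs_deriv_rpow_le {p C T : ℝ} {V V' : ℝ → ℝ} (hp : 0 < p) (hC : 0 ≤ C)
    (hT : 0 < T) (hV : ∀ s ∈ Ico 0 T, HasDerivAt V (V' s) s) (hV0 : V 0 = 0)
    (hle : ∀ s ∈ Ico 0 T, |V' s| ^ p ≤ C * V s ^ p) : ¬ ∀ s ∈ Ioo 0 T, 0 < V s := by
  intro hpos
  have hb : T / 2 ∈ Ioo 0 T := ⟨by linarith, by linarith⟩
  have hsub : Icc 0 (T / 2) ⊆ Ico 0 T := fun s hs => ⟨hs.1, hs.2.trans_lt hb.2⟩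
  have hnn : ∀ s ∈ Ico 0 T, 0 ≤ V s := by
    intro s hs
    rcases hs.1.eq_or_lt with rfl | h
    · exact hV0.ge
    · exact (hpos s ⟨h, hs.2⟩).le
  have h := norm_le_gronwallBound_of_norm_deriv_right_le (f := V) (f' := V') (δ := 0)
    (K := C ^ p⁻¹) (ε := 0) (a := 0) (b := T / 2)
    (fun s hs => (hV s (hsub hs)).continuousAt.continuousWithinAt)
    (fun s hs => (hV s (hsub (Ico_subset_Icc_self hs))).hasDerivWithinAt) (by simp [hV0])
    (fun s hs => by
      have hs' := hsub (Ico_subset_Icc_self hs)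
      have h1 := Real.rpow_le_rpow (by positivity) (hle s hs') (inv_nonneg.2 hp.le)
      rw [Real.rpow_rpow_inv (abs_nonneg _) hp.ne', Real.mul_rpow hC (by have := hnn s hs'; positivity),
        Real.rpow_rpow_inv (hnn s hs') hp.ne'] at h1
      rw [add_zero, Real.norm_eq_abs, Real.norm_of_nonneg (hnn s hs')]
      exact h1) (T / 2) ⟨hb.1.le, le_rfl⟩
  rw [gronwallBound_ε0_δ0] at h
  exact (hpos _ hb).ne' (norm_le_zero_iff.1 h)

lemma abs_abs_rpow_sub_two_mul_self {p : ℝ} (hp : 1 < p) (x : ℝ) :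
    |(|x| ^ (p - 2) * x)| = |x| ^ (p - 1) := by
  rcases eq_or_ne x 0 with rfl | hx
  · rw [mul_zero, abs_zero, Real.zero_rpow (by linarith)]
  · rw [abs_mul, abs_of_nonneg (by positivity), ← Real.rpow_add_one (abs_pos.2 hx).ne']
    congr 1
    ring

lemma abs_rpow_sub_two_mul_self_rpow {p : ℝ} (hp : 1 < p) (x : ℝ) :
    |(|x| ^ (p - 2) * x)| ^ (p / (p - 1)) = |x| ^ p := by
  have : p - 1 ≠ 0 := by linarith
  rw [abs_abs_rpow_sub_two_mul_self hp, ← Real.rpow_mul (abs_nonneg x)]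
  congr 1
  field_simp

/-- The map `x ↦ |x| ^ (q - 2) * x` is a left inverse of `x ↦ |x| ^ (p - 2) * x` for conjugate
exponents `p` and `q`. -/
lemma abs_rpow_sub_two_mul_self_conj {p : ℝ} (hp : 1 < p) (x : ℝ) :
    |(|x| ^ (p - 2) * x)| ^ (p / (p - 1) - 2) * (|x| ^ (p - 2) * x) = x := by
  have hp1 : p - 1 ≠ 0 := by linarith
  rcases eq_or_ne x 0 with rfl | hx
  · simp
  · have hx' : 0 < |x| := abs_pos.2 hx
    rw [abs_abs_rpow_sub_two_mul_self hp, ← Real.rpow_mul hx'.le, ← mul_assoc, ← Real.rpow_add hx']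
    have : (p - 1) * (p / (p - 1) - 2) + (p - 2) = 0 := by
      field_simp
      ring
    rw [this, Real.rpow_zero, one_mul]

/-- Conservation of energy for `(|u'| ^ (p - 2) * u')' = -h u`. -/
lemma abs_deriv_rpow_eq_energy {p : ℝ} (hp : 1 < p) {h u u' : ℝ → ℝ} (hh : Continuous h)
    (hu : ∀ t ∈ Ioi (0 : ℝ), HasDerivAt u (u' t) t)
    (hode : ∀ t ∈ Ioi (0 : ℝ),
      HasDerivAt (fun s : ℝ => |u' s| ^ (p - 2) * u' s) (-(h (u t))) t)
    {t₁ : ℝ} (ht₁ : 0 < t₁) (hu₁ : u' t₁ = 0) {t : ℝ} (ht : 0 < t) :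
    |u' t| ^ p = p / (p - 1) * ((∫ s in (0 : ℝ)..u t₁, h s) - ∫ s in (0 : ℝ)..u t, h s) := by
  have hp1 : 0 < p - 1 := by linarith
  have hq : 1 < p / (p - 1) := by
    rw [one_lt_div hp1]
    linarith
  have hd : ∀ s ∈ Ioi (0 : ℝ), HasDerivAt (fun r => |(|u' r| ^ (p - 2) * u' r)| ^ (p / (p - 1)) +
      p / (p - 1) * ∫ x in (0 : ℝ)..u r, h x) 0 s := by
    intro s hs
    have h1 := (hasDerivAt_abs_rpow (|u' s| ^ (p - 2) * u' s) hq).comp s (hode s hs)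
    have h2 := ((hh.integral_hasStrictDerivAt 0 (u s)).hasDerivAt.comp s (hu s hs)).const_mul
      (p / (p - 1))
    refine (h1.add h2).congr_deriv ?_
    rw [mul_assoc (p / (p - 1)), abs_rpow_sub_two_mul_self_conj hp]
    ring
  have := isOpen_Ioi.is_const_of_deriv_eq_zero isPreconnected_Ioi
    (fun s hs => (hd s hs).differentiableAt.differentiableWithinAt)
    (fun s hs => (hd s hs).deriv) (mem_Ioi.2 ht) (mem_Ioi.2 ht₁)
  simp only [abs_rpow_sub_two_mul_self_rpow hp] at this
  rw [hu₁, abs_zero, Real.zero_rpow (by linarith)] at this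
  linarith

/-- Reflection symmetry about a critical point reached monotonically; `-σ` is the sign of `u'`
on the left of the critical point. -/
lemma eq_reflect_of_sign {p : ℝ} (hp : 1 < p) {h u u' : ℝ → ℝ} (hh : Continuous h)
    (hu : ∀ t ∈ Ioi (0 : ℝ), HasDerivAt u (u' t) t) (hu' : ContinuousOn u' (Ioi 0))
    (hode : ∀ t ∈ Ioi (0 : ℝ),
      HasDerivAt (fun s : ℝ => |u' s| ^ (p - 2) * u' s) (-(h (u t))) t)
    {t₀ t₁ σ : ℝ} (ht₀ : 0 ≤ t₀) (ht : t₀ < t₁) (hu₁ : u' t₁ = 0) (hσ : σ * σ = 1)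
    (hsign : ∀ t ∈ Ioo t₀ t₁, σ * u' t < 0)
    (hsmp : h (u t₁) = 0 → ∃ C : ℝ, ∀ᶠ x in 𝓝[>] (0 : ℝ),
      -(σ * h (u t₁ + σ * x)) ≤ C * x ^ (p - 1)) :
    ∀ t ∈ Ioo t₀ t₁, u t = u (2 * t₁ - t) := by
  have hp0 : 0 < p := by linarith
  have hq : 0 < p / (p - 1) := div_pos hp0 (by linarith)
  have ht₁ : 0 < t₁ := ht₀.trans_lt ht
  have hσ0 : σ ≠ 0 := by rintro rfl; simp at hσ
  have hσabs : |σ| = 1 := by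
    rcases mul_self_eq_one_iff.1 hσ with rfl | rfl <;> simp
  set m := u t₁ with hm
  set T := t₁ - t₀ with hTdef
  have hT : 0 < T := sub_pos.2 ht
  set H : ℝ → ℝ := fun x => p / (p - 1) *
    ((∫ s in (0 : ℝ)..m, h s) - ∫ s in (0 : ℝ)..(m + σ * x), h s) with hH
  have hHd : ∀ x, HasDerivAt H (p / (p - 1) * -(σ * h (m + σ * x))) x := by
    intro x
    have h1 : HasDerivAt (fun x => m + σ * x) σ x := by
      simpa using ((hasDerivAt_id x).const_mul σ).const_add m
    have h2 := (((hh.integral_hasStrictDerivAt 0 (m + σ * x)).hasDerivAt.comp x h1).const_sub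
      (∫ s in (0 : ℝ)..m, h s)).const_mul (p / (p - 1))
    refine h2.congr_deriv ?_
    ring
  have hHc : Continuous H := continuous_iff_continuousAt.2 fun x => (hHd x).continuousAt
  have hH0 : H 0 = 0 := by simp [hH]
  set V : ℝ → ℝ := fun s => σ * (u (t₁ - s) - m) with hVdef
  set V' : ℝ → ℝ := fun s => σ * -u' (t₁ - s) with hV'def
  set Y : ℝ → ℝ := fun s => σ * (u (t₁ + s) - m) with hYdef
  set Y' : ℝ → ℝ := fun s => σ * u' (t₁ + s) with hY'def
  have hleft : ∀ s ∈ Ico 0 T, 0 < t₁ - s := fun s hs => by linarith [hs.2]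
  have hright : ∀ s ∈ Ico 0 T, 0 < t₁ + s := fun s hs => by linarith [hs.1]
  have hV : ∀ s ∈ Ico 0 T, HasDerivAt V (V' s) s := fun s hs =>
    (((hu _ (hleft s hs)).comp_const_sub t₁ s).sub_const m).const_mul σ
  have hY : ∀ s ∈ Ico 0 T, HasDerivAt Y (Y' s) s := fun s hs =>
    (((hu _ (hright s hs)).comp_const_add t₁ s).sub_const m).const_mul σ
  have hVc : ContinuousOn V' (Ico 0 T) :=
    continuousOn_const.mul (hu'.comp (by fun_prop) hleft).neg
  have hYc : ContinuousOn Y' (Ico 0 T) :=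
    continuousOn_const.mul (hu'.comp (by fun_prop) hright)
  have hVpos : ∀ s ∈ Ioo 0 T, 0 < V' s := fun s hs => by
    have := hsign (t₁ - s) ⟨by linarith [hs.2], by linarith [hs.1]⟩
    simp only [hV'def]
    linarith
  have hHV : ∀ s, m + σ * V s = u (t₁ - s) := fun s => by
    simp only [hVdef]
    linear_combination (u (t₁ - s) - m) * hσ
  have hHY : ∀ s, m + σ * Y s = u (t₁ + s) := fun s => by
    simp only [hYdef]
    linear_combination (u (t₁ + s) - m) * hσ
  have hVH : ∀ s ∈ Ico 0 T, |V' s| ^ p = H (V s) := fun s hs => by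
    simp only [hH, hHV, hV'def, abs_mul, hσabs, one_mul, abs_neg]
    exact abs_deriv_rpow_eq_energy hp hh hu hode ht₁ hu₁ (hleft s hs)
  have hYH : ∀ s ∈ Ico 0 T, |Y' s| ^ p = H (Y s) := fun s hs => by
    simp only [hH, hHY, hY'def, abs_mul, hσabs, one_mul]
    exact abs_deriv_rpow_eq_energy hp hh hu hode ht₁ hu₁ (hright s hs)
  have hV0 : V 0 = 0 := by simp [hVdef, hm]
  have hVp : ∀ s ∈ Ioo 0 T, 0 < V s := by
    have hmono : StrictMonoOn V (Ico 0 T) := by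
      refine strictMonoOn_of_deriv_pos (convex_Ico 0 T)
        (fun s hs => (hV s hs).continuousAt.continuousWithinAt) fun s hs => ?_
      rw [interior_Ico] at hs
      rw [(hV s (Ioo_subset_Ico_self hs)).deriv]
      exact hVpos s hs
    intro s hs
    exact hV0 ▸ hmono ⟨le_rfl, hT⟩ (Ioo_subset_Ico_self hs) hs.1
  have hm0 : h m ≠ 0 := by
    intro h0
    obtain ⟨C, hC⟩ := hsmp h0
    obtain ⟨δ, hδ, hδC⟩ := mem_nhdsGT_iff_exists_Ioo_subset.1 hC
    have hHle : ∀ x ∈ Ico 0 δ, H x ≤ p / (p - 1) * max C 0 * x ^ p := by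
      intro x hx
      rcases hx.1.eq_or_lt with rfl | hx0
      · rw [hH0, Real.zero_rpow hp0.ne', mul_zero]
      obtain ⟨ξ, hξ, hξe⟩ := exists_hasDerivAt_eq_slope H _ hx0 hHc.continuousOn
        fun y _ => hHd y
      rw [hH0, sub_zero, sub_zero, eq_div_iff hx0.ne'] at hξe
      have h1 : -(σ * h (m + σ * ξ)) ≤ max C 0 * x ^ (p - 1) :=
        calc -(σ * h (m + σ * ξ)) ≤ C * ξ ^ (p - 1) := hδC ⟨hξ.1, hξ.2.trans hx.2⟩
          _ ≤ max C 0 * x ^ (p - 1) := by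
            have := hξ.1
            gcongr
            · exact le_max_left _ _
            · exact hξ.2.le
      rw [← hξe]
      calc p / (p - 1) * -(σ * h (m + σ * ξ)) * x
          ≤ p / (p - 1) * (max C 0 * x ^ (p - 1)) * x := by gcongr
        _ = p / (p - 1) * max C 0 * (x ^ (p - 1) * x) := by ring
        _ = p / (p - 1) * max C 0 * x ^ p := by
          rw [← Real.rpow_add_one hx0.ne', sub_add_cancel]
    have hsmall : ∀ᶠ s in 𝓝[>] (0 : ℝ), V s < δ :=
      ((hV 0 ⟨le_rfl, hT⟩).continuousAt.eventually_lt continuousAt_const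
        (by rw [hV0]; exact hδ)).filter_mono nhdsWithin_le_nhds
    obtain ⟨b, hb, hbs⟩ := mem_nhdsGT_iff_exists_Ioo_subset.1 (hsmall.and (Ioo_mem_nhdsGT hT))
    have hbT : ∀ s ∈ Ioo 0 b, s ∈ Ioo 0 T := fun s hs => (hbs hs).2
    have hbT' : ∀ s ∈ Ico 0 b, s ∈ Ico 0 T := by
      intro s hs
      rcases hs.1.eq_or_lt with rfl | h
      · exact ⟨le_rfl, hT⟩
      · exact Ioo_subset_Ico_self (hbT s ⟨h, hs.2⟩)
    refine not_forall_pos_of_abs_deriv_rpow_le (C := p / (p - 1) * max C 0) hp0 (by positivity)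
      (mem_Ioi.1 hb) (fun s hs => hV s (hbT' s hs)) hV0 (fun s hs => ?_)
      fun s hs => hVp s (hbT s hs)
    rw [hVH s (hbT' s hs)]
    refine hHle _ ?_
    rcases hs.1.eq_or_lt with rfl | h
    · rw [hV0]
      exact ⟨le_rfl, hδ⟩
    · exact ⟨(hVp s (hbT s ⟨h, hs.2⟩)).le, (hbs ⟨h, hs.2⟩).1⟩
  have hW := (hode t₁ ht₁).const_mul σ
  have hslope := hW.tendsto_slope
  have hnonneg : 0 ≤ σ * -(h m) := by
    refine ge_of_tendsto (hslope.mono_left (nhdsLT_le_nhdsNE t₁)) ?_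
    filter_upwards [Ioo_mem_nhdsLT ht] with s hs
    simp only [slope_def_field, hu₁, mul_zero, sub_zero]
    refine div_nonneg_of_nonpos ?_ (by linarith [hs.2])
    nlinarith [hsign s hs, Real.rpow_nonneg (abs_nonneg (u' s)) (p - 2)]
  have hpos : 0 < σ * -(h m) :=
    hnonneg.lt_of_ne (mul_ne_zero hσ0 (neg_ne_zero.2 hm0)).symm
  have hY0 : ∀ᶠ s in 𝓝[>] (0 : ℝ), 0 < Y' s := by
    have h1 : ∀ᶠ t in 𝓝[>] t₁, 0 < σ * u' t := by
      filter_upwards [(hslope.mono_left (nhdsGT_le_nhdsNE t₁)).eventually_const_lt hpos,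
        self_mem_nhdsWithin] with t h1 h2
      simp only [slope_def_field, hu₁, mul_zero, sub_zero] at h1
      rw [div_pos_iff_of_pos_right (sub_pos.2 h2), mul_left_comm] at h1
      exact pos_of_mul_pos_right h1 (by positivity)
    have h2 : Tendsto (fun s => t₁ + s) (𝓝[>] 0) (𝓝[>] t₁) := by
      refine tendsto_nhdsWithin_iff.2 ⟨?_, ?_⟩
      · have : Tendsto (fun s => t₁ + s) (𝓝 0) (𝓝 (t₁ + 0)) :=
          (continuous_const.add continuous_id).continuousAt
        rw [add_zero] at this
        exact this.mono_left nhdsWithin_le_nhds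
      · filter_upwards [self_mem_nhdsWithin] with s hs
        simpa using hs
    exact h2.eventually h1
  have key := eqOn_of_abs_deriv_eq (g := fun x => H x ^ p⁻¹)
    (hHc.rpow_const fun _ => Or.inr (inv_nonneg.2 hp0.le)) hV hY hVc hYc hVpos
    (fun s hs => by rw [← hVH s (Ioo_subset_Ico_self hs), Real.rpow_rpow_inv (abs_nonneg _) hp0.ne'])
    (fun s hs => by rw [← hYH s (Ioo_subset_Ico_self hs), Real.rpow_rpow_inv (abs_nonneg _) hp0.ne'])
    (by simp [hVdef, hYdef]) (by simp [hV'def, hY'def, hu₁]) hY0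
  intro t htt
  have := key (show t₁ - t ∈ Ico 0 T from ⟨by linarith [htt.2], by linarith [htt.1]⟩)
  have h2 := hHY (t₁ - t)
  rw [this, hHV] at h2
  rw [show 2 * t₁ - t = t₁ + (t₁ - t) by ring, ← h2]
  congr 1
  ring

lemma SMP.exists_bound_right {p : ℝ} {f : ℝ → ℝ} (hf : SMP p f) {z : ℝ} (hz : z ∈ Zf f) :
    ∃ C : ℝ, ∀ᶠ x in 𝓝[>] (0 : ℝ), -f (z + x) ≤ C * x ^ (p - 1) := by
  obtain ⟨c, -, hc⟩ := EReal.lt_iff_exists_real_btwn.1 (hf z hz).1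
  have hev := Filter.eventually_lt_of_lt_liminf hc
  refine ⟨-c, ?_⟩
  have htend : Tendsto (fun x => z + x) (𝓝[>] 0) (𝓝[>] z) := by
    refine tendsto_nhdsWithin_iff.2 ⟨?_, ?_⟩
    · have : Tendsto (fun x => z + x) (𝓝 0) (𝓝 (z + 0)) :=
        (continuous_const.add continuous_id).continuousAt
      rw [add_zero] at this
      exact this.mono_left nhdsWithin_le_nhds
    · filter_upwards [self_mem_nhdsWithin] with x hx
      simpa using hx
  filter_upwards [htend.eventually hev, self_mem_nhdsWithin] with x hx hx0
  rw [EReal.coe_lt_coe_iff, add_sub_cancel_left,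
    lt_div_iff₀ (Real.rpow_pos_of_pos hx0 _)] at hx
  linarith

lemma SMP.exists_bound_left {p : ℝ} {f : ℝ → ℝ} (hf : SMP p f) {z : ℝ} (hz : z ∈ Zf f)
    (hz0 : 0 < z) :
    ∃ C : ℝ, ∀ᶠ x in 𝓝[>] (0 : ℝ), f (z - x) ≤ C * x ^ (p - 1) := by
  obtain ⟨c, hc, -⟩ := EReal.lt_iff_exists_real_btwn.1 (hf z hz).2
  rw [nhdsWithin_Ico_eq_nhdsLT hz0] at hc
  have hev := Filter.eventually_lt_of_limsup_lt hc
  refine ⟨c, ?_⟩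
  have htend : Tendsto (fun x => z - x) (𝓝[>] 0) (𝓝[<] z) := by
    refine tendsto_nhdsWithin_iff.2 ⟨?_, ?_⟩
    · have : Tendsto (fun x => z - x) (𝓝 0) (𝓝 (z - 0)) :=
        (continuous_const.sub continuous_id).continuousAt
      rw [sub_zero] at this
      exact this.mono_left nhdsWithin_le_nhds
    · filter_upwards [self_mem_nhdsWithin] with x hx
      simpa using hx
  filter_upwards [htend.eventually hev, self_mem_nhdsWithin] with x hx hx0
  rw [EReal.coe_lt_coe_iff, sub_sub_cancel, div_lt_iff₀ (Real.rpow_pos_of_pos hx0 _)] at hx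
  exact hx.le

theorem stmt0 (p : ℝ) (hp : 1 < p) (f : ℝ → ℝ)
    (hfc : ContinuousOn f (Set.Ici 0))
    (hflip : LocLipOn f (Set.Ici 0 \ Zf f))
    (hsmp : SMP p f)
    (u u' : ℝ → ℝ) (hu : Sol1D p f u u')
    (t0 t1 : ℝ) (ht0 : 0 ≤ t0) (ht01 : t0 < t1)
    (hne : ∀ t ∈ Set.Ioo t0 t1, u' t ≠ 0) (ht1 : u' t1 = 0) :
    ∀ t ∈ Set.Ioo t0 t1, u t = u (2 * t1 - t) := by
  have ht1' : 0 < t1 := ht0.trans_lt ht01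
  have hm : 0 ≤ u t1 := hu.nonneg t1 ht1'.le
  have hfext : ∀ x, 0 ≤ x → f (max x 0) = f x := fun x hx => by rw [max_eq_left hx]
  have hcont : Continuous fun x => f (max x 0) :=
    hfc.comp_continuous (by fun_prop) fun x => le_max_right x 0
  have hd : ∀ t ∈ Ioi (0 : ℝ), HasDerivAt u (u' t) t := fun t ht =>
    (hu.hasDeriv t (mem_Ici_of_Ioi ht)).hasDerivAt (Ici_mem_nhds ht)
  have hc : ContinuousOn u' (Ioi 0) := hu.derivCont.mono Ioi_subset_Ici_self
  have hode : ∀ t ∈ Ioi (0 : ℝ),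
      HasDerivAt (fun s : ℝ => |u' s| ^ (p - 2) * u' s) (-(f (max (u t) 0))) t := by
    intro t ht
    rw [hfext _ (hu.nonneg t (mem_Ici_of_Ioi ht))]
    exact hu.ode t ht
  rcases hasDerivWithinAt_forall_lt_or_forall_gt_of_forall_ne (convex_Ioo t0 t1)
    (fun t ht => (hd t (ht0.trans_lt ht.1)).hasDerivWithinAt) hne with hs | hs
  · refine eq_reflect_of_sign (σ := 1) hp hcont hd hc hode ht0 ht01 ht1 (by norm_num)
      (fun t ht => by linarith [hs t ht]) fun h0 => ?_
    rw [hfext _ hm] at h0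
    obtain ⟨C, hC⟩ := hsmp.exists_bound_right ⟨hm, h0⟩
    refine ⟨C, ?_⟩
    filter_upwards [hC, self_mem_nhdsWithin] with x hx hx0
    rwa [one_mul, one_mul, hfext _ (add_nonneg hm (le_of_lt hx0))]
  · have hmono : StrictMonoOn u (Ioc t0 t1) := by
      refine strictMonoOn_of_deriv_pos (convex_Ioc t0 t1)
        (fun t ht => (hd t (ht0.trans_lt ht.1)).continuousAt.continuousWithinAt) fun t ht => ?_
      rw [interior_Ioc] at ht
      rw [(hd t (ht0.trans_lt ht.1)).deriv]
      exact hs t ht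
    obtain ⟨r, hr⟩ := exists_between ht01
    have hm' : 0 < u t1 := (hu.nonneg r (ht0.trans hr.1.le)).trans_lt
      (hmono ⟨hr.1, hr.2.le⟩ ⟨ht01, le_rfl⟩ hr.2)
    refine eq_reflect_of_sign (σ := -1) hp hcont hd hc hode ht0 ht01 ht1 (by norm_num)
      (fun t ht => by linarith [hs t ht]) fun h0 => ?_
    rw [hfext _ hm] at h0
    obtain ⟨C, hC⟩ := hsmp.exists_bound_left ⟨hm, h0⟩ hm'
    refine ⟨C, ?_⟩
    filter_upwards [hC, Ioo_mem_nhdsGT hm'] with x hx hx0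
    rw [neg_one_mul, neg_neg, neg_one_mul, ← sub_eq_add_neg, hfext _ (sub_nonneg.2 hx0.2.le)]
    exact hx
end

section
/- Let u be a solution of problem (1D). If there exist 0 < t0 < t1 ≤ +∞ such that u′(t) ≠ 0 for all t ∈ (t0, t1) and u′(t0) = 0, then t0 ≥ t1/2 (in particular t1 < +∞) and u(t) = u(2t0 − t) for all t ∈ (t0, t1). -/
open Real Filter Set Topology MeasureTheory

/-- A strictly increasing solution of an autonomous first order equation is determined, on an
interval, by its value at the left endpoint; here the equation is encoded by `hg`. -/
lemma autonomous_le_of_le {a b : ℝ} (hab : a < b) {u v u' v' : ℝ → ℝ}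
    (huc : ContinuousOn u (Icc a b)) (hvc : ContinuousOn v (Icc a b))
    (hud : ∀ t ∈ Ioo a b, HasDerivAt u (u' t) t) (hvd : ∀ t ∈ Ioo a b, HasDerivAt v (v' t) t)
    (hu0 : ∀ t ∈ Ioo a b, 0 < u' t) (hv0 : ∀ t ∈ Ioo a b, 0 < v' t)
    (hg : ∀ s ∈ Ioo a b, ∀ t ∈ Ioo a b, u s = v t → u' s = v' t)
    (ha : u a = v a) (hb : u b ≤ v b) : v b ≤ u b := by
  have hum : StrictMonoOn u (Icc a b) := by
    refine strictMonoOn_of_deriv_pos (convex_Icc a b) huc fun t ht => ?_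
    rw [interior_Icc] at ht
    rw [(hud t ht).deriv]; exact hu0 t ht
  have hvm : StrictMonoOn v (Icc a b) := by
    refine strictMonoOn_of_deriv_pos (convex_Icc a b) hvc fun t ht => ?_
    rw [interior_Icc] at ht
    rw [(hvd t ht).deriv]; exact hv0 t ht
  have haI : a ∈ Icc a b := left_mem_Icc.2 hab.le
  have hbI : b ∈ Icc a b := right_mem_Icc.2 hab.le
  have hex : ∀ t, ∃ s, t ∈ Icc a b → s ∈ Icc a b ∧ v s = u t := by
    intro t
    by_cases ht : t ∈ Icc a b
    · have : u t ∈ Icc (v a) (v b) :=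
        ⟨ha ▸ hum.monotoneOn haI ht ht.1, (hum.monotoneOn ht hbI ht.2).trans hb⟩
      obtain ⟨s, hs, hs'⟩ := intermediate_value_Icc hab.le hvc this
      exact ⟨s, fun _ => ⟨hs, hs'⟩⟩
    · exact ⟨0, fun h => absurd h ht⟩
  choose τ hτ using hex
  have hτm : StrictMonoOn τ (Icc a b) := by
    intro s hs t ht hst
    rw [← hvm.lt_iff_lt (hτ s hs).1 (hτ t ht).1, (hτ s hs).2, (hτ t ht).2]
    exact hum hs ht hst
  have hτa : τ a = a := hvm.injOn (hτ a haI).1 haI ((hτ a haI).2.trans ha)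
  have hτI : ∀ t ∈ Ioo a b, τ t ∈ Ioo a (τ b) := fun t ht =>
    ⟨hτa ▸ hτm haI (Ioo_subset_Icc_self ht) ht.1, hτm (Ioo_subset_Icc_self ht) hbI ht.2⟩
  have hτI' : ∀ t ∈ Ioo a b, τ t ∈ Ioo a b := fun t ht =>
    ⟨(hτI t ht).1, (hτI t ht).2.trans_le (hτ b hbI).1.2⟩
  have hτc : ∀ t ∈ Ioo a b, ContinuousAt τ t := by
    intro t ht
    refine continuousAt_of_monotoneOn_of_image_mem_nhds hτm.monotoneOn
      (Icc_mem_nhds ht.1 ht.2) ?_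
    refine mem_of_superset (Icc_mem_nhds (hτI t ht).1 (hτI t ht).2) ?_
    intro s hs
    have hsI : s ∈ Icc a b := ⟨hs.1, hs.2.trans (hτ b hbI).1.2⟩
    have : v s ∈ Icc (u a) (u b) :=
      ⟨ha ▸ hvm.monotoneOn haI hsI hs.1,
        (hτ b hbI).2 ▸ hvm.monotoneOn hsI (hτ b hbI).1 hs.2⟩
    obtain ⟨r, hr, hr'⟩ := intermediate_value_Icc hab.le huc this
    exact ⟨r, hr, hvm.injOn (hτ r hr).1 hsI ((hτ r hr).2.trans hr')⟩
  have hτd : ∀ t ∈ Ioo a b, HasDerivAt τ 1 t := by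
    intro t ht
    have hvt := hvd _ (hτI' t ht)
    have hpos := hv0 _ (hτI' t ht)
    have heq : u' t = v' (τ t) := hg t ht _ (hτI' t ht) (hτ t (Ioo_subset_Icc_self ht)).2.symm
    have hIcc : ∀ᶠ s in 𝓝[≠] t, s ∈ Icc a b :=
      mem_nhdsWithin_of_mem_nhds (Icc_mem_nhds ht.1 ht.2)
    have htI := Ioo_subset_Icc_self ht
    have hτt : Tendsto τ (𝓝[≠] t) (𝓝[≠] (τ t)) := by
      refine tendsto_nhdsWithin_of_tendsto_nhds_of_eventually_within _
        ((hτc t ht).mono_left nhdsWithin_le_nhds) ?_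
      filter_upwards [hIcc, self_mem_nhdsWithin] with s hs hst
      exact fun h => hst (hτm.injOn hs htI h)
    have h1 := (hasDerivAt_iff_tendsto_slope.1 (hud t ht))
    have h2 := (hasDerivAt_iff_tendsto_slope.1 hvt).comp hτt
    rw [hasDerivAt_iff_tendsto_slope]
    have h3 := h1.div h2 hpos.ne'
    rw [heq, div_self hpos.ne'] at h3
    refine h3.congr' ?_
    filter_upwards [hIcc, self_mem_nhdsWithin] with s hs hst
    have hne : u s - u t ≠ 0 := sub_ne_zero.2 fun h => hst (hum.injOn hs htI h)
    simp only [Pi.div_apply, Function.comp_apply, slope_def_field, (hτ s hs).2, (hτ t htI).2]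
    rw [div_div_div_eq, mul_comm (s - t), mul_div_mul_left _ _ hne]
  have hle : ∀ t ∈ Ioo a b, t ≤ τ t := by
    intro t ht
    have key : ∀ x ∈ Ioo a t, t - τ t ≤ x - a := by
      intro x hx
      obtain ⟨c, hc, hc'⟩ := exists_hasDerivAt_eq_slope τ (fun _ => 1) hx.2
        (fun r hr => (hτc r ⟨hx.1.trans_le hr.1, hr.2.trans_lt ht.2⟩).continuousWithinAt)
        (fun r hr => hτd r ⟨hx.1.trans hr.1, hr.2.trans ht.2⟩)
      rw [eq_div_iff (by linarith [hx.2])] at hc'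
      linarith [(hτI x ⟨hx.1, hx.2.trans ht.2⟩).1]
    by_contra! h
    have := key (min ((a + t) / 2) (a + (t - τ t) / 2))
      ⟨lt_min (by linarith [ht.1]) (by linarith), (min_le_left _ _).trans_lt (by linarith [ht.1])⟩
    linarith [min_le_right ((a + t) / 2) (a + (t - τ t) / 2)]
  refine ContinuousWithinAt.closure_le (s := Ioo a b) ?_
    ((hvc b hbI).mono Ioo_subset_Icc_self) ((huc b hbI).mono Ioo_subset_Icc_self) fun t ht => ?_
  · rw [closure_Ioo hab.ne]; exact hbI
  · have htI := Ioo_subset_Icc_self ht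
    rw [← (hτ t htI).2]
    exact hvm.monotoneOn htI (hτ t htI).1 (hle t ht)

/-- Uniqueness for strictly increasing solutions of an autonomous first order equation. -/
lemma autonomous_eq {a b : ℝ} (hab : a < b) {u v u' v' : ℝ → ℝ}
    (huc : ContinuousOn u (Icc a b)) (hvc : ContinuousOn v (Icc a b))
    (hud : ∀ t ∈ Ioo a b, HasDerivAt u (u' t) t) (hvd : ∀ t ∈ Ioo a b, HasDerivAt v (v' t) t)
    (hu0 : ∀ t ∈ Ioo a b, 0 < u' t) (hv0 : ∀ t ∈ Ioo a b, 0 < v' t)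
    (hg : ∀ s ∈ Ioo a b, ∀ t ∈ Ioo a b, u s = v t → u' s = v' t)
    (ha : u a = v a) : u b = v b := by
  rcases le_total (u b) (v b) with hb | hb
  · exact hb.antisymm (autonomous_le_of_le hab huc hvc hud hvd hu0 hv0 hg ha hb)
  · exact (autonomous_le_of_le hab hvc huc hvd hud hv0 hu0
      (fun s hs t ht h => (hg t ht s hs h.symm).symm) ha.symm hb).antisymm hb

/-- Quantitative strong maximum principle: a function vanishing at `a` with `y' ^ (p - 1)` tending
to `0` there cannot be strictly increasing if `(y' ^ (p - 1))' ≤ C * y ^ (p - 1)`. -/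
lemma hopf_contradiction {p a b C : ℝ} (hp : 1 < p) (hab : a < b) {y y' W h : ℝ → ℝ}
    (hyc : ContinuousOn y (Icc a b)) (hyd : ∀ t ∈ Ioo a b, HasDerivAt y (y' t) t)
    (hy' : ∀ t ∈ Ioo a b, 0 < y' t) (hya : y a = 0)
    (hWc : ContinuousOn W (Icc a b)) (hWd : ∀ t ∈ Ioo a b, HasDerivAt W (h t) t)
    (hWa : W a = 0) (hW : ∀ t ∈ Ioo a b, W t = y' t ^ (p - 1))
    (hC : 0 ≤ C) (hh : ∀ t ∈ Ioo a b, h t ≤ C * y t ^ (p - 1)) : False := by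
  have hym : StrictMonoOn y (Icc a b) := by
    refine strictMonoOn_of_deriv_pos (convex_Icc a b) hyc fun t ht => ?_
    rw [interior_Icc] at ht
    rw [(hyd t ht).deriv]; exact hy' t ht
  have haI : a ∈ Icc a b := left_mem_Icc.2 hab.le
  have hypos : ∀ t ∈ Ioo a b, 0 < y t := fun t ht =>
    hya ▸ hym haI (Ioo_subset_Icc_self ht) ht.1
  obtain ⟨t, hat, ht⟩ : ∃ t, a < t ∧ t < min b (min (a + 1) (a + 1 / (C + 1))) :=
    exists_between (lt_min hab (lt_min (by linarith) (by
      have : 0 < 1 / (C + 1) := by positivity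
      linarith)))
  rw [lt_min_iff, lt_min_iff] at ht
  obtain ⟨htb, ht1, htC⟩ := ht
  have htI : t ∈ Ioo a b := ⟨hat, htb⟩
  have hCt : C * (t - a) < 1 := by
    have h1 : t - a < 1 / (C + 1) := by linarith
    rw [lt_div_iff₀ (by linarith)] at h1
    nlinarith
  obtain ⟨ξ, hξ, hξ'⟩ := exists_hasDerivAt_eq_slope y y' hat
    (hyc.mono (Icc_subset_Icc_right htb.le)) (fun x hx => hyd x ⟨hx.1, hx.2.trans htb⟩)
  have hξI : ξ ∈ Ioo a b := ⟨hξ.1, hξ.2.trans htb⟩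
  obtain ⟨η, hη, hη'⟩ := exists_hasDerivAt_eq_slope W h hξ.1
    (hWc.mono (Icc_subset_Icc_right hξI.2.le)) (fun x hx => hWd x ⟨hx.1, hx.2.trans hξI.2⟩)
  have hηI : η ∈ Ioo a b := ⟨hη.1, hη.2.trans hξI.2⟩
  rw [eq_div_iff (by linarith), hya, sub_zero] at hξ'
  rw [eq_div_iff (by linarith [hξ.1]), hWa, sub_zero, hW ξ hξI] at hη'
  have hyη : y η ≤ y t :=
    hym.monotoneOn (Ioo_subset_Icc_self hηI) (Ioo_subset_Icc_self htI) (hη.2.trans hξ.2).le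
  have hyt := hypos t htI
  have h1 : y t ≤ y' ξ := by nlinarith [hy' ξ hξI]
  have h2 : y t ^ (p - 1) ≤ y' ξ ^ (p - 1) := rpow_le_rpow hyt.le h1 (by linarith)
  have h3 : y η ^ (p - 1) ≤ y t ^ (p - 1) := rpow_le_rpow (hypos η hηI).le hyη (by linarith)
  have h4 : 0 < y t ^ (p - 1) := rpow_pos_of_pos hyt _
  have h5 : h η ≤ C * y t ^ (p - 1) := (hh η hηI).trans (by gcongr)
  have h6 : h η * (ξ - a) ≤ C * y t ^ (p - 1) * (ξ - a) :=
    mul_le_mul_of_nonneg_right h5 (by linarith [hξ.1])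
  have h7 : C * y t ^ (p - 1) * (ξ - a) ≤ C * y t ^ (p - 1) * (t - a) :=
    mul_le_mul_of_nonneg_left (by linarith [hξ.2]) (by positivity)
  nlinarith

namespace Sol1D

variable {p : ℝ} {f u u' : ℝ → ℝ}

lemma hasDerivAt (hu : Sol1D p f u u') {t : ℝ} (ht : 0 < t) : HasDerivAt u (u' t) t :=
  (hu.hasDeriv t ht.le).hasDerivAt (Ici_mem_nhds ht)

lemma continuousOn (hu : Sol1D p f u u') : ContinuousOn u (Ici 0) :=
  fun t ht => (hu.hasDeriv t ht).continuousWithinAt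

/-- By conservation of energy, `|u'|` is a function of `u`. -/
lemma abs_deriv_eq (hu : Sol1D p f u u') (hp : 1 < p) (hfc : ContinuousOn f (Ici 0))
    {s t : ℝ} (hs : 0 < s) (ht : 0 < t) (hst : u s = u t) : |u' s| = |u' t| := by
  set g : ℝ → ℝ := fun x => f (max x 0)
  have hg : Continuous g := by
    exact hfc.comp_continuous (by fun_prop) fun x => mem_Ici.2 (le_max_right _ _)
  set q : ℝ := p / (p - 1) with hq
  have hp1 : 0 < p - 1 := by linarith
  have hq1 : 1 < q := by rw [hq, one_lt_div hp1]; linarith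
  set w : ℝ → ℝ := fun s => |u' s| ^ (p - 2) * u' s with hw
  have hwabs : ∀ r, |w r| = |u' r| ^ (p - 1) := by
    intro r
    rcases eq_or_ne (u' r) 0 with h0 | h0
    · simp [hw, h0, zero_rpow hp1.ne']
    · have := abs_pos.2 h0
      rw [hw]
      simp only [abs_mul, abs_of_nonneg (rpow_nonneg (abs_nonneg (u' r)) (p - 2))]
      nth_rw 2 [← rpow_one |u' r|]
      rw [← rpow_add this]; ring_nf
  have hwinv : ∀ r, |w r| ^ (q - 2) * w r = u' r := by
    intro r
    rcases eq_or_ne (u' r) 0 with h0 | h0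
    · simp [hw, h0]
    · have := abs_pos.2 h0
      rw [hwabs, hw, ← rpow_mul this.le, ← mul_assoc, ← rpow_add this]
      have : (p - 1) * (q - 2) + (p - 2) = 0 := by rw [hq]; field_simp; ring
      rw [this, rpow_zero, one_mul]
  have hE : ∀ r ∈ Ioi (0:ℝ),
      HasDerivAt (fun r => |w r| ^ q / q + ∫ x in (0:ℝ)..(u r), g x) 0 r := by
    intro r hr
    have h1 := (((hasDerivAt_abs_rpow (w r) hq1).comp r (hu.ode r hr)).div_const q)
    have h2 := (hg.integral_hasStrictDerivAt 0 (u r)).hasDerivAt.comp r (hu.hasDerivAt hr)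
    refine (h1.add h2).congr_deriv ?_
    have h3 : g (u r) = f (u r) := by
      simp only [g, max_eq_left (hu.nonneg r (mem_Ici.2 (le_of_lt hr)))]
    rw [mul_assoc q, hwinv, h3]
    field_simp
    ring
  have hconst := isOpen_Ioi.is_const_of_deriv_eq_zero isPreconnected_Ioi
    (fun r hr => (hE r hr).differentiableAt.differentiableWithinAt)
    (fun r hr => (hE r hr).deriv) (x := s) (y := t) hs ht
  simp only [hst, add_left_inj, hwabs] at hconst
  have hq0 : q ≠ 0 := by linarith
  rw [div_left_inj' hq0, ← rpow_mul (abs_nonneg _), ← rpow_mul (abs_nonneg _)] at hconst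
  exact (rpow_left_inj (abs_nonneg _) (abs_nonneg _) (by positivity)).1 hconst

lemma ne_zero_of_critical (hu : Sol1D p f u u') (hp : 1 < p) (hsmp : SMP p f) {ε a b : ℝ}
    (hε : ε = 1 ∨ ε = -1) (ha : 0 < a) (hab : a < b) (hd : u' a = 0)
    (hpos : ∀ t ∈ Ioo a b, 0 < ε * u' t) : f (u a) ≠ 0 := by
  intro hfz
  have hIci : ∀ t ∈ Icc a b, 0 < t := fun t ht => ha.trans_le ht.1
  have hyd : ∀ t ∈ Icc a b, HasDerivAt (fun t => ε * (u t - u a)) (ε * u' t) t := fun t ht =>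
    ((hu.hasDerivAt (hIci t ht)).sub_const _).const_mul ε
  have hyc : ContinuousOn (fun t => ε * (u t - u a)) (Icc a b) := fun t ht =>
    (hyd t ht).continuousAt.continuousWithinAt
  have hym : StrictMonoOn (fun t => ε * (u t - u a)) (Icc a b) := by
    refine strictMonoOn_of_deriv_pos (convex_Icc a b) hyc fun t ht => ?_
    rw [interior_Icc] at ht
    rw [(hyd t (Ioo_subset_Icc_self ht)).deriv]; exact hpos t ht
  have hypos : ∀ t ∈ Ioo a b, 0 < ε * (u t - u a) := fun t ht => by
    simpa using hym (left_mem_Icc.2 hab.le) (Ioo_subset_Icc_self ht) ht.1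
  have hut : Tendsto u (𝓝[>] a) (𝓝 (u a)) :=
    (hu.hasDerivAt ha).continuousAt.continuousWithinAt.tendsto
  have hIoo : ∀ᶠ t in 𝓝[>] a, t ∈ Ioo a b := Ioo_mem_nhdsGT hab
  have hbound : ∃ C, 0 ≤ C ∧ ∀ᶠ t in 𝓝[>] a,
      ε * (-f (u t)) ≤ C * (ε * (u t - u a)) ^ (p - 1) := by
    obtain ⟨h1, h2⟩ := hsmp (u a) ⟨hu.nonneg a ha.le, hfz⟩
    rcases hε with rfl | rfl
    · obtain ⟨c, -, hc⟩ := EReal.lt_iff_exists_real_btwn.1 h1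
      have hev := eventually_lt_of_lt_liminf hc
      have hu' : Tendsto u (𝓝[>] a) (𝓝[>] (u a)) := by
        refine tendsto_nhdsWithin_of_tendsto_nhds_of_eventually_within _ hut ?_
        filter_upwards [hIoo] with t ht
        have := hypos t ht
        simp only [mem_Ioi]; linarith
      refine ⟨|c|, abs_nonneg c, ?_⟩
      filter_upwards [hu'.eventually hev, hIoo] with t ht htI
      have hy := hypos t htI
      rw [one_mul] at hy ⊢
      have hp' : 0 < (u t - u a) ^ (p - 1) := rpow_pos_of_pos hy _
      rw [EReal.coe_lt_coe_iff, lt_div_iff₀ hp'] at ht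
      rw [one_mul]
      nlinarith [neg_abs_le c]
    · obtain ⟨c, hc, -⟩ := EReal.lt_iff_exists_real_btwn.1 h2
      have hev := eventually_lt_of_limsup_lt hc
      have hu' : Tendsto u (𝓝[>] a) (𝓝[Ico 0 (u a)] (u a)) := by
        refine tendsto_nhdsWithin_of_tendsto_nhds_of_eventually_within _ hut ?_
        filter_upwards [hIoo] with t ht
        have := hypos t ht
        exact ⟨hu.nonneg t (ha.trans ht.1).le, by linarith⟩
      refine ⟨|c|, abs_nonneg c, ?_⟩
      filter_upwards [hu'.eventually hev, hIoo] with t ht htI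
      have hy := hypos t htI
      rw [show -1 * (u t - u a) = u a - u t by ring] at hy ⊢
      have hp' : 0 < (u a - u t) ^ (p - 1) := rpow_pos_of_pos hy _
      rw [EReal.coe_lt_coe_iff, div_lt_iff₀ hp'] at ht
      nlinarith [le_abs_self c]
  obtain ⟨C, hC, hev⟩ := hbound
  obtain ⟨c, hac, hc⟩ := mem_nhdsGT_iff_exists_Ioo_subset.1 (hev.and hIoo)
  have hcI : ∀ t ∈ Ioo a c, t ∈ Ioo a b := fun t ht => (hc ht).2
  have hcb : c ≤ b := by
    by_contra! h
    exact lt_irrefl b (hcI b ⟨hab, h⟩).2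
  have hWd : ∀ t ∈ Icc a c, HasDerivAt (fun s => ε * (|u' s| ^ (p - 2) * u' s))
      (ε * (-f (u t))) t := fun t ht => (hu.ode t (ha.trans_le ht.1)).const_mul ε
  refine hopf_contradiction (y' := fun t => ε * u' t) hp hac
    (hyc.mono (Icc_subset_Icc_right hcb))
    (fun t ht => hyd t (Ioo_subset_Icc_self (hcI t ht))) (fun t ht => hpos t (hcI t ht))
    (by simp) (fun t ht => (hWd t ht).continuousAt.continuousWithinAt)
    (fun t ht => hWd t (Ioo_subset_Icc_self ht)) (by simp [hd]) (fun t ht => ?_) hC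
    fun t ht => (hc ht).1
  have h0 := hpos t (hcI t ht)
  have habs : |u' t| = ε * u' t := by
    rw [← abs_of_pos h0, abs_mul]
    rcases hε with rfl | rfl <;> simp
  rw [habs, mul_left_comm, ← rpow_add_one h0.ne']
  ring_nf

lemma eventually_left_of_critical (hu : Sol1D p f u u') {ε a b : ℝ} (hε : ε ≠ 0)
    (ha : 0 < a) (hab : a < b) (hd : u' a = 0) (hpos : ∀ t ∈ Ioo a b, 0 < ε * u' t)
    (hf : f (u a) ≠ 0) : ∀ᶠ t in 𝓝[<] a, ε * u' t < 0 := by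
  have hW := hasDerivAt_iff_tendsto_slope.1 ((hu.ode a ha).const_mul ε)
  have hge : 0 ≤ ε * (-f (u a)) := by
    refine ge_of_tendsto (x := 𝓝[>] a)
      (hW.mono_left (nhdsWithin_mono a fun t (ht : a < t) => ht.ne')) ?_
    filter_upwards [Ioo_mem_nhdsGT hab] with t ht
    rw [slope_def_field, hd]
    simp only [mul_zero, sub_zero]
    rw [mul_left_comm]
    exact div_nonneg (mul_nonneg (by positivity) (hpos t ht).le) (by linarith [ht.1])
  have hgt : 0 < ε * (-f (u a)) := hge.lt_of_ne' (mul_ne_zero hε (neg_ne_zero.2 hf))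
  have hleft := hW.mono_left (nhdsWithin_mono a fun t (ht : t ∈ Iio a) => ne_of_lt ht)
  filter_upwards [hleft.eventually (lt_mem_nhds hgt), self_mem_nhdsWithin] with t ht hta
  rw [slope_def_field, hd] at ht
  simp only [mul_zero, sub_zero] at ht
  rw [mul_left_comm] at ht
  by_contra! h
  have hta' : t - a < 0 := sub_neg.2 hta
  exact absurd ht (not_lt.2 (div_nonpos_of_nonneg_of_nonpos
    (mul_nonneg (by positivity) h) hta'.le))

/-- A solution is symmetric about a critical point as long as it stays strictly monotone. -/
lemma reflection (hu : Sol1D p f u u') (hp : 1 < p) (hfc : ContinuousOn f (Ici 0))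
    (hsmp : SMP p f) {ε a c : ℝ} (hε : ε = 1 ∨ ε = -1) (ha : 0 < a) (hc : c ≤ 2 * a)
    (hd : u' a = 0) (hpos : ∀ t ∈ Ioo a c, 0 < ε * u' t) :
    ∀ t ∈ Ioo a c, u t = u (2 * a - t) := by
  intro t ht
  have hac : a < c := ht.1.trans ht.2
  have hε0 : ε ≠ 0 := by rcases hε with rfl | rfl <;> norm_num
  have hεabs : |ε| = 1 := by rcases hε with rfl | rfl <;> simp
  have hvd : ∀ s ∈ Ico a c, HasDerivAt (fun s => u (2 * a - s)) (-u' (2 * a - s)) s := by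
    intro s hs
    have h := (hu.hasDerivAt (t := 2 * a - s) (by linarith [hs.2])).comp s
      ((hasDerivAt_id s).const_sub (2 * a))
    exact h.congr_deriv (by ring)
  have hud : ∀ s ∈ Ico a c, HasDerivAt u (u' s) s := fun s hs =>
    hu.hasDerivAt (ha.trans_le hs.1)
  have hEq : ∀ b ∈ Ioo a c, (∀ s ∈ Ioo a b, 0 < ε * -u' (2 * a - s)) →
      u b = u (2 * a - b) := by
    intro b hb hb'
    have hsub : Icc a b ⊆ Ico a c := fun s hs => ⟨hs.1, hs.2.trans_lt hb.2⟩
    have hsub' : Ioo a b ⊆ Ioo a c := Ioo_subset_Ioo_right hb.2.le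
    have := autonomous_eq hb.1 (u := fun s => ε * u s) (v := fun s => ε * u (2 * a - s))
      (u' := fun s => ε * u' s) (v' := fun s => ε * -u' (2 * a - s))
      (fun s hs => ((hud s (hsub hs)).const_mul ε).continuousAt.continuousWithinAt)
      (fun s hs => ((hvd s (hsub hs)).const_mul ε).continuousAt.continuousWithinAt)
      (fun s hs => (hud s (hsub (Ioo_subset_Icc_self hs))).const_mul ε)
      (fun s hs => (hvd s (hsub (Ioo_subset_Icc_self hs))).const_mul ε)
      (fun s hs => hpos s (hsub' hs)) hb' ?_ (by ring_nf)
    · exact mul_left_cancel₀ hε0 this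
    · intro s hs r hr hsr
      have h1 := hu.abs_deriv_eq hp hfc (ha.trans hs.1) (t := 2 * a - r)
        (by linarith [(hsub' hr).2]) (mul_left_cancel₀ hε0 hsr)
      show ε * u' s = ε * -u' (2 * a - r)
      rw [← abs_of_pos (hpos s (hsub' hs)), ← abs_of_pos (hb' r hr), abs_mul, abs_mul,
        abs_neg, h1]
  refine hEq t ht ?_
  by_contra! hbad
  obtain ⟨s, hs, hs'⟩ := hbad
  have hfz := hu.ne_zero_of_critical hp hsmp hε ha hac hd hpos
  obtain ⟨l, hla, hl⟩ := mem_nhdsLT_iff_exists_Ioo_subset.1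
    (hu.eventually_left_of_critical hε0 ha hac hd hpos hfz)
  have hla : l < a := hla
  set δ := 2 * a - l with hδ
  have hnear : ∀ r, a < r → r < δ → 0 < ε * -u' (2 * a - r) := by
    intro r h1 h2
    have : ε * u' (2 * a - r) < 0 := hl ⟨by linarith, by linarith⟩
    linarith
  have hδs : δ ≤ s := by
    by_contra! h
    exact absurd (hnear s hs.1 h) (not_lt.2 hs')
  have hsc : s < c := hs.2.trans ht.2
  have hcont : ContinuousOn (fun r => ε * -u' (2 * a - r)) (Icc δ s) := by
    refine continuousOn_const.mul (ContinuousOn.neg ?_)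
    refine hu.derivCont.comp (by fun_prop) fun r hr => ?_
    simp only [mem_Ici]; linarith [hr.2]
  have hK : IsCompact {r ∈ Icc δ s | ε * -u' (2 * a - r) ≤ 0} :=
    isCompact_Icc.of_isClosed_subset
      (hcont.preimage_isClosed_of_isClosed isClosed_Icc isClosed_Iic) fun r hr => hr.1
  obtain ⟨m, ⟨hmI, hm⟩, hmin⟩ := hK.exists_isLeast ⟨s, ⟨hδs, le_rfl⟩, hs'⟩
  have ham : a < m := by linarith [hmI.1]
  have hmc : m < c := hmI.2.trans_lt hsc
  have hbefore : ∀ r ∈ Ioo a m, 0 < ε * -u' (2 * a - r) := by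
    intro r hr
    by_contra! h
    rcases lt_or_ge r δ with h1 | h1
    · exact absurd (hnear r hr.1 h1) (not_lt.2 h)
    · exact absurd (hmin ⟨⟨h1, hr.2.le.trans hmI.2⟩, h⟩) (not_le.2 hr.2)
  have heq : EqOn u (fun r => u (2 * a - r)) (Icc a m) := by
    intro r hr
    rcases eq_or_lt_of_le hr.1 with rfl | h
    · simp only; ring_nf
    · exact hEq r ⟨h, hr.2.trans_lt hmc⟩ fun q hq => hbefore q ⟨hq.1, hq.2.trans_le hr.2⟩
  have hmm : m ∈ Icc a m := right_mem_Icc.2 ham.le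
  have hderiv : u' m = -u' (2 * a - m) :=
    (uniqueDiffOn_Icc ham m hmm).eq_deriv _ (hud m ⟨ham.le, hmc⟩).hasDerivWithinAt
      ((hvd m ⟨ham.le, hmc⟩).hasDerivWithinAt.congr heq (heq hmm))
  rw [← hderiv] at hm
  exact absurd (hpos m ⟨ham, hmc⟩) (not_lt.2 hm)

end Sol1D

theorem stmt1 (p : ℝ) (hp : 1 < p) (f : ℝ → ℝ)
    (hfc : ContinuousOn f (Set.Ici 0))
    (hflip : LocLipOn f (Set.Ici 0 \ Zf f))
    (hsmp : SMP p f)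
    (u u' : ℝ → ℝ) (hu : Sol1D p f u u')
    (t0 : ℝ) (t1 : EReal) (ht0 : 0 < t0) (ht01 : (t0 : EReal) < t1)
    (hne : ∀ t : ℝ, t0 < t → (t : EReal) < t1 → u' t ≠ 0) (hd0 : u' t0 = 0) :
    ∃ T : ℝ, t1 = (T : EReal) ∧ T / 2 ≤ t0 ∧
      ∀ t : ℝ, t0 < t → t < T → u t = u (2 * t0 - t) := by
  obtain ⟨ε, hε, hpos⟩ : ∃ ε : ℝ, (ε = 1 ∨ ε = -1) ∧
      ∀ t : ℝ, t0 < t → (t : EReal) < t1 → 0 < ε * u' t := by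
    obtain ⟨r, hr0, hr1⟩ := EReal.lt_iff_exists_real_btwn.1 ht01
    rw [EReal.coe_lt_coe_iff] at hr0
    have hI : IsPreconnected {t : ℝ | t0 < t ∧ (t : EReal) < t1} := by
      refine OrdConnected.isPreconnected ⟨fun x hx y hy z hz => ⟨hx.1.trans_le hz.1, ?_⟩⟩
      exact (EReal.coe_le_coe_iff.2 hz.2).trans_lt hy.2
    obtain ⟨ε, hε, hεr⟩ : ∃ ε : ℝ, (ε = 1 ∨ ε = -1) ∧ 0 < ε * u' r := by
      rcases (hne r hr0 hr1).lt_or_gt with h | h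
      · exact ⟨-1, Or.inr rfl, by linarith⟩
      · exact ⟨1, Or.inl rfl, by linarith⟩
    refine ⟨ε, hε, fun t ht ht' => ?_⟩
    by_contra! h
    have hc : ContinuousOn (fun t => ε * u' t) {t : ℝ | t0 < t ∧ (t : EReal) < t1} :=
      continuousOn_const.mul (hu.derivCont.mono fun x hx => (ht0.trans hx.1).le)
    obtain ⟨z, hz, hz'⟩ := hI.intermediate_value (a := t) (b := r) ⟨ht, ht'⟩ ⟨hr0, hr1⟩ hc
      ⟨h, hεr.le⟩
    rcases mul_eq_zero.1 hz' with h0 | h0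
    · rcases hε with rfl | rfl <;> norm_num at h0
    · exact hne z hz.1 hz.2 h0
  have hle : t1 ≤ ((2 * t0 : ℝ) : EReal) := by
    by_contra! hlt
    have heq := hu.reflection hp hfc hsmp hε ht0 (le_refl (2 * t0)) hd0
      fun t ht => hpos t ht.1 ((EReal.coe_lt_coe_iff.2 ht.2).trans hlt)
    have h2 : 0 < 2 * t0 := by linarith
    have hlt2 : t0 < 2 * t0 := by linarith
    have hud := hu.hasDerivAt h2
    have hl1 : Tendsto u (𝓝[<] (2 * t0)) (𝓝 (u (2 * t0))) :=
      hud.continuousAt.continuousWithinAt.tendsto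
    have hl2 : Tendsto (fun t => u (2 * t0 - t)) (𝓝[<] (2 * t0)) (𝓝 (u 0)) := by
      refine (hu.continuousOn 0 (mem_Ici.2 le_rfl)).tendsto.comp
        (tendsto_nhdsWithin_of_tendsto_nhds_of_eventually_within _ ?_ ?_)
      · refine Tendsto.mono_left ?_ nhdsWithin_le_nhds
        have : Continuous fun t : ℝ => 2 * t0 - t := by fun_prop
        simpa using this.tendsto (2 * t0)
      · filter_upwards [self_mem_nhdsWithin] with t ht
        exact mem_Ici.2 (sub_nonneg.2 (le_of_lt ht))
    have hu2 : u (2 * t0) = 0 := by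
      rw [← hu.zeroAtZero]
      refine tendsto_nhds_unique (hl1.congr' ?_) hl2
      filter_upwards [Ioo_mem_nhdsLT hlt2] with t ht using heq t ht
    refine hne (2 * t0) hlt2 hlt (IsLocalMin.hasDerivAt_eq_zero ?_ hud)
    filter_upwards [Ioi_mem_nhds h2] with t ht
    rw [hu2]
    exact hu.nonneg t (mem_Ici.2 (le_of_lt ht))
  have hT : t1 = (t1.toReal : EReal) :=
    (EReal.coe_toReal (hle.trans_lt (EReal.coe_lt_top _)).ne
      ((EReal.bot_lt_coe _).trans ht01).ne').symm
  generalize t1.toReal = T at hT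
  subst hT
  rw [EReal.coe_le_coe_iff] at hle
  exact ⟨T, rfl, by linarith, fun t ht ht' =>
    hu.reflection hp hfc hsmp hε ht0 hle hd0
      (fun s hs => hpos s hs.1 (EReal.coe_lt_coe_iff.2 hs.2)) t ⟨ht, ht'⟩⟩
end

section
/- Let u be a solution of problem (1D). If there exist 0 ≤ t0 < t1 < +∞ such that u′(t) > 0 for all t ∈ (t0, t1) and u′(t1) = 0, then f(u(t1)) > 0. -/
open Real Filter Set Topology MeasureTheory

/-- If `u` increases strictly up to the level `z = u b`, and its nonnegative `(p-1)`-th power slope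
`w = u' ^ (p-1)` vanishes at `b`, then `w' ≥ -C (z - u) ^ (p-1)` cannot hold before `b`. -/
theorem false_of_rpow_slope_bound {p C a b : ℝ} {u u' w g : ℝ → ℝ} (hp : 1 < p) (hC : 0 < C)
    (hab : a < b) (hu : ∀ t ∈ Icc a b, HasDerivAt u (u' t) t)
    (hw : ∀ t ∈ Icc a b, HasDerivAt w (-(g t)) t)
    (hpos : ∀ t ∈ Ico a b, 0 < u' t) (hwu : ∀ t ∈ Ico a b, w t = u' t ^ (p - 1)) (hwb : w b = 0)
    (hmono : StrictMonoOn u (Icc a b))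
    (hg : ∀ t ∈ Ico a b, g t ≤ C * (u b - u t) ^ (p - 1)) : False := by
  have hp0 : 0 < p - 1 := by linarith
  have hL : 0 < C * (b - a) := mul_pos hC (by linarith)
  obtain ⟨K, hK0, hK⟩ : ∃ K : ℝ, 0 ≤ K ∧ K ^ (p - 1) = C * (b - a) :=
    ⟨(C * (b - a)) ^ (p - 1)⁻¹, by positivity, Real.rpow_inv_rpow hL.le hp0.ne'⟩
  have hslope : ∀ t ∈ Ico a b, u' t ≤ K * (u b - u t) := by
    intro t ht
    have hsub : Icc t b ⊆ Icc a b := Icc_subset_Icc_left ht.1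
    have hv : 0 < u b - u t :=
      sub_pos.2 (hmono ⟨ht.1, ht.2.le⟩ ⟨hab.le, le_rfl⟩ ht.2)
    obtain ⟨ξ, hξ, heq⟩ := exists_hasDerivAt_eq_slope w (fun t => -(g t)) ht.2
      (fun x hx => (hw x (hsub hx)).continuousAt.continuousWithinAt)
      (fun x hx => hw x (hsub (Ioo_subset_Icc_self hx)))
    have hbt : 0 < b - t := sub_pos.2 ht.2
    have hwt : w t = g ξ * (b - t) := by
      rw [hwb] at heq
      field_simp at heq
      linarith
    have hξ' : ξ ∈ Ico a b := ⟨ht.1.trans hξ.1.le, hξ.2⟩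
    have hle : (u b - u ξ) ^ (p - 1) ≤ (u b - u t) ^ (p - 1) := by
      apply Real.rpow_le_rpow _ _ hp0.le
      · exact sub_nonneg.2 (hmono.monotoneOn ⟨hξ'.1, hξ.2.le⟩ ⟨hab.le, le_rfl⟩ hξ.2.le)
      · exact sub_le_sub_left
          (hmono.monotoneOn ⟨ht.1, ht.2.le⟩ ⟨hξ'.1, hξ.2.le⟩ hξ.1.le) _
    rw [← Real.rpow_le_rpow_iff (hpos t ht).le (by positivity) hp0,
      Real.mul_rpow hK0 hv.le, hK, ← hwu t ht, hwt]
    calc g ξ * (b - t) ≤ C * (u b - u t) ^ (p - 1) * (b - t) := by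
          gcongr
          exact (hg ξ hξ').trans (by gcongr)
      _ ≤ C * (u b - u t) ^ (p - 1) * (b - a) := by
          gcongr
          exact ht.1
      _ = C * (b - a) * (u b - u t) ^ (p - 1) := by ring
  have hder : ∀ t ∈ Icc a b, HasDerivAt (fun t => (u b - u t) * exp (K * t))
      (-(u' t) * exp (K * t) + (u b - u t) * (exp (K * t) * K)) t := by
    intro t ht
    have h := ((hasDerivAt_id t).const_mul K).exp
    simp only [id, mul_one] at h
    exact ((hu t ht).const_sub (u b)).mul h
  obtain ⟨ξ, hξ, heq⟩ := exists_hasDerivAt_eq_slope _ _ hab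
    (fun x hx => (hder x hx).continuousAt.continuousWithinAt)
    (fun x hx => hder x (Ioo_subset_Icc_self hx))
  have hnonneg : 0 ≤ -(u' ξ) * exp (K * ξ) + (u b - u ξ) * (exp (K * ξ) * K) := by
    have := mul_nonneg (sub_nonneg.2 (hslope ξ ⟨hξ.1.le, hξ.2⟩)) (exp_pos (K * ξ)).le
    linarith
  have hneg : ((u b - u b) * exp (K * b) - (u b - u a) * exp (K * a)) / (b - a) < 0 := by
    have hv : 0 < u b - u a := sub_pos.2 (hmono ⟨le_rfl, hab.le⟩ ⟨hab.le, le_rfl⟩ hab)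
    have := mul_pos hv (exp_pos (K * a))
    exact div_neg_of_neg_of_pos (by linarith) (by linarith)
  linarith

theorem stmt2 (p : ℝ) (hp : 1 < p) (f : ℝ → ℝ)
    (hfc : ContinuousOn f (Set.Ici 0))
    (hflip : LocLipOn f (Set.Ici 0 \ Zf f))
    (hsmp : SMP p f)
    (u u' : ℝ → ℝ) (hu : Sol1D p f u u')
    (t0 t1 : ℝ) (ht0 : 0 ≤ t0) (ht01 : t0 < t1)
    (hpos : ∀ t ∈ Set.Ioo t0 t1, 0 < u' t) (ht1 : u' t1 = 0) :
    0 < f (u t1) := by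
  have hud : ∀ t, 0 < t → HasDerivAt u (u' t) t := fun t ht =>
    (hu.hasDeriv t ht.le).hasDerivAt (Ici_mem_nhds ht)
  have hp0 : 0 < p - 1 := by linarith
  have ht1pos : 0 < t1 := ht0.trans_lt ht01
  have hmono : StrictMonoOn u (Icc t0 t1) := by
    apply strictMonoOn_of_deriv_pos (convex_Icc t0 t1)
    · exact fun x hx => ((hu.hasDeriv x (ht0.trans hx.1)).continuousWithinAt).mono
        fun y hy => ht0.trans hy.1
    · intro x hx
      rw [interior_Icc] at hx
      rw [(hud x (ht0.trans_lt hx.1)).deriv]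
      exact hpos x hx
  have hwu : ∀ t, 0 < u' t → |u' t| ^ (p - 2) * u' t = u' t ^ (p - 1) := by
    intro t h
    rw [abs_of_pos h, ← Real.rpow_add_one h.ne']
    ring_nf
  have hw1 : |u' t1| ^ (p - 2) * u' t1 = 0 := by rw [ht1, mul_zero]
  have hf0 : 0 ≤ f (u t1) := by
    have hlim := (hasDerivAt_iff_tendsto_slope_left_right.1 (hu.ode t1 ht1pos)).1
    have hle : -(f (u t1)) ≤ 0 := by
      refine le_of_tendsto hlim ?_
      filter_upwards [Ioo_mem_nhdsLT ht01] with t ht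
      rw [slope_def_field, hw1, sub_zero, hwu t (hpos t ht)]
      exact div_nonpos_of_nonneg_of_nonpos (Real.rpow_nonneg (hpos t ht).le _)
        (sub_nonpos.2 ht.2.le)
    linarith
  refine hf0.lt_of_ne fun hz => ?_
  have hlimsup := (hsmp (u t1) ⟨hu.nonneg t1 ht1pos.le, hz.symm⟩).2
  obtain ⟨C, hC, -⟩ := EReal.lt_iff_exists_real_btwn.1 hlimsup
  have hev := eventually_lt_of_limsup_lt hC
  have htend : Tendsto u (𝓝[<] t1) (𝓝[Ico 0 (u t1)] (u t1)) := by
    refine tendsto_nhdsWithin_iff.2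
      ⟨(hud t1 ht1pos).continuousAt.tendsto.mono_left nhdsWithin_le_nhds, ?_⟩
    filter_upwards [Ioo_mem_nhdsLT ht01] with t ht
    exact ⟨hu.nonneg t (ht0.trans ht.1.le),
      hmono ⟨ht.1.le, ht.2.le⟩ ⟨ht01.le, le_rfl⟩ ht.2⟩
  obtain ⟨l, hl, hsub⟩ := (mem_nhdsLT_iff_exists_Ioo_subset' ht01).1
    ((htend.eventually hev).and (Ioo_mem_nhdsLT ht01))
  obtain ⟨a, hla, hat⟩ := exists_between (mem_Iio.1 hl)
  have hmem : ∀ t ∈ Ico a t1, _ := fun t ht => hsub ⟨hla.trans_le ht.1, ht.2⟩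
  have hta : t0 < a := (hmem a ⟨le_rfl, hat⟩).2.1
  have hpos' : ∀ t ∈ Icc a t1, 0 < t := fun t ht => ht0.trans_lt (hta.trans_le ht.1)
  refine false_of_rpow_slope_bound (C := max C 1) (w := fun s => |u' s| ^ (p - 2) * u' s)
    (g := fun t => f (u t)) hp (by positivity) hat
    (fun t ht => hud t (hpos' t ht)) (fun t ht => hu.ode t (hpos' t ht))
    (fun t ht => hpos t (hmem t ht).2) (fun t ht => hwu t (hpos t (hmem t ht).2)) hw1
    (hmono.mono (Icc_subset_Icc_left hta.le)) fun t ht => ?_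
  have hv : 0 < u t1 - u t :=
    sub_pos.2 (hmono ⟨hta.le.trans ht.1, ht.2.le⟩ ⟨ht01.le, le_rfl⟩ ht.2)
  have hlt := EReal.coe_lt_coe_iff.1 (hmem t ht).1
  rw [div_lt_iff₀ (Real.rpow_pos_of_pos hv _)] at hlt
  exact hlt.le.trans (by gcongr; exact le_max_left _ _)
end

section
/- Assume f(0) < 0. For each ρ ∈ P_f, set t* := ((p−1)/p)^{1/p} ∫_0^ρ (F(ρ)−F(s))^{−1/p} ds (a finite positive number). Then there exists a unique solution ũ_ρ of problem (1D) such that ũ_ρ′(t) > 0 for all t ∈ (0, t*), ũ_ρ′(0) = ũ_ρ′(t*) = 0, ũ_ρ(t*) = ρ, and ũ_ρ(t + 2k t*) = ũ_ρ(t) and ũ_ρ(t + (2k+1) t*) = ũ_ρ(t* − t) for all t ∈ [0, t*] and all natural numbers k. -/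
open Real Filter Set Topology MeasureTheory

/-- The set `P_f = {z > 0 : F(t) < 0 = F(z) for all t ∈ (0,z) and f(z) > 0}`. -/
def Pf (f : ℝ → ℝ) : Set ℝ :=
  {z : ℝ | 0 < z ∧ 0 < f z ∧ Fint f z = 0 ∧ ∀ t ∈ Set.Ioo 0 z, Fint f t < 0}

/-- A function which is continuous on `[a, b]`, whose derivative in the interior extends
continuously to `[a, b]`, is differentiable within `[a, b]` up to the end points. -/
theorem hasDerivWithinAt_Icc_of_continuousOn {a b : ℝ} {h h' : ℝ → ℝ} (hab : a < b)
    (hc : ContinuousOn h (Icc a b)) (hc' : ContinuousOn h' (Icc a b))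
    (hd : ∀ t ∈ Ioo a b, HasDerivAt h (h' t) t) :
    ∀ t ∈ Icc a b, HasDerivWithinAt h (h' t) (Icc a b) t := by
  have hdiff : DifferentiableOn ℝ h (Ioo a b) := fun x hx =>
    (hd x hx).differentiableAt.differentiableWithinAt
  intro t ht
  rcases eq_or_lt_of_le ht.1 with rfl | hat
  · refine (hasDerivWithinAt_Ici_of_tendsto_deriv hdiff
      ((hc a ht).mono Ioo_subset_Icc_self) (Ioo_mem_nhdsGT hab) ?_).mono Icc_subset_Ici_self
    rw [← nhdsWithin_Ioo_eq_nhdsGT hab]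
    refine ((hc' a ht).mono Ioo_subset_Icc_self).tendsto.congr' ?_
    filter_upwards [self_mem_nhdsWithin] with x hx using (hd x hx).deriv.symm
  rcases eq_or_lt_of_le ht.2 with rfl | htb
  · refine (hasDerivWithinAt_Iic_of_tendsto_deriv hdiff
      ((hc t ht).mono Ioo_subset_Icc_self) (Ioo_mem_nhdsLT hab) ?_).mono Icc_subset_Iic_self
    rw [← nhdsWithin_Ioo_eq_nhdsLT hab]
    refine ((hc' t ht).mono Ioo_subset_Icc_self).tendsto.congr' ?_
    filter_upwards [self_mem_nhdsWithin] with x hx using (hd x hx).deriv.symm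
  · exact (hd t ⟨hat, htb⟩).hasDerivWithinAt

/-- A function that is even (`ε = 1`) or odd (`ε = -1`) about both `0` and `T` is differentiable
on the whole line as soon as it is differentiable within `[0, T]`, provided the
candidate derivative has the opposite parity. -/
theorem hasDerivAt_of_reflection {T ε : ℝ} {h h' : ℝ → ℝ} (hT : 0 < T) (hε : ε * ε = 1)
    (h0 : ∀ t, h (-t) = ε * h t) (hT1 : ∀ t, h (2 * T - t) = ε * h t)
    (h0' : ∀ t, h' (-t) = -ε * h' t) (hT1' : ∀ t, h' (2 * T - t) = -ε * h' t)
    (hd : ∀ t ∈ Icc 0 T, HasDerivWithinAt h (h' t) (Icc 0 T) t) (t : ℝ) :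
    HasDerivAt h (h' t) t := by
  have reflect : ∀ c : ℝ, (∀ t, h (c - t) = ε * h t) → (∀ t, h' (c - t) = -ε * h' t) →
      ∀ (s : Set ℝ) (t : ℝ), HasDerivWithinAt h (h' t) s t →
        HasDerivWithinAt h (h' (c - t)) ((fun x => c - x) ⁻¹' s) (c - t) := by
    intro c hc hc' s t hst
    have h1 : HasDerivWithinAt (fun x : ℝ => c - x) (-1) ((fun x => c - x) ⁻¹' s) (c - t) := by
      simpa using ((hasDerivAt_id (c - t)).const_sub c).hasDerivWithinAt
    have h2 := (HasDerivWithinAt.scomp_of_eq (c - t) hst h1 (fun x hx => hx) (by ring)).const_mul ε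
    have h3 : (fun x => ε * (h ∘ fun x => c - x) x) = h := by
      funext x
      simp only [Function.comp_apply, hc, ← mul_assoc, hε, one_mul]
    rw [h3] at h2
    have h4 : ε * (-1 : ℝ) • h' t = -ε * h' t := by
      rw [smul_eq_mul]
      ring
    rwa [h4, ← hc'] at h2
  have h0'' : ∀ t, h (0 - t) = ε * h t := by simpa using h0
  have h0''' : ∀ t, h' (0 - t) = -ε * h' t := by simpa using h0'
  have hcore : ∀ t ∈ Icc 0 T, HasDerivAt h (h' t) t := by
    intro t ht
    have hR : t < T → HasDerivWithinAt h (h' t) (Ici t) t := fun h =>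
      (hd t ht).mono_of_mem_nhdsWithin (mem_of_superset (Icc_mem_nhdsGE h)
        (Icc_subset_Icc_left ht.1))
    have hL : 0 < t → HasDerivWithinAt h (h' t) (Iic t) t := fun h =>
      (hd t ht).mono_of_mem_nhdsWithin (mem_of_superset (Icc_mem_nhdsLE h)
        (Icc_subset_Icc_right ht.2))
    have glue : HasDerivWithinAt h (h' t) (Iic t) t → HasDerivWithinAt h (h' t) (Ici t) t →
        HasDerivAt h (h' t) t := fun a b => by
      simpa [Iic_union_Ici, hasDerivWithinAt_univ] using a.union b
    rcases eq_or_lt_of_le ht.1 with rfl | h0t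
    · refine glue ?_ (hR hT)
      simpa using reflect 0 h0'' h0''' _ 0 (hR hT)
    rcases eq_or_lt_of_le ht.2 with rfl | htT
    · refine glue (hL hT) ?_
      have := reflect (2 * t) hT1 hT1' _ t (hL hT)
      rw [show 2 * t - t = t by ring] at this
      refine this.mono fun x hx => ?_
      simp only [mem_Ici, mem_preimage, mem_Iic] at hx ⊢
      linarith
    · exact glue (hL h0t) (hR htT)
  have hper : Function.Periodic h (2 * T) := fun x => by
    rw [show x + 2 * T = 2 * T - -x by ring, hT1, h0, ← mul_assoc, hε, one_mul]
  have hper' : Function.Periodic h' (2 * T) := fun x => by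
    rw [show x + 2 * T = 2 * T - -x by ring, hT1', h0', ← mul_assoc, neg_mul_neg, hε, one_mul]
  have hcore2 : ∀ t ∈ Icc (-T) T, HasDerivAt h (h' t) t := by
    intro t ht
    rcases le_total 0 t with h | h
    · exact hcore t ⟨h, ht.2⟩
    · have := reflect 0 h0'' h0''' univ (-t)
        (hcore (-t) ⟨by linarith, by linarith [ht.1]⟩).hasDerivWithinAt
      simpa using this
  obtain ⟨n, hn⟩ : ∃ n : ℤ, t - n * (2 * T) ∈ Icc (-T) T := by
    refine ⟨toIcoDiv (by linarith : 0 < 2 * T) (-T) t, ?_⟩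
    have := sub_toIcoDiv_zsmul_mem_Ico (by linarith : 0 < 2 * T) (-T) t
    rw [zsmul_eq_mul] at this
    exact ⟨this.1, by linarith [this.2]⟩
  have h1 := (hcore2 _ hn).comp_sub_const t (n * (2 * T))
  rw [hper'.sub_int_mul_eq n] at h1
  exact h1.congr_of_eventuallyEq (Eventually.of_forall fun x => (hper.sub_int_mul_eq n).symm)

theorem eq_left_of_hasDerivAt_zero {a b : ℝ} {h : ℝ → ℝ} (hc : ContinuousOn h (Icc a b))
    (hd : ∀ t ∈ Ioo a b, HasDerivAt h 0 t) : ∀ t ∈ Icc a b, h t = h a := by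
  intro t ht
  rcases lt_or_ge a b with hab | hab
  · exact constant_of_has_deriv_right_zero hc (fun x hx =>
      (hasDerivWithinAt_Icc_of_continuousOn hab hc continuousOn_const hd x
        (Ico_subset_Icc_self hx)).mono_of_mem_nhdsWithin
          (mem_of_superset (Icc_mem_nhdsGE hx.2) (Icc_subset_Icc_left hx.1))) t ht
  · rw [le_antisymm (ht.2.trans hab) ht.1]

/-- If `A` vanishes with nonzero slope at the ends of `[0, ρ]` and is positive in between, then
`A ^ (-r)` is integrable for `r < 1`. -/
theorem intervalIntegrable_rpow_neg_of_simple_zeros {A a : ℝ → ℝ} {ρ r : ℝ} (hρ : 0 < ρ)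
    (hr : 0 < r) (hr1 : r < 1) (hA : ∀ x, HasDerivAt A (a x) x) (hA0 : A 0 = 0) (hAρ : A ρ = 0)
    (hpos : ∀ x ∈ Ioo 0 ρ, 0 < A x) (ha0 : 0 < a 0) (haρ : a ρ < 0) :
    IntervalIntegrable (fun s => A s ^ (-r)) volume 0 ρ := by
  have hcont : Continuous A := continuous_iff_continuousAt.2 fun x => (hA x).continuousAt
  have hmeas : ∀ l, StronglyMeasurableAtFilter (fun s => A s ^ (-r)) l volume := fun l =>
    ⟨univ, univ_mem, ((hcont.measurable.pow_const _).stronglyMeasurable).aestronglyMeasurable⟩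
  have bound : ∀ (c x y : ℝ), 0 < c → 0 < x → c * x ≤ y → ‖y ^ (-r)‖ ≤ c ^ (-r) * ‖x ^ (-r)‖ := by
    intro c x y hc hx hxy
    have hcx := mul_pos hc hx
    rw [Real.norm_of_nonneg (rpow_nonneg (hcx.le.trans hxy) _),
      Real.norm_of_nonneg (rpow_nonneg hx.le _), ← mul_rpow hc.le hx.le]
    exact rpow_le_rpow_of_nonpos hcx hxy (by linarith)
  have h0 : IntegrableAtFilter (fun s => A s ^ (-r)) (𝓝[>] 0) volume := by
    refine Asymptotics.IsBigO.integrableAtFilter (g := fun s => s ^ (-r)) ?_ (hmeas _) ?_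
    · refine Asymptotics.IsBigO.of_bound ((a 0 / 2) ^ (-r)) ?_
      have := hasDerivAt_iff_tendsto_slope.1 (hA 0)
      have h2 := (this.mono_left (nhdsGT_le_nhdsNE (0:ℝ))).eventually
        (lt_mem_nhds (by linarith : a 0 / 2 < a 0))
      filter_upwards [h2, self_mem_nhdsWithin] with x hx hx0
      have hx0 : 0 < x := hx0
      refine bound _ _ _ (by linarith) hx0 ?_
      rw [slope_def_field, hA0, sub_zero, sub_zero, lt_div_iff₀ hx0] at hx
      exact hx.le
    · refine ⟨Ioc 0 1, Ioc_mem_nhdsGT one_pos, ?_⟩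
      exact (intervalIntegrable_iff_integrableOn_Ioc_of_le zero_le_one).1
        (intervalIntegral.intervalIntegrable_rpow' (by linarith))
  have h1 : IntegrableAtFilter (fun s => A s ^ (-r)) (𝓝[<] ρ) volume := by
    refine Asymptotics.IsBigO.integrableAtFilter (g := fun s => (ρ - s) ^ (-r)) ?_ (hmeas _) ?_
    · refine Asymptotics.IsBigO.of_bound ((-a ρ / 2) ^ (-r)) ?_
      have := hasDerivAt_iff_tendsto_slope.1 (hA ρ)
      have h2 := (this.mono_left (nhdsLT_le_nhdsNE ρ)).eventually
        (gt_mem_nhds (by linarith : a ρ < a ρ / 2))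
      filter_upwards [h2, self_mem_nhdsWithin] with x hx hx0
      have hx0 : x < ρ := hx0
      refine bound _ _ _ (by linarith) (by linarith) ?_
      rw [slope_def_field, hAρ, div_lt_iff_of_neg (by linarith)] at hx
      linarith
    · refine ⟨Ico 0 ρ, Ico_mem_nhdsLT hρ, ?_⟩
      have := (intervalIntegral.intervalIntegrable_rpow' (a := 0) (b := ρ)
        (by linarith : -1 < -r)).comp_sub_left ρ
      rw [sub_zero, sub_self] at this
      exact ((intervalIntegrable_iff_integrableOn_Icc_of_le hρ.le).1 this.symm).mono_set
        Ico_subset_Icc_self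
  rw [intervalIntegrable_iff_integrableOn_Ioo_of_le hρ.le]
  have hc : ContinuousOn (fun s => A s ^ (-r)) (Ioo 0 ρ) := fun x hx =>
    (hcont.continuousAt.rpow_const (Or.inl (hpos x hx).ne')).continuousWithinAt
  obtain ⟨s, hs, hsi⟩ := h0
  obtain ⟨s', hs', hsi'⟩ := h1
  obtain ⟨α, hα, hαs⟩ := mem_nhdsGT_iff_exists_Ioc_subset.1 hs
  obtain ⟨β, hβ, hβs⟩ := mem_nhdsLT_iff_exists_Ico_subset.1 hs'
  have hmid : IntegrableOn (fun s => A s ^ (-r)) (Icc α β) volume :=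
    (hc.mono fun x hx => ⟨lt_of_lt_of_le hα hx.1, lt_of_le_of_lt hx.2 hβ⟩).integrableOn_Icc
  refine ((hsi.union hsi').union hmid).mono_set fun x hx => ?_
  rcases le_total x α with h | h
  · exact Or.inl (Or.inl (hαs ⟨hx.1, h⟩))
  rcases le_total β x with h' | h'
  · exact Or.inl (Or.inr (hβs ⟨h', hx.2⟩))
  · exact Or.inr ⟨h, h'⟩

section TimeMap

variable {G : ℝ → ℝ} {ρ : ℝ}

theorem hasDerivAt_timeMap (hG : ContinuousOn G (Ioo 0 ρ)) (hint : IntervalIntegrable G volume 0 ρ)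
    {x : ℝ} (hx : x ∈ Ioo 0 ρ) : HasDerivAt (fun y => ∫ s in (0:ℝ)..y, G s) (G x) x := by
  refine intervalIntegral.integral_hasDerivAt_right (hint.mono_set ?_)
    (hG.stronglyMeasurableAtFilter isOpen_Ioo x hx) (hG.continuousAt (isOpen_Ioo.mem_nhds hx))
  rw [uIcc_of_le hx.1.le, uIcc_of_le (hx.1.trans hx.2).le]
  exact Icc_subset_Icc_right hx.2.le

theorem continuousOn_timeMap (hρ : 0 < ρ) (hint : IntervalIntegrable G volume 0 ρ) :
    ContinuousOn (fun y => ∫ s in (0:ℝ)..y, G s) (Icc 0 ρ) := by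
  have := intervalIntegral.continuousOn_primitive_interval'
    (μ := volume) (f := G) (a := 0) (b₁ := 0) (b₂ := ρ) hint left_mem_uIcc
  rwa [uIcc_of_le hρ.le] at this

theorem strictMonoOn_timeMap (hρ : 0 < ρ) (hG : ContinuousOn G (Ioo 0 ρ))
    (hint : IntervalIntegrable G volume 0 ρ) (hpos : ∀ x ∈ Ioo 0 ρ, 0 < G x) :
    StrictMonoOn (fun y => ∫ s in (0:ℝ)..y, G s) (Icc 0 ρ) := by
  refine strictMonoOn_of_deriv_pos (convex_Icc 0 ρ) (continuousOn_timeMap hρ hint) fun x hx => ?_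
  rw [interior_Icc] at hx
  rw [(hasDerivAt_timeMap hG hint hx).deriv]
  exact hpos x hx

/-- The separable equation `u' = 1 / G(u)` has an increasing solution joining `0` to `ρ`. -/
theorem exists_timeMap_inverse (hρ : 0 < ρ) (hG : ContinuousOn G (Ioo 0 ρ))
    (hint : IntervalIntegrable G volume 0 ρ) (hpos : ∀ x ∈ Ioo 0 ρ, 0 < G x)
    {T : ℝ} (hT : T = ∫ s in (0:ℝ)..ρ, G s) :
    0 < T ∧ ∃ U : ℝ → ℝ, Continuous U ∧ (∀ t, U t ∈ Icc 0 ρ) ∧ U 0 = 0 ∧ U T = ρ ∧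
      ∀ t ∈ Ioo 0 T, U t ∈ Ioo 0 ρ ∧ HasDerivAt U (G (U t))⁻¹ t := by
  set τ : ℝ → ℝ := fun y => ∫ s in (0:ℝ)..y, G s with hτ
  have hmono : StrictMonoOn τ (Icc 0 ρ) := strictMonoOn_timeMap hρ hG hint hpos
  have hcont : ContinuousOn τ (Icc 0 ρ) := continuousOn_timeMap hρ hint
  have hτ0 : τ 0 = 0 := intervalIntegral.integral_same
  have hτρ : τ ρ = T := hT.symm
  have h0 : (0:ℝ) ∈ Icc 0 ρ := left_mem_Icc.2 hρ.le
  have h1 : ρ ∈ Icc 0 ρ := right_mem_Icc.2 hρ.le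
  have hTpos : 0 < T := by
    rw [← hτ0, ← hτρ]
    exact hmono h0 h1 hρ
  refine ⟨hTpos, ?_⟩
  have hbij : BijOn τ (Icc 0 ρ) (Icc 0 T) := by
    refine ⟨fun x hx => ?_, hmono.injOn, ?_⟩
    · rw [← hτ0, ← hτρ]
      exact ⟨hmono.monotoneOn h0 hx hx.1, hmono.monotoneOn hx h1 hx.2⟩
    · have := intermediate_value_Icc hρ.le hcont
      rwa [hτ0, hτρ] at this
  let e : Icc 0 ρ ≃ Icc 0 T := BijOn.equiv τ hbij
  have he : Continuous e := by
    refine Continuous.subtype_mk ?_ _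
    exact continuousOn_iff_continuous_domRestrict.1 hcont
  let E : Icc 0 ρ ≃ₜ Icc 0 T := he.homeoOfEquivCompactToT2
  let U : ℝ → ℝ := fun t => (E.symm (projIcc 0 T hTpos.le t) : ℝ)
  have hUcont : Continuous U :=
    continuous_subtype_val.comp (E.symm.continuous.comp continuous_projIcc)
  have hUmem : ∀ t, U t ∈ Icc 0 ρ := fun t => (E.symm _).2
  have hτU : ∀ t ∈ Icc 0 T, τ (U t) = t := by
    intro t ht
    have h2 : E (E.symm (projIcc 0 T hTpos.le t)) = ⟨t, ht⟩ := by
      rw [E.apply_symm_apply, projIcc_of_mem _ ht]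
    exact congrArg Subtype.val h2
  have hU0 : U 0 = 0 := hmono.injOn (hUmem 0) h0 (by rw [hτU 0 ⟨le_rfl, hTpos.le⟩, hτ0])
  have hUT : U T = ρ := hmono.injOn (hUmem T) h1 (by rw [hτU T ⟨hTpos.le, le_rfl⟩, hτρ])
  refine ⟨U, hUcont, hUmem, hU0, hUT, fun t ht => ?_⟩
  have hUt : U t ∈ Ioo 0 ρ := by
    refine ⟨lt_of_le_of_ne (hUmem t).1 fun h => ?_, lt_of_le_of_ne (hUmem t).2 fun h => ?_⟩
    · have := hτU t (Ioo_subset_Icc_self ht)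
      rw [← h, hτ0] at this
      exact ht.1.ne this
    · have := hτU t (Ioo_subset_Icc_self ht)
      rw [h, hτρ] at this
      exact ht.2.ne this.symm
  refine ⟨hUt, HasDerivAt.of_local_left_inverse hUcont.continuousAt
    (hasDerivAt_timeMap hG hint hUt) (hpos _ hUt).ne' ?_⟩
  filter_upwards [Ioo_mem_nhds ht.1 ht.2] with s hs using hτU s (Ioo_subset_Icc_self hs)

/-- A solution of `u' = 1 / G(u)` starting from `0` is the inverse of the time map. -/
theorem timeMap_apply_of_solution (hρ : 0 < ρ) (hG : ContinuousOn G (Ioo 0 ρ))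
    (hint : IntervalIntegrable G volume 0 ρ) (hpos : ∀ x ∈ Ioo 0 ρ, 0 < G x)
    {T : ℝ} {u : ℝ → ℝ} (hu : ContinuousOn u (Icc 0 T)) (hu0 : u 0 = 0)
    (hmem : ∀ t ∈ Icc 0 T, u t ∈ Icc 0 ρ) (hmem' : ∀ t ∈ Ioo 0 T, u t ∈ Ioo 0 ρ)
    (hd : ∀ t ∈ Ioo 0 T, HasDerivAt u (G (u t))⁻¹ t) :
    ∀ t ∈ Icc 0 T, ∫ s in (0:ℝ)..u t, G s = t := by
  intro t ht
  have hc : ContinuousOn (fun t => (∫ s in (0:ℝ)..u t, G s) - t) (Icc 0 T) :=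
    ((continuousOn_timeMap hρ hint).comp hu hmem).sub continuousOn_id
  have hderiv : ∀ x ∈ Ioo 0 T, HasDerivAt (fun t => (∫ s in (0:ℝ)..u t, G s) - t) 0 x := by
    intro x hx
    have h1 := ((hasDerivAt_timeMap hG hint (hmem' x hx)).comp x (hd x hx)).sub (hasDerivAt_id x)
    rw [mul_inv_cancel₀ (hpos _ (hmem' x hx)).ne', sub_self] at h1
    exact h1
  have := eq_left_of_hasDerivAt_zero hc hderiv t ht
  simp only [hu0, intervalIntegral.integral_same, sub_zero] at this
  linarith

end TimeMap

section Potential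

variable {p : ℝ} {f A : ℝ → ℝ} {ρ T : ℝ}

/-- The rescaled potential `-(p / (p - 1)) F` extends to a differentiable function on the line. -/
theorem exists_potential (p : ℝ) (hfc : ContinuousOn f (Ici 0)) :
    ∃ A : ℝ → ℝ, (∀ x, HasDerivAt A (-(p / (p - 1)) * f (max x 0)) x) ∧
      ∀ x, 0 ≤ x → A x = -(p / (p - 1)) * Fint f x := by
  have hc : Continuous fun s => f (max s 0) :=
    hfc.comp_continuous (by fun_prop) fun x => mem_Ici.2 (le_max_right x 0)
  refine ⟨fun x => -(p / (p - 1)) * ∫ s in (0:ℝ)..x, f (max s 0), fun x =>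
    (hc.integral_hasStrictDerivAt 0 x).hasDerivAt.const_mul _, fun x hx => ?_⟩
  refine congrArg (-(p / (p - 1)) * ·) (intervalIntegral.integral_congr fun s hs => ?_)
  rw [uIcc_of_le hx] at hs
  simp only [max_eq_left hs.1]

theorem abs_rpow_sub_two_mul_self (hp : 1 < p) {x : ℝ} (hx : 0 ≤ x) :
    |x| ^ (p - 2) * x = x ^ (p - 1) := by
  rcases eq_or_lt_of_le hx with rfl | hx
  · rw [mul_zero, zero_rpow (by linarith)]
  · rw [abs_of_pos hx, ← rpow_add_one hx.ne']
    congr 1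
    ring

/-- Conservation of energy along an increasing branch of a solution. -/
theorem Sol1D.deriv_eq_rpow (hp : 1 < p)
    (hA : ∀ x, HasDerivAt A (-(p / (p - 1)) * f (max x 0)) x) (hAρ : A ρ = 0)
    {w w' : ℝ → ℝ} (hw : Sol1D p f w w') (hpos : ∀ t ∈ Ioo 0 T, 0 < w' t) (hT : w' T = 0)
    (hwT : w T = ρ) {t : ℝ} (ht : t ∈ Ioo 0 T) : w' t = A (w t) ^ (1 / p) := by
  have hp0 : 0 < p := by linarith
  have hp1 : 0 < p - 1 := by linarith
  have hAc : Continuous A := continuous_iff_continuousAt.2 fun x => (hA x).continuousAt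
  have hwc : ContinuousOn w (Icc 0 T) := fun x hx =>
    (hw.hasDeriv x hx.1).continuousWithinAt.mono Icc_subset_Ici_self
  have hc : ContinuousOn (fun s => |w' s| ^ p - A (w s)) (Icc 0 T) :=
    ((hw.derivCont.mono Icc_subset_Ici_self).abs.rpow_const fun _ _ => Or.inr hp0.le).sub
      (hAc.comp_continuousOn hwc)
  have hd : ∀ s ∈ Ioo 0 T, HasDerivAt (fun s => |w' s| ^ p - A (w s)) 0 s := by
    intro s hs
    have hφ : ∀ x, 0 < w' x →
        (|w' x| ^ (p - 2) * w' x) ^ (p / (p - 1)) = |w' x| ^ p := fun x hx => by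
      rw [abs_rpow_sub_two_mul_self hp hx.le, ← rpow_mul hx.le, mul_div_cancel₀ _ hp1.ne',
        abs_of_pos hx]
    have hws := hpos s hs
    have h1 := (hw.ode s hs.1).rpow_const (p := p / (p - 1)) (Or.inl (by positivity))
    have h2 : HasDerivAt (fun s => A (w s)) (-(p / (p - 1)) * f (w s) * w' s) s := by
      have := (hA (w s)).comp s ((hw.hasDeriv s hs.1.le).hasDerivAt (Ici_mem_nhds hs.1))
      rwa [max_eq_left (hw.nonneg s hs.1.le)] at this
    have h3 : (|w' s| ^ (p - 2) * w' s) ^ (p / (p - 1) - 1) = w' s := by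
      rw [abs_rpow_sub_two_mul_self hp hws.le, ← rpow_mul hws.le,
        show (p - 1) * (p / (p - 1) - 1) = 1 by field_simp; ring, rpow_one]
    rw [h3] at h1
    have h4 := (h1.congr_of_eventuallyEq (f₁ := fun x => |w' x| ^ p) (by
      filter_upwards [Ioo_mem_nhds hs.1 hs.2] with x hx using (hφ x (hpos x hx)).symm)).sub h2
    exact h4.congr_deriv (by ring)
  have hconst := eq_left_of_hasDerivAt_zero hc hd
  have hTpos : 0 < T := ht.1.trans ht.2
  have hE := (hconst t (Ioo_subset_Icc_self ht)).trans (hconst T ⟨hTpos.le, le_rfl⟩).symm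
  simp only [hT, hwT, hAρ, abs_zero, zero_rpow hp0.ne', sub_zero] at hE
  rw [← sub_eq_zero.1 hE, abs_of_pos (hpos t ht), ← rpow_mul (hpos t ht).le,
    mul_one_div_cancel hp0.ne', rpow_one]

theorem Sol1D.timeMap_apply (hp : 1 < p) (hρ : 0 < ρ)
    (hA : ∀ x, HasDerivAt A (-(p / (p - 1)) * f (max x 0)) x) (hAρ : A ρ = 0)
    (hApos : ∀ x ∈ Ioo 0 ρ, 0 < A x)
    (hint : IntervalIntegrable (fun s => A s ^ (-(1 / p))) volume 0 ρ)
    {w w' : ℝ → ℝ} (hw : Sol1D p f w w') (hTpos : 0 < T) (hpos : ∀ t ∈ Ioo 0 T, 0 < w' t)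
    (hT : w' T = 0) (hwT : w T = ρ) :
    ∀ t ∈ Icc 0 T, w t ∈ Icc 0 ρ ∧ ∫ s in (0:ℝ)..w t, A s ^ (-(1 / p)) = t := by
  have hAc : Continuous A := continuous_iff_continuousAt.2 fun x => (hA x).continuousAt
  have hwc : ContinuousOn w (Icc 0 T) := fun x hx =>
    (hw.hasDeriv x hx.1).continuousWithinAt.mono Icc_subset_Ici_self
  have hwd : ∀ t ∈ Ioo 0 T, HasDerivAt w (w' t) t := fun t ht =>
    (hw.hasDeriv t ht.1.le).hasDerivAt (Ici_mem_nhds ht.1)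
  have hmono : StrictMonoOn w (Icc 0 T) := by
    refine strictMonoOn_of_deriv_pos (convex_Icc 0 T) hwc fun x hx => ?_
    rw [interior_Icc] at hx
    rw [(hwd x hx).deriv]
    exact hpos x hx
  have h0 : (0:ℝ) ∈ Icc 0 T := left_mem_Icc.2 hTpos.le
  have h1 : T ∈ Icc 0 T := right_mem_Icc.2 hTpos.le
  have hmem : ∀ t ∈ Icc 0 T, w t ∈ Icc 0 ρ := fun t ht =>
    ⟨hw.nonneg t ht.1, hwT ▸ hmono.monotoneOn ht h1 ht.2⟩
  have hmem' : ∀ t ∈ Ioo 0 T, w t ∈ Ioo 0 ρ := fun t ht =>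
    ⟨hw.zeroAtZero ▸ hmono h0 (Ioo_subset_Icc_self ht) ht.1,
      hwT ▸ hmono (Ioo_subset_Icc_self ht) h1 ht.2⟩
  intro t ht
  refine ⟨hmem t ht, timeMap_apply_of_solution (G := fun s => A s ^ (-(1 / p))) hρ ?_ hint ?_ hwc
    hw.zeroAtZero hmem hmem' ?_ t ht⟩
  · exact fun x hx => (hAc.continuousAt.rpow_const (Or.inl (hApos x hx).ne')).continuousWithinAt
  · exact fun x hx => rpow_pos_of_pos (hApos x hx) _
  · intro s hs
    have := hwd s hs
    rw [hw.deriv_eq_rpow hp hA hAρ hpos hT hwT hs] at this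
    simpa only [rpow_neg (hApos _ (hmem' s hs)).le, inv_inv] using this

/-- Functions on `[0, ∞)` obtained from their values on `[0, T]` by the same reflections agree as
soon as they agree on `[0, T]`. -/
theorem eq_of_eq_on_Icc_of_reflection (hT : 0 < T) {v w : ℝ → ℝ}
    (hv : ∀ t ∈ Icc 0 T, ∀ k : ℕ,
      v (t + 2 * (k:ℝ) * T) = v t ∧ v (t + (2 * (k:ℝ) + 1) * T) = v (T - t))
    (hw : ∀ t ∈ Icc 0 T, ∀ k : ℕ,
      w (t + 2 * (k:ℝ) * T) = w t ∧ w (t + (2 * (k:ℝ) + 1) * T) = w (T - t))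
    (h : ∀ t ∈ Icc 0 T, w t = v t) : ∀ t ∈ Ici (0:ℝ), w t = v t := by
  intro t ht
  have hn0 : 0 ≤ t / T := div_nonneg ht hT.le
  have hn1 := Nat.floor_le hn0
  have hn2 := Nat.lt_floor_add_one (t / T)
  set n := ⌊t / T⌋₊
  rw [le_div_iff₀ hT] at hn1
  rw [div_lt_iff₀ hT] at hn2
  have hs : t - n * T ∈ Icc 0 T := ⟨by linarith, by linarith⟩
  have hsr : T - (t - n * T) ∈ Icc 0 T := ⟨by linarith, by linarith⟩
  obtain ⟨k, hk | hk⟩ := Nat.even_or_odd' n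
  · have ht' : t = (t - n * T) + 2 * (k:ℝ) * T := by
      rw [hk]
      push_cast
      ring
    rw [ht', (hw _ hs k).1, (hv _ hs k).1, h _ hs]
  · have ht' : t = (t - n * T) + (2 * (k:ℝ) + 1) * T := by
      rw [hk]
      push_cast
      ring
    rw [ht', (hw _ hs k).2, (hv _ hs k).2, h _ hsr]

/-- The symmetric periodic extension of the increasing branch solves the problem. -/
theorem exists_sol1D_of_branch (hp : 1 < p) (hTpos : 0 < T) (hfc : ContinuousOn f (Ici 0))
    (hA : ∀ x, HasDerivAt A (-(p / (p - 1)) * f (max x 0)) x) (hA0 : A 0 = 0) (hAρ : A ρ = 0)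
    (hApos : ∀ x ∈ Ioo 0 ρ, 0 < A x) {U : ℝ → ℝ} (hU : Continuous U) (hmem : ∀ t, U t ∈ Icc 0 ρ)
    (hU0 : U 0 = 0) (hUT : U T = ρ)
    (hUd : ∀ t ∈ Ioo 0 T, U t ∈ Ioo 0 ρ ∧ HasDerivAt U (A (U t) ^ (-(1 / p)))⁻¹ t) :
    ∃ v v' : ℝ → ℝ, Sol1D p f v v' ∧ (∀ t ∈ Ioo 0 T, 0 < v' t) ∧ v' 0 = 0 ∧ v' T = 0 ∧ v T = ρ ∧
      ∀ t ∈ Icc 0 T, ∀ k : ℕ,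
        v (t + 2 * (k:ℝ) * T) = v t ∧ v (t + (2 * (k:ℝ) + 1) * T) = v (T - t) := by
  have hp0 : 0 < p := by linarith
  have hp1 : 0 < p - 1 := by linarith
  have hr : 0 < 1 / p := by positivity
  have hr1 : 0 < (p - 1) / p := by positivity
  have hAc : Continuous A := continuous_iff_continuousAt.2 fun x => (hA x).continuousAt
  let v : ℝ → ℝ := fun t => U (T / π * arccos (cos (π * t / T)))
  let v' : ℝ → ℝ := fun t => Real.sign (sin (π * t / T)) * A (v t) ^ (1 / p)
  let φ : ℝ → ℝ := fun t => Real.sign (sin (π * t / T)) * A (v t) ^ ((p - 1) / p)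
  have hvc : Continuous v := hU.comp (continuous_const.mul (continuous_arccos.comp (by fun_prop)))
  have hvmem : ∀ t, v t ∈ Icc 0 ρ := fun t => hmem _
  have hvA : ∀ t, 0 ≤ A (v t) := fun t => by
    rcases eq_or_lt_of_le (hvmem t).1 with h | h
    · rw [← h, hA0]
    rcases eq_or_lt_of_le (hvmem t).2 with h' | h'
    · rw [h', hAρ]
    · exact (hApos _ ⟨h, h'⟩).le
  have hvAzero : ∀ t, sin (π * t / T) = 0 → A (v t) = 0 := by
    intro t ht
    have hcos : cos (π * t / T) = 1 ∨ cos (π * t / T) = -1 := sin_eq_zero_iff_cos_eq.1 ht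
    rcases hcos with h | h
    · simp only [v, h, arccos_one, mul_zero, hU0, hA0]
    · simp only [v, h, arccos_neg_one, div_mul_cancel₀ _ pi_ne_zero, hUT, hAρ]
  have hvU : ∀ t ∈ Icc 0 T, v t = U t := by
    intro t ht
    have h1 : 0 ≤ π * t / T := div_nonneg (mul_nonneg pi_pos.le ht.1) hTpos.le
    have h2 : π * t / T ≤ π := by
      rw [div_le_iff₀ hTpos]
      exact mul_le_mul_of_nonneg_left ht.2 pi_pos.le
    simp only [v, arccos_cos h1 h2]
    congr 1
    field_simp
  have harg : ∀ t, π * -t / T = -(π * t / T) := fun t => by ring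
  have harg' : ∀ t, π * (2 * T - t) / T = 2 * π - π * t / T := fun t => by field_simp
  have hv0 : ∀ t, v (-t) = 1 * v t := fun t => by simp only [v, harg, cos_neg, one_mul]
  have hv1 : ∀ t, v (2 * T - t) = 1 * v t := fun t => by
    simp only [v, harg', cos_two_pi_sub, one_mul]
  have hodd0 : ∀ r t, Real.sign (sin (π * -t / T)) * A (v (-t)) ^ (r : ℝ) =
      -1 * (Real.sign (sin (π * t / T)) * A (v t) ^ r) := fun r t => by
    rw [hv0, harg, sin_neg, Real.sign_neg]
    ring_nf
  have hodd1 : ∀ r t, Real.sign (sin (π * (2 * T - t) / T)) * A (v (2 * T - t)) ^ (r : ℝ) =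
      -1 * (Real.sign (sin (π * t / T)) * A (v t) ^ r) := fun r t => by
    rw [hv1, harg', sin_two_pi_sub, Real.sign_neg]
    ring_nf
  have hon : ∀ r : ℝ, 0 < r → ∀ t ∈ Icc 0 T,
      Real.sign (sin (π * t / T)) * A (v t) ^ r = A (U t) ^ r := by
    intro r hr t ht
    rw [← hvU t ht]
    rcases (sin_nonneg_of_nonneg_of_le_pi (x := π * t / T)
      (div_nonneg (mul_nonneg pi_pos.le ht.1) hTpos.le) (by
        rw [div_le_iff₀ hTpos]
        exact mul_le_mul_of_nonneg_left ht.2 pi_pos.le)).eq_or_lt with h | h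
    · rw [hvAzero t h.symm, zero_rpow hr.ne', mul_zero]
    · rw [Real.sign_of_pos h, one_mul]
  have hAUc : ∀ r : ℝ, 0 < r → Continuous fun t => A (U t) ^ r := fun r hr =>
    (hAc.comp hU).rpow_const fun _ => Or.inr hr.le
  have hcongr : ∀ {g g' d : ℝ → ℝ}, (∀ t ∈ Icc 0 T, g t = g' t) →
      (∀ t ∈ Icc 0 T, HasDerivWithinAt g' (d t) (Icc 0 T) t) →
      ∀ t ∈ Icc 0 T, HasDerivWithinAt g (d t) (Icc 0 T) t := fun hg hd t ht =>
    (hd t ht).congr hg (hg t ht)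
  have hvd : ∀ t, HasDerivAt v (v' t) t := by
    refine hasDerivAt_of_reflection hTpos (one_mul 1) hv0 hv1 (hodd0 _) (hodd1 _)
      (hcongr hvU fun t ht => ?_)
    rw [show v' t = _ from hon _ hr t ht]
    refine hasDerivWithinAt_Icc_of_continuousOn (h' := fun t => A (U t) ^ (1 / p)) hTpos
      hU.continuousOn (hAUc _ hr).continuousOn (fun s hs => ?_) t ht
    have := (hUd s hs).2
    rwa [rpow_neg (hApos _ (hUd s hs).1).le, inv_inv] at this
  have hφd : ∀ t, HasDerivAt φ (-f (v t)) t := by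
    refine hasDerivAt_of_reflection (ε := -1) hTpos (by norm_num) (hodd0 _) (hodd1 _)
      (fun t => by rw [hv0, one_mul, neg_neg, one_mul])
      (fun t => by rw [hv1, one_mul, neg_neg, one_mul]) (hcongr (hon _ hr1) fun t ht => ?_)
    have hfU : Continuous fun t => -f (U t) :=
      (hfc.comp_continuous hU fun t => (hmem t).1).neg
    rw [hvU t ht]
    refine hasDerivWithinAt_Icc_of_continuousOn (h' := fun t => -f (U t)) hTpos
      (hAUc _ hr1).continuousOn hfU.continuousOn (fun s hs => ?_) t ht
    obtain ⟨hUs, hUds⟩ := hUd s hs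
    have hAs := hApos _ hUs
    have h1 := ((hA (U s)).comp s hUds).rpow_const (p := (p - 1) / p) (Or.inl hAs.ne')
    refine h1.congr_deriv ?_
    rw [Function.comp_apply, max_eq_left hUs.1.le, show (p - 1) / p - 1 = -(1 / p) by field_simp; ring]
    have := (rpow_pos_of_pos hAs (-(1 / p))).ne'
    field_simp
  have hφ : ∀ t, |v' t| ^ (p - 2) * v' t = φ t := by
    intro t
    have hx := rpow_nonneg (hvA t) (1 / p)
    have hpow : |A (v t) ^ (1 / p)| ^ (p - 2) * A (v t) ^ (1 / p) = A (v t) ^ ((p - 1) / p) := by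
      rw [abs_rpow_sub_two_mul_self hp hx, ← rpow_mul (hvA t)]
      congr 1
      ring
    rcases lt_trichotomy (sin (π * t / T)) 0 with h | h | h
    · simp only [v', φ, Real.sign_of_neg h, neg_one_mul, abs_neg, mul_neg, hpow]
    · simp only [v', φ, h, Real.sign_zero, zero_mul, mul_zero]
    · simp only [v', φ, Real.sign_of_pos h, one_mul, hpow]
  have hv'c : Continuous v' := by
    have hAvc : Continuous fun t => A (v t) ^ (1 / p) :=
      (hAc.comp hvc).rpow_const fun _ => Or.inr hr.le
    have hsc : Continuous fun t => sin (π * t / T) := by fun_prop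
    refine continuous_iff_continuousAt.2 fun t => ?_
    rcases lt_trichotomy (sin (π * t / T)) 0 with h | h | h
    · refine hAvc.neg.continuousAt.congr ?_
      filter_upwards [hsc.continuousAt.eventually (gt_mem_nhds h)] with s hs
      simp only [v', Real.sign_of_neg hs, neg_one_mul, Pi.neg_apply]
    · have h0 : A (v t) ^ (1 / p) = 0 := by rw [hvAzero t h, zero_rpow hr.ne']
      have hlim := hAvc.tendsto t
      rw [h0] at hlim
      rw [ContinuousAt, show v' t = 0 by simp only [v', h0, mul_zero]]
      refine squeeze_zero_norm (fun s => ?_) hlim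
      rw [norm_mul, Real.norm_of_nonneg (rpow_nonneg (hvA s) _)]
      refine mul_le_of_le_one_left (rpow_nonneg (hvA s) _) ?_
      rcases Real.sign_apply_eq (sin (π * s / T)) with h | h | h <;> simp [h]
    · refine hAvc.continuousAt.congr ?_
      filter_upwards [hsc.continuousAt.eventually (lt_mem_nhds h)] with s hs
      simp only [v', Real.sign_of_pos hs, one_mul]
  have h0mem : (0:ℝ) ∈ Icc 0 T := left_mem_Icc.2 hTpos.le
  have hTmem : T ∈ Icc 0 T := right_mem_Icc.2 hTpos.le
  refine ⟨v, v', ⟨fun t _ => (hvd t).hasDerivWithinAt, hv'c.continuousOn,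
    ⟨ρ, fun t _ => ?_⟩, (hvU 0 h0mem).trans hU0, fun t _ => (hvmem t).1, fun t _ => ?_⟩,
    fun t ht => ?_, ?_, ?_, (hvU T hTmem).trans hUT, fun t ht k => ⟨?_, ?_⟩⟩
  · rw [abs_of_nonneg (hvmem t).1]
    exact (hvmem t).2
  · simpa only [hφ] using hφd t
  · rw [show v' t = _ from hon _ hr t (Ioo_subset_Icc_self ht)]
    exact rpow_pos_of_pos (hApos _ (hUd t ht).1) _
  · rw [show v' 0 = _ from hon _ hr 0 h0mem, hU0, hA0, zero_rpow hr.ne']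
  · rw [show v' T = _ from hon _ hr T hTmem, hUT, hAρ, zero_rpow hr.ne']
  · simp only [v]
    rw [show π * (t + 2 * (k:ℝ) * T) / T = π * t / T + k * (2 * π) by field_simp,
      cos_add_nat_mul_two_pi]
  · simp only [v]
    rw [show π * (t + (2 * (k:ℝ) + 1) * T) / T = π * t / T + π + k * (2 * π) by
        field_simp; ring, cos_add_nat_mul_two_pi,
      show π * (T - t) / T = π - π * t / T by field_simp, cos_pi_sub, cos_add_pi]

end Potential

theorem stmt7 (p : ℝ) (hp : 1 < p) (f : ℝ → ℝ)
    (hfc : ContinuousOn f (Set.Ici 0))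
    (hflip : LocLipOn f (Set.Ici 0 \ Zf f))
    (hsmp : SMP p f)
    (hf0 : f 0 < 0) (ρ : ℝ) (hρ : ρ ∈ Pf f)
    (tstar : ℝ)
    (htstar : tstar = ((p - 1) / p) ^ (1/p) *
      ∫ s in (0:ℝ)..ρ, (Fint f ρ - Fint f s) ^ (-(1/p))) :
    0 < tstar ∧
    ∃ v v' : ℝ → ℝ,
      (Sol1D p f v v' ∧ (∀ t ∈ Set.Ioo 0 tstar, 0 < v' t) ∧
        v' 0 = 0 ∧ v' tstar = 0 ∧ v tstar = ρ ∧
        ∀ t ∈ Set.Icc 0 tstar, ∀ k : ℕ,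
          v (t + 2 * (k:ℝ) * tstar) = v t ∧
          v (t + (2 * (k:ℝ) + 1) * tstar) = v (tstar - t)) ∧
      ∀ w w' : ℝ → ℝ,
        Sol1D p f w w' → (∀ t ∈ Set.Ioo 0 tstar, 0 < w' t) →
        w' 0 = 0 → w' tstar = 0 → w tstar = ρ →
        (∀ t ∈ Set.Icc 0 tstar, ∀ k : ℕ,
          w (t + 2 * (k:ℝ) * tstar) = w t ∧
          w (t + (2 * (k:ℝ) + 1) * tstar) = w (tstar - t)) →
        ∀ t ∈ Set.Ici (0:ℝ), w t = v t := by
  obtain ⟨hρ0, hfρ, hFρ, hFneg⟩ := hρ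
  have hp0 : 0 < p := by linarith
  have hq : 0 < p / (p - 1) := div_pos hp0 (by linarith)
  have hr1 : 1 / p < 1 := by rwa [div_lt_one hp0]
  obtain ⟨A, hA, hAF⟩ := exists_potential p hfc
  have hA0 : A 0 = 0 := by rw [hAF 0 le_rfl, Fint, intervalIntegral.integral_same, mul_zero]
  have hAρ : A ρ = 0 := by rw [hAF ρ hρ0.le, hFρ, mul_zero]
  have hApos : ∀ x ∈ Ioo 0 ρ, 0 < A x := fun x hx => by
    rw [hAF x hx.1.le]
    exact mul_pos_of_neg_of_neg (by linarith) (hFneg x hx)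
  have hint : IntervalIntegrable (fun s => A s ^ (-(1 / p))) volume 0 ρ := by
    refine intervalIntegrable_rpow_neg_of_simple_zeros hρ0 (by positivity) hr1 hA hA0 hAρ hApos ?_ ?_
    · rw [max_self]
      exact mul_pos_of_neg_of_neg (by linarith) hf0
    · rw [max_eq_left hρ0.le]
      exact mul_neg_of_neg_of_pos (by linarith) hfρ
  have hAc : Continuous A := continuous_iff_continuousAt.2 fun x => (hA x).continuousAt
  have hGc : ContinuousOn (fun s => A s ^ (-(1 / p))) (Ioo 0 ρ) := fun x hx =>
    (hAc.continuousAt.rpow_const (Or.inl (hApos x hx).ne')).continuousWithinAt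
  have hGpos : ∀ x ∈ Ioo 0 ρ, 0 < A x ^ (-(1 / p)) := fun x hx => rpow_pos_of_pos (hApos x hx) _
  have hT : tstar = ∫ s in (0:ℝ)..ρ, A s ^ (-(1 / p)) := by
    rw [htstar, ← intervalIntegral.integral_const_mul]
    refine intervalIntegral.integral_congr fun s hs => ?_
    rw [uIcc_of_le hρ0.le] at hs
    have hFs : 0 ≤ -Fint f s := by
      rcases eq_or_lt_of_le hs.1 with rfl | h
      · rw [Fint, intervalIntegral.integral_same, neg_zero]
      rcases eq_or_lt_of_le hs.2 with rfl | h'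
      · rw [hFρ, neg_zero]
      · exact (neg_pos.2 (hFneg s ⟨h, h'⟩)).le
    simp only [hAF s hs.1, hFρ, zero_sub]
    rw [neg_mul_comm, mul_rpow hq.le hFs, rpow_neg hq.le, ← inv_rpow hq.le, inv_div]
  obtain ⟨hTpos, U, hU, hmem, hU0, hUT, hUd⟩ :=
    exists_timeMap_inverse hρ0 hGc hint hGpos hT
  obtain ⟨v, v', hv, hvpos, hv0, hvT, hvρ, hvper⟩ :=
    exists_sol1D_of_branch hp hTpos hfc hA hA0 hAρ hApos hU hmem hU0 hUT hUd
  refine ⟨hTpos, v, v', ⟨hv, hvpos, hv0, hvT, hvρ, hvper⟩, ?_⟩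
  intro w w' hw hwpos _ hwT hwρ hwper
  refine eq_of_eq_on_Icc_of_reflection hTpos hvper hwper fun t ht => ?_
  obtain ⟨hw1, hw2⟩ := hw.timeMap_apply hp hρ0 hA hAρ hApos hint hTpos hwpos hwT hwρ t ht
  obtain ⟨hv1, hv2⟩ := hv.timeMap_apply hp hρ0 hA hAρ hApos hint hTpos hvpos hvT hvρ t ht
  exact (strictMonoOn_timeMap hρ0 hGc hint hGpos).injOn hw1 hv1 (hw2.trans hv2.symm)
end

section
/- Every solution u ≢ 0 of problem (1D) has one of the following two forms: either (a) u′(t) > 0 for all t > 0, the limit ρ := lim_{t→+∞} u(t) exists, is finite and belongs to Z_f^*, and u′(0) = ((p/(p−1))·F(ρ))^{1/p}; or (b) f(0) < 0 and there exist ρ ∈ P_f and t* > 0 such that u′ > 0 on (0, t*), u′(0) = u′(t*) = 0, u(t*) = ρ, and u(t + 2k t*) = u(t) and u(t + (2k+1) t*) = u(t* − t) for all t ∈ [0, t*] and all natural numbers k. -/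
open Real Filter Set Topology MeasureTheory

/-- The set `Z_f^* = {z ∈ Z_f : F(t) < F(z) for all t ∈ [0,z)} ∪ Z_f^0`, where
`Z_f^0 = {z ∈ Z_f : F(t) < 0 = F(z) for all t ∈ (0,z)}` if `f(0) < 0` and `∅` otherwise. -/
def Zfstar (f : ℝ → ℝ) : Set ℝ :=
  {z ∈ Zf f | ∀ t ∈ Set.Ico 0 z, Fint f t < Fint f z} ∪
  {z ∈ Zf f | f 0 < 0 ∧ Fint f z = 0 ∧ ∀ t ∈ Set.Ioo 0 z, Fint f t < 0}

lemma hasDerivAt_Fint {f : ℝ → ℝ} (hf : Continuous f) (x : ℝ) : HasDerivAt (Fint f) (f x) x :=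
  intervalIntegral.integral_hasDerivAt_right (hf.intervalIntegrable _ _)
    hf.aestronglyMeasurable.stronglyMeasurableAtFilter hf.continuousAt

lemma continuous_Fint {f : ℝ → ℝ} (hf : Continuous f) : Continuous (Fint f) :=
  continuous_iff_continuousAt.2 fun x => (hasDerivAt_Fint hf x).continuousAt

lemma Fint_zero (f : ℝ → ℝ) : Fint f 0 = 0 := by simp [Fint]

/-- If `g` converges at infinity and so does its derivative, then the derivative tends to `0`. -/
lemma limit_deriv_eq_zero {g g' : ℝ → ℝ} {L m : ℝ} (hd : ∀ t > 0, HasDerivAt g (g' t) t)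
    (hg : Tendsto g atTop (𝓝 L)) (hg' : Tendsto g' atTop (𝓝 m)) : m = 0 := by
  have key : ∀ t : ℝ, ∃ ξ, t ≤ ξ ∧ (0 < t → g' ξ = g (t + 1) - g t) := by
    intro t
    rcases le_or_gt t 0 with ht | ht
    · exact ⟨t, le_rfl, fun h => absurd h ht.not_gt⟩
    · obtain ⟨ξ, hξ, h⟩ := exists_hasDerivAt_eq_slope g g' (show t < t + 1 by linarith)
        (fun x hx => (hd x (ht.trans_le hx.1)).continuousAt.continuousWithinAt)
        (fun x hx => hd x (ht.trans hx.1))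
      exact ⟨ξ, hξ.1.le, fun _ => by simpa using h⟩
  choose ξ hξ hs using key
  have h1 : Tendsto (fun t => g' (ξ t)) atTop (𝓝 m) :=
    hg'.comp (tendsto_atTop_mono hξ tendsto_id)
  have h2 : Tendsto (fun t => g (t + 1) - g t) atTop (𝓝 (L - L)) :=
    (hg.comp (tendsto_atTop_add_const_right _ _ tendsto_id)).sub hg
  rw [sub_self] at h2
  refine tendsto_nhds_unique (h1.congr' ?_) h2
  filter_upwards [eventually_gt_atTop 0] with t ht using hs t ht

/-- A continuous function that is positive to the right of `0` but nonpositive somewhere later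
has a first zero. -/
lemma exists_first_zero {φ : ℝ → ℝ} {t₁ : ℝ} (ht₁ : 0 < t₁) (hφ : ContinuousOn φ (Icc 0 t₁))
    (hnear : ∃ δ > 0, ∀ s ∈ Ioo 0 δ, 0 < φ s) (h₁ : φ t₁ ≤ 0) :
    ∃ T ∈ Ioc 0 t₁, φ T = 0 ∧ ∀ s ∈ Ioo 0 T, 0 < φ s := by
  obtain ⟨δ, hδ, hpos⟩ := hnear
  have hsub : Icc (δ / 2) t₁ ⊆ Icc 0 t₁ := Icc_subset_Icc_left (by positivity)
  have hδt : δ ≤ t₁ := by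
    by_contra! h
    exact absurd (hpos t₁ ⟨ht₁, h⟩) h₁.not_gt
  have hne : (Icc (δ / 2) t₁ ∩ φ ⁻¹' Iic 0).Nonempty := ⟨t₁, ⟨by linarith, le_rfl⟩, h₁⟩
  have hcomp : IsCompact (Icc (δ / 2) t₁ ∩ φ ⁻¹' Iic 0) :=
    isCompact_Icc.of_isClosed_subset
      ((hφ.mono hsub).preimage_isClosed_of_isClosed isClosed_Icc isClosed_Iic) inter_subset_left
  obtain ⟨T, ⟨hT, hT0⟩, hmin⟩ := hcomp.exists_isLeast hne
  have hTpos : 0 < T := by linarith [hT.1]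
  have hbefore : ∀ s ∈ Ioo 0 T, 0 < φ s := by
    intro s hs
    by_contra! h
    rcases lt_or_ge s δ with h' | h'
    · exact absurd (hpos s ⟨hs.1, h'⟩) h.not_gt
    · exact absurd (hmin ⟨⟨by linarith, by linarith [hs.2, hT.2]⟩, h⟩) hs.2.not_ge
  refine ⟨T, ⟨hTpos, hT.2⟩, le_antisymm hT0 ?_, hbefore⟩
  have hc : Tendsto φ (𝓝[Ioo 0 T] T) (𝓝 (φ T)) :=
    (hφ T (hsub hT)).mono fun s hs => ⟨hs.1.le, hs.2.le.trans hT.2⟩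
  rw [nhdsWithin_Ioo_eq_nhdsLT hTpos] at hc
  refine ge_of_tendsto hc ?_
  filter_upwards [Ioo_mem_nhdsLT hTpos] with s hs using (hbefore s hs).le

lemma strictMonoOn_of_hasDerivAt_pos_Icc {a a' : ℝ → ℝ} {x y : ℝ} (ha : ContinuousOn a (Icc x y))
    (hd : ∀ s ∈ Ioo x y, HasDerivAt a (a' s) s) (hp : ∀ s ∈ Ioo x y, 0 < a' s) :
    StrictMonoOn a (Icc x y) := by
  refine strictMonoOn_of_hasDerivWithinAt_pos (f' := a') (convex_Icc _ _) ha ?_ ?_ <;>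
    rw [interior_Icc]
  exacts [fun s hs => (hd s hs).hasDerivWithinAt, hp]

/-- Two increasing solutions of `y' = g y`, `y 0 = 0` with `g > 0` on `(0, r)` satisfy `a ≤ b`. -/
lemma autonomous_le {g a b : ℝ → ℝ} {T r : ℝ}
    (hgc : ContinuousOn g (Ioo 0 r)) (hg : ∀ x ∈ Ioo 0 r, 0 < g x)
    (hb : ContinuousOn b (Icc 0 T)) (hb0 : b 0 = 0)
    (har : ∀ s ∈ Ioo 0 T, a s ∈ Ioo 0 r) (hbr : ∀ s ∈ Ioo 0 T, b s ∈ Ioo 0 r)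
    (hda : ∀ s ∈ Ioo 0 T, HasDerivAt a (g (a s)) s)
    (hdb : ∀ s ∈ Ioo 0 T, HasDerivAt b (g (b s)) s) :
    ∀ s ∈ Ioo 0 T, b s ≤ a s := by
  intro s₀ hs₀
  have hT : 0 < T := hs₀.1.trans hs₀.2
  have hr : r / 2 ∈ Ioo 0 r := by
    have := (har s₀ hs₀).1.trans (har s₀ hs₀).2
    constructor <;> linarith
  set G : ℝ → ℝ := fun x => ∫ y in (r / 2)..x, (g y)⁻¹ with hG
  have hic : ContinuousOn (fun y => (g y)⁻¹) (Ioo 0 r) := hgc.inv₀ fun x hx => (hg x hx).ne'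
  have hGd : ∀ x ∈ Ioo 0 r, HasDerivAt G (g x)⁻¹ x := by
    intro x hx
    have hn : Ioo 0 r ∈ 𝓝 x := isOpen_Ioo.mem_nhds hx
    refine intervalIntegral.integral_hasDerivAt_right ?_ ?_ (hic.continuousAt hn)
    · exact (hic.mono (ordConnected_Ioo.uIcc_subset hr hx)).intervalIntegrable
    · exact hic.stronglyMeasurableAtFilter isOpen_Ioo x hx
  have hGm : StrictMonoOn G (Ioo 0 r) := by
    refine strictMonoOn_of_hasDerivWithinAt_pos (f' := fun x => (g x)⁻¹) (convex_Ioo _ _)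
      (fun x hx => (hGd x hx).continuousAt.continuousWithinAt) ?_ ?_ <;> rw [interior_Ioo]
    exacts [fun x hx => (hGd x hx).hasDerivWithinAt, fun x hx => inv_pos.2 (hg x hx)]
  have time : ∀ c : ℝ → ℝ, (∀ s ∈ Ioo 0 T, c s ∈ Ioo 0 r) →
      (∀ s ∈ Ioo 0 T, HasDerivAt c (g (c s)) s) →
      ∀ s ∈ Ioo 0 T, ∀ t ∈ Ioo 0 T, G (c s) - s = G (c t) - t := by
    intro c hcr hdc s hs t ht
    have hd : ∀ x ∈ Ioo 0 T, HasDerivAt (fun x => G (c x) - x) 0 x := by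
      intro x hx
      have := ((hGd _ (hcr x hx)).comp x (hdc x hx)).sub (hasDerivAt_id x)
      rw [inv_mul_cancel₀ (hg _ (hcr x hx)).ne', sub_self] at this
      exact this
    exact isOpen_Ioo.is_const_of_deriv_eq_zero (convex_Ioo _ _).isPreconnected
      (fun x hx => (hd x hx).differentiableAt.differentiableWithinAt)
      (fun x hx => (hd x hx).deriv) hs ht
  by_contra! hlt
  have hd0 : 0 < G (b s₀) - G (a s₀) := sub_pos.2 (hGm (har _ hs₀) (hbr _ hs₀) hlt)
  set d := G (b s₀) - G (a s₀) with hd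
  set t := min d (T / 2) with ht
  have ht0 : t ∈ Ioo 0 T := ⟨lt_min hd0 (by linarith), (min_le_right _ _).trans_lt (by linarith)⟩
  have hle : ∀ s ∈ Ioo 0 T, a t ≤ b s := by
    intro s hs
    have h1 := time a har hda s₀ hs₀ t ht0
    have h2 := time b hbr hdb s₀ hs₀ s hs
    have h3 : t ≤ d := min_le_left _ _
    exact ((hGm.lt_iff_lt (har _ ht0) (hbr _ hs)).1 (by linarith [hs.1])).le
  have hc : Tendsto b (𝓝[Ioo 0 T] 0) (𝓝 (b 0)) :=
    (hb 0 ⟨le_rfl, hT.le⟩).mono Ioo_subset_Icc_self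
  rw [nhdsWithin_Ioo_eq_nhdsGT hT, hb0] at hc
  have : a t ≤ 0 := by
    refine ge_of_tendsto hc ?_
    filter_upwards [Ioo_mem_nhdsGT hT] with s hs using hle s hs
  linarith [(har t ht0).1]

/-- Continuation: if `a` increases from `0` to `r` on `[0, T]` following `y' = g y`, and `b` starts
at `0`, is initially increasing and follows the same equation as long as it increases, then `b`
coincides with `a` on `[0, T]`. -/
lemma eqOn_of_autonomous {g a b b' : ℝ → ℝ} {T r : ℝ} (hT : 0 < T)
    (hgc : ContinuousOn g (Ioo 0 r))
    (ha : ContinuousOn a (Icc 0 T)) (ha0 : a 0 = 0) (haT : a T = r)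
    (hda : ∀ s ∈ Ioo 0 T, HasDerivAt a (g (a s)) s) (hga : ∀ s ∈ Ioo 0 T, 0 < g (a s))
    (hb : ContinuousOn b (Icc 0 T)) (hb0 : b 0 = 0)
    (hdb : ∀ s ∈ Ioo 0 T, HasDerivAt b (b' s) s) (hb'c : ContinuousOn b' (Icc 0 T))
    (hbg : ∀ s ∈ Ioo 0 T, 0 < b' s → b' s = g (b s) ∧ b s ≠ r)
    (hnear : ∃ δ > 0, ∀ s ∈ Ioo 0 δ, 0 < b' s) :
    EqOn b a (Icc 0 T) := by
  have ham : StrictMonoOn a (Icc 0 T) := strictMonoOn_of_hasDerivAt_pos_Icc ha hda hga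
  have har : ∀ s ∈ Ioo 0 T, a s ∈ Ioo 0 r := by
    intro s hs
    have h1 := ham ⟨le_rfl, hT.le⟩ ⟨hs.1.le, hs.2.le⟩ hs.1
    have h2 := ham ⟨hs.1.le, hs.2.le⟩ ⟨hT.le, le_rfl⟩ hs.2
    rw [ha0] at h1
    rw [haT] at h2
    exact ⟨h1, h2⟩
  have hr : 0 < r := by
    have := har (T / 2) ⟨by linarith, by linarith⟩
    exact this.1.trans this.2
  have hg : ∀ x ∈ Ioo 0 r, 0 < g x := by
    intro x hx
    obtain ⟨s, hs, rfl⟩ := intermediate_value_Ioo hT.le ha (by rwa [ha0, haT])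
    exact hga s hs
  have main : ∀ τ ∈ Ioc 0 T, (∀ s ∈ Ioo 0 τ, 0 < b' s) → EqOn b a (Icc 0 τ) := by
    intro τ hτ hpos
    have hsub : Icc 0 τ ⊆ Icc 0 T := Icc_subset_Icc_right hτ.2
    have hsubo : Ioo 0 τ ⊆ Ioo 0 T := Ioo_subset_Ioo_right hτ.2
    have hbm : StrictMonoOn b (Icc 0 τ) :=
      strictMonoOn_of_hasDerivAt_pos_Icc (hb.mono hsub) (fun s hs => hdb s (hsubo hs)) hpos
    have hbr : ∀ s ∈ Ioo 0 τ, b s ∈ Ioo 0 r := by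
      intro s hs
      have h1 := hbm ⟨le_rfl, hτ.1.le⟩ ⟨hs.1.le, hs.2.le⟩ hs.1
      rw [hb0] at h1
      refine ⟨h1, ?_⟩
      by_contra! h
      obtain ⟨s', hs', hs'r⟩ := intermediate_value_Ioc hs.1.le
        (hb.mono fun x hx => ⟨hx.1, hx.2.trans (hs.2.le.trans hτ.2)⟩)
        (show r ∈ Ioc (b 0) (b s) from ⟨by rwa [hb0], h⟩)
      have hs'' : s' ∈ Ioo 0 τ := ⟨hs'.1, hs'.2.trans_lt hs.2⟩
      exact (hbg s' (hsubo hs'') (hpos s' hs'')).2 hs'r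
    have hdb' : ∀ s ∈ Ioo 0 τ, HasDerivAt b (g (b s)) s := fun s hs => by
      rw [← (hbg s (hsubo hs) (hpos s hs)).1]
      exact hdb s (hsubo hs)
    have hIoo : EqOn b a (Ioo 0 τ) := fun s hs => le_antisymm
      (autonomous_le hgc hg (hb.mono hsub) hb0 (fun s hs => har s (hsubo hs)) hbr
        (fun s hs => hda s (hsubo hs)) hdb' s hs)
      (autonomous_le hgc hg (ha.mono hsub) ha0 hbr (fun s hs => har s (hsubo hs))
        hdb' (fun s hs => hda s (hsubo hs)) s hs)
    exact hIoo.of_subset_closure (hb.mono hsub) (ha.mono hsub) Ioo_subset_Icc_self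
      (by rw [closure_Ioo hτ.1.ne])
  refine main T ⟨hT, le_rfl⟩ ?_
  by_contra! hneg
  obtain ⟨t₁, ht₁, hb't₁⟩ := hneg
  obtain ⟨τ, hτ, hb'τ, hpos⟩ := exists_first_zero ht₁.1
    (hb'c.mono (Icc_subset_Icc_right ht₁.2.le)) hnear hb't₁
  have hτT : τ ∈ Ioo 0 T := ⟨hτ.1, hτ.2.trans_lt ht₁.2⟩
  have heq := main τ ⟨hτ.1, hτT.2.le⟩ hpos
  have hmem : τ ∈ Icc 0 τ := ⟨hτ.1.le, le_rfl⟩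
  have h1 : HasDerivWithinAt a (b' τ) (Icc 0 τ) τ :=
    (hdb τ hτT).hasDerivWithinAt.congr_of_mem (fun s hs => (heq hs).symm) hmem
  have h2 := (uniqueDiffOn_Icc hτ.1 τ hmem).eq_deriv _ h1 (hda τ hτT).hasDerivWithinAt
  linarith [hga τ hτT]

lemma abs_rpow_sub_two_mul_abs {p : ℝ} (hp : 1 < p) (x : ℝ) :
    |x| ^ (p - 2) * |x| = |x| ^ (p - 1) := by
  rcases eq_or_ne x 0 with rfl | hx
  · simp [Real.zero_rpow (sub_pos.2 hp).ne']
  · rw [← Real.rpow_add_one (abs_ne_zero.2 hx)]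
    ring_nf

lemma continuous_abs_rpow_sub_two_mul {p : ℝ} (hp : 1 < p) :
    Continuous fun x : ℝ => |x| ^ (p - 2) * x := by
  have h : Continuous (deriv fun x : ℝ => |x| ^ p) :=
    (contDiff_norm_rpow (E := ℝ) hp).continuous_deriv le_rfl
  have h2 : (deriv fun x : ℝ => |x| ^ p) = fun x => p * (|x| ^ (p - 2) * x) := by
    funext x
    rw [(hasDerivAt_abs_rpow x hp).deriv, mul_assoc]
  rw [h2] at h
  have hp0 : p ≠ 0 := by linarith
  simpa [← mul_assoc, inv_mul_cancel₀ hp0] using h.const_mul p⁻¹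

lemma abs_rpow_sub_two_mul_pos_iff {p x : ℝ} : 0 < |x| ^ (p - 2) * x ↔ 0 < x := by
  rcases eq_or_ne x 0 with rfl | hx
  · simp
  · exact mul_pos_iff_of_pos_left (Real.rpow_pos_of_pos (abs_pos.2 hx) _)

/-- The modulus of `u'` at the points where `u = x`, for a solution of energy level `c`. -/
noncomputable def speed (p : ℝ) (f : ℝ → ℝ) (c x : ℝ) : ℝ :=
  (p / (p - 1) * (c - Fint f x)) ^ (1 / p)

lemma continuous_speed {p : ℝ} (hp : 1 < p) {f : ℝ → ℝ} (hf : Continuous f) (c : ℝ) :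
    Continuous (speed p f c) :=
  (continuous_const.mul (continuous_const.sub (continuous_Fint hf))).rpow_const
    fun _ => Or.inr (by positivity)

namespace Sol1D

variable {p : ℝ} {f u u' : ℝ → ℝ}

lemma energy (hp : 1 < p) (hf : Continuous f) (hu : Sol1D p f u u') {t : ℝ} (ht : 0 ≤ t) :
    |u' t| ^ p + p / (p - 1) * Fint f (u t) = |u' 0| ^ p := by
  rcases ht.eq_or_lt with rfl | ht
  · simp [hu.zeroAtZero, Fint_zero]
  have hp1 : 0 < p - 1 := sub_pos.2 hp
  have hq : 1 < p / (p - 1) := by rw [one_lt_div hp1]; linarith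
  have hsub : Icc 0 t ⊆ Ici 0 := fun s hs => hs.1
  have hcont : ContinuousOn (fun s => |u' s| ^ p + p / (p - 1) * Fint f (u s)) (Icc 0 t) :=
    (((hu.derivCont.mono hsub).abs).rpow_const fun _ _ => Or.inr (by linarith)).add
      (continuousOn_const.mul ((continuous_Fint hf).comp_continuousOn (hu.continuousOn.mono hsub)))
  have habs : ∀ s, |u' s| ^ p = |(|u' s| ^ (p - 2) * u' s)| ^ (p / (p - 1)) := by
    intro s
    rw [abs_mul, abs_of_nonneg (Real.rpow_nonneg (abs_nonneg _) _), abs_rpow_sub_two_mul_abs hp,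
      ← Real.rpow_mul (abs_nonneg _), mul_div_cancel₀ _ hp1.ne']
  have hconj : ∀ s, |(|u' s| ^ (p - 2) * u' s)| ^ (p / (p - 1) - 2) * (|u' s| ^ (p - 2) * u' s)
      = u' s := by
    intro s
    rcases eq_or_ne (u' s) 0 with h0 | h0
    · simp [h0]
    rw [abs_mul, abs_of_nonneg (Real.rpow_nonneg (abs_nonneg _) _), abs_rpow_sub_two_mul_abs hp,
      ← Real.rpow_mul (abs_nonneg _), ← mul_assoc, ← Real.rpow_add (abs_pos.2 h0)]
    have : (p - 1) * (p / (p - 1) - 2) + (p - 2) = 0 := by field_simp; ring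
    rw [this, Real.rpow_zero, one_mul]
  obtain ⟨ξ, hξ, hs⟩ := exists_hasDerivAt_eq_slope _ (fun _ => 0) ht hcont (fun s hs => by
    have h1 := (hasDerivAt_abs_rpow _ hq).comp s (hu.ode s hs.1)
    have h2 := ((hasDerivAt_Fint hf (u s)).comp s (hu.hasDerivAt hs.1)).const_mul (p / (p - 1))
    have h3 := h1.add h2
    rw [mul_assoc (p / (p - 1)), hconj] at h3
    rw [show p / (p - 1) * u' s * -f (u s) + p / (p - 1) * (f (u s) * u' s) = 0 by ring] at h3
    exact h3.congr_of_eventuallyEq (Eventually.of_forall fun x => by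
      simp only [habs x, Pi.add_apply, Function.comp_apply]))
  rw [eq_comm, div_eq_zero_iff] at hs
  have := hs.resolve_right (by linarith)
  simp only [hu.zeroAtZero, Fint_zero, mul_zero, add_zero] at this
  linarith

lemma abs_deriv_rpow (hp : 1 < p) (hf : Continuous f) (hu : Sol1D p f u u') {s t : ℝ}
    (hs : 0 ≤ s) (hs' : u' s = 0) (ht : 0 ≤ t) :
    |u' t| ^ p = p / (p - 1) * (Fint f (u s) - Fint f (u t)) := by
  have h1 := hu.energy hp hf hs
  have h2 := hu.energy hp hf ht
  rw [hs', abs_zero, Real.zero_rpow (by linarith)] at h1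
  linarith

lemma abs_deriv_eq_speed (hp : 1 < p) (hf : Continuous f) (hu : Sol1D p f u u') {s t : ℝ}
    (hs : 0 ≤ s) (hs' : u' s = 0) (ht : 0 ≤ t) : |u' t| = speed p f (Fint f (u s)) (u t) := by
  rw [speed, ← hu.abs_deriv_rpow hp hf hs hs' ht, one_div,
    Real.rpow_rpow_inv (abs_nonneg _) (by linarith)]

/-- Near a critical point at which `f ∘ u` does not vanish, `u'` changes sign. -/
lemma deriv_sign_near (hp : 1 < p) (hf : Continuous f) (hu : Sol1D p f u u') {t₀ : ℝ}
    (ht₀ : 0 ≤ t₀) (h0 : u' t₀ = 0) (hne : f (u t₀) ≠ 0) :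
    ∃ δ > 0, ∀ s, 0 ≤ s → |s - t₀| < δ → s ≠ t₀ → f (u t₀) * (u' s * (s - t₀)) < 0 := by
  have hc : ContinuousWithinAt (fun s => f (u t₀) * f (u s)) (Ici 0) t₀ :=
    continuousWithinAt_const.mul
      (hf.continuousAt.comp_continuousWithinAt (hu.continuousOn t₀ ht₀))
  have hev := hc.eventually (lt_mem_nhds (mul_self_pos.2 hne))
  obtain ⟨δ, hδ, hball⟩ := Metric.mem_nhdsWithin_iff.1 hev
  have hW : ContinuousOn (fun s => |u' s| ^ (p - 2) * u' s) (Ici 0) :=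
    (continuous_abs_rpow_sub_two_mul hp).comp_continuousOn hu.derivCont
  have hfu : ∀ ξ, 0 ≤ ξ → |ξ - t₀| < δ → 0 < f (u t₀) * f (u ξ) :=
    fun ξ h1 h2 => hball ⟨by rwa [Metric.mem_ball, Real.dist_eq], h1⟩
  have hslope : ∀ x y, 0 ≤ x → x < y → ∃ ξ ∈ Ioo x y,
      |u' y| ^ (p - 2) * u' y - |u' x| ^ (p - 2) * u' x = - f (u ξ) * (y - x) := by
    intro x y hx hxy
    obtain ⟨ξ, hξ, h⟩ := exists_hasDerivAt_eq_slope _ (fun s => -f (u s)) hxy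
      (hW.mono fun s hs => hx.trans hs.1) (fun s hs => hu.ode s (hx.trans_lt hs.1))
    exact ⟨ξ, hξ, by rw [h, div_mul_cancel₀ _ (sub_pos.2 hxy).ne']⟩
  refine ⟨δ, hδ, fun s hs hsδ hst => ?_⟩
  have hkey : f (u t₀) * ((|u' s| ^ (p - 2) * u' s) * (s - t₀)) < 0 := by
    rcases lt_or_gt_of_ne hst with h | h
    · obtain ⟨ξ, hξ, h'⟩ := hslope s t₀ hs h
      rw [h0, mul_zero, zero_sub] at h'
      have hpos := hfu ξ (hs.trans hξ.1.le) (by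
        rw [abs_lt] at hsδ ⊢; constructor <;> linarith [hξ.1, hξ.2])
      have : |u' s| ^ (p - 2) * u' s = f (u ξ) * (t₀ - s) := by linarith
      rw [this]
      nlinarith [mul_pos hpos (mul_pos (sub_pos.2 h) (sub_pos.2 h))]
    · obtain ⟨ξ, hξ, h'⟩ := hslope t₀ s ht₀ h
      rw [h0, mul_zero, sub_zero] at h'
      have hpos := hfu ξ (ht₀.trans hξ.1.le) (by
        rw [abs_lt] at hsδ ⊢; constructor <;> linarith [hξ.1, hξ.2])
      rw [h']
      nlinarith [mul_pos hpos (mul_pos (sub_pos.2 h) (sub_pos.2 h))]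
  have hnn : 0 ≤ |u' s| ^ (p - 2) := Real.rpow_nonneg (abs_nonneg _) _
  have : f (u t₀) * ((|u' s| ^ (p - 2) * u' s) * (s - t₀))
      = |u' s| ^ (p - 2) * (f (u t₀) * (u' s * (s - t₀))) := by ring
  rw [this] at hkey
  exact (pos_iff_neg_of_mul_neg hkey).1 (hnn.lt_of_ne' fun h => by simp [h] at hkey)

end Sol1D

/-- Condition (SMP) bounds the increments of the primitive of `f` near a zero of `f`. -/
lemma exists_Fint_sub_le {p : ℝ} (hp : 1 < p) {f : ℝ → ℝ} (hf : Continuous f) (hsmp : SMP p f)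
    {z : ℝ} (hz : z ∈ Zf f) :
    ∃ ε > 0, ∃ C ≥ 0, ∀ x, 0 ≤ x → |x - z| < ε → Fint f z - Fint f x ≤ C * |x - z| ^ p := by
  obtain ⟨h1, h2⟩ := hsmp z hz
  obtain ⟨c₁, -, hc₁⟩ := EReal.lt_iff_exists_real_btwn.1 h1
  obtain ⟨c₂, hc₂, -⟩ := EReal.lt_iff_exists_real_btwn.1 h2
  obtain ⟨ε₁, hε₁, H₁⟩ := Metric.mem_nhdsWithin_iff.1 (eventually_lt_of_lt_liminf hc₁)
  obtain ⟨ε₂, hε₂, H₂⟩ := Metric.mem_nhdsWithin_iff.1 (eventually_lt_of_limsup_lt hc₂)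
  have hp1 : 0 < p - 1 := sub_pos.2 hp
  have hpow : ∀ y : ℝ, 0 < y → y ^ (p - 1) * y = y ^ p := fun y hy => by
    rw [← Real.rpow_add_one hy.ne', sub_add_cancel]
  refine ⟨min ε₁ ε₂, lt_min hε₁ hε₂, max |c₁| |c₂|, by positivity, fun x hx hxz => ?_⟩
  have hFc : ContinuousOn (Fint f) univ := (continuous_Fint hf).continuousOn
  rcases lt_trichotomy x z with h | rfl | h
  · rw [abs_sub_comm, abs_of_pos (sub_pos.2 h)] at hxz ⊢
    obtain ⟨ξ, hξ, hs⟩ := exists_hasDerivAt_eq_slope (Fint f) f h (hFc.mono (subset_univ _))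
      (fun y _ => hasDerivAt_Fint hf y)
    rw [eq_div_iff (sub_pos.2 h).ne'] at hs
    have hy : 0 < z - ξ := sub_pos.2 hξ.2
    have hb : ((f ξ / (z - ξ) ^ (p - 1) : ℝ) : EReal) < c₂ := H₂ ⟨by
      rw [Metric.mem_ball, Real.dist_eq, abs_sub_comm, abs_of_pos hy]
      exact lt_of_lt_of_le (by linarith [hξ.1]) (min_le_right ε₁ ε₂), hx.trans hξ.1.le, hξ.2⟩
    rw [EReal.coe_lt_coe_iff, div_lt_iff₀ (Real.rpow_pos_of_pos hy _)] at hb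
    rw [← hs, ← hpow _ (sub_pos.2 h), ← mul_assoc]
    refine mul_le_mul_of_nonneg_right (hb.le.trans ?_) (sub_pos.2 h).le
    refine mul_le_mul ((le_abs_self _).trans (le_max_right _ _)) ?_ (by positivity) (by positivity)
    exact Real.rpow_le_rpow hy.le (by linarith [hξ.1]) hp1.le
  · simp [Real.zero_rpow (by linarith : p ≠ 0)]
  · rw [abs_of_pos (sub_pos.2 h)] at hxz ⊢
    obtain ⟨ξ, hξ, hs⟩ := exists_hasDerivAt_eq_slope (Fint f) f h (hFc.mono (subset_univ _))
      (fun y _ => hasDerivAt_Fint hf y)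
    rw [eq_div_iff (sub_pos.2 h).ne'] at hs
    have hy : 0 < ξ - z := sub_pos.2 hξ.1
    have hb : (c₁ : EReal) < ((f ξ / (ξ - z) ^ (p - 1) : ℝ) : EReal) := H₁ ⟨by
      rw [Metric.mem_ball, Real.dist_eq, abs_of_pos hy]
      exact lt_of_lt_of_le (by linarith [hξ.2]) (min_le_left ε₁ ε₂), hξ.1⟩
    rw [EReal.coe_lt_coe_iff, lt_div_iff₀ (Real.rpow_pos_of_pos hy _)] at hb
    have hxz' : 0 < x - z := sub_pos.2 h
    rw [show Fint f z - Fint f x = -f ξ * (x - z) by linarith, ← hpow _ hxz', ← mul_assoc]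
    refine mul_le_mul_of_nonneg_right ?_ hxz'.le
    have : -f ξ ≤ -c₁ * (ξ - z) ^ (p - 1) := by linarith
    refine this.trans ?_
    refine mul_le_mul ((neg_le_abs _).trans (le_max_left _ _)) ?_ (by positivity) (by positivity)
    exact Real.rpow_le_rpow hy.le (by linarith [hξ.2]) hp1.le

namespace Sol1D

variable {p : ℝ} {f u u' : ℝ → ℝ}

/-- Strong maximum principle: a nontrivial solution has no critical point whose value is a zero
of `f`. -/
lemma apply_ne_zero_of_deriv_eq_zero (hp : 1 < p) (hf : Continuous f) (hsmp : SMP p f)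
    (hu : Sol1D p f u u') (hnz : ∃ t ∈ Ici (0 : ℝ), u t ≠ 0) {t₀ : ℝ} (ht₀ : 0 ≤ t₀)
    (h0 : u' t₀ = 0) : f (u t₀) ≠ 0 := by
  intro hz0
  set z := u t₀ with hz
  obtain ⟨ε, hε, C, hC, hF⟩ := exists_Fint_sub_le hp hf hsmp (z := z) ⟨hu.nonneg t₀ ht₀, hz0⟩
  have hp0 : 0 < p := by linarith
  have hq : 0 < p / (p - 1) := div_pos hp0 (sub_pos.2 hp)
  have bound : ∀ N, ∃ K, ∀ t ∈ Icc 0 N, ‖u' t‖ ≤ K * ‖u t - z‖ := by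
    intro N
    obtain ⟨M, hM⟩ := isCompact_Icc.exists_bound_of_continuousOn
      (hu.derivCont.mono fun t (ht : t ∈ Icc 0 N) => ht.1)
    refine ⟨max ((p / (p - 1) * C) ^ (1 / p)) (|M| / ε), fun t ht => ?_⟩
    rcases lt_or_ge |u t - z| ε with h | h
    · have h1 : |u' t| ^ p ≤ p / (p - 1) * C * |u t - z| ^ p := by
        rw [hu.abs_deriv_rpow hp hf ht₀ h0 ht.1, mul_assoc]
        exact mul_le_mul_of_nonneg_left (hF _ (hu.nonneg t ht.1) h) hq.le
      have h2 := Real.rpow_le_rpow (by positivity) h1 (show 0 ≤ 1 / p by positivity)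
      rw [Real.mul_rpow (by positivity) (by positivity), one_div,
        Real.rpow_rpow_inv (abs_nonneg _) hp0.ne', Real.rpow_rpow_inv (abs_nonneg _) hp0.ne',
        ← one_div] at h2
      exact h2.trans (mul_le_mul_of_nonneg_right (le_max_left _ _) (abs_nonneg _))
    · calc ‖u' t‖ ≤ |M| := (hM t ht).trans (le_abs_self M)
        _ = |M| / ε * ε := by field_simp
        _ ≤ _ := mul_le_mul (le_max_right _ _) h hε.le (by positivity)
  have hforward : ∀ t, t₀ ≤ t → u t = z := by
    intro t ht
    obtain ⟨K, hK⟩ := bound t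
    have := eq_zero_of_abs_deriv_le_mul_abs_self_of_eq_zero_right (f := fun s => u s - z) (f' := u')
      (a := t₀) (b := t)
      ((hu.continuousOn.mono fun s hs => ht₀.trans hs.1).sub continuousOn_const)
      (fun s hs => ((hu.hasDeriv s (ht₀.trans hs.1)).mono
        (Ici_subset_Ici.2 (ht₀.trans hs.1))).sub_const z) (sub_self _)
      (fun s hs => hK s ⟨ht₀.trans hs.1, hs.2.le⟩) t ⟨ht, le_rfl⟩
    exact sub_eq_zero.1 this
  have hbackward : ∀ t ∈ Icc 0 t₀, u t = z := by
    intro t ht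
    obtain ⟨K, hK⟩ := bound t₀
    have hsub : Icc 0 t₀ ⊆ (fun s => t₀ - s) ⁻¹' Ici 0 := fun s hs => sub_nonneg.2 hs.2
    have := eq_zero_of_abs_deriv_le_mul_abs_self_of_eq_zero_right (f := fun s => u (t₀ - s) - z)
      (f' := fun s => -u' (t₀ - s)) (a := 0) (b := t₀)
      ((hu.continuousOn.comp (continuousOn_const.sub continuousOn_id) hsub).sub continuousOn_const)
      (fun s hs => (((hu.hasDerivAt (sub_pos.2 hs.2)).comp_const_sub t₀ s).sub_const
        z).hasDerivWithinAt)
      (by simp [hz])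
      (fun s hs => by
        rw [norm_neg]
        exact hK _ ⟨sub_nonneg.2 hs.2.le, by linarith [hs.1]⟩) (t₀ - t)
      ⟨sub_nonneg.2 ht.2, by linarith [ht.1]⟩
    simp only [sub_sub_cancel] at this
    exact sub_eq_zero.1 this
  have hz00 : z = 0 := by rw [← hbackward 0 ⟨le_rfl, ht₀⟩, hu.zeroAtZero]
  obtain ⟨t, ht, hut⟩ := hnz
  refine hut ?_
  rcases le_total t₀ t with h | h
  · rw [hforward t h, hz00]
  · rw [hbackward t ⟨ht, h⟩, hz00]

end Sol1D

namespace Sol1D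

variable {p : ℝ} {f u u' : ℝ → ℝ}

lemma not_initially_neg (hu : Sol1D p f u u') : ¬ ∃ δ > 0, ∀ s ∈ Ioo 0 δ, u' s < 0 := by
  rintro ⟨δ, hδ, h⟩
  have hδ2 : 0 < δ / 2 := by positivity
  obtain ⟨ξ, hξ, hs⟩ := exists_hasDerivAt_eq_slope u u' hδ2
    (hu.continuousOn.mono fun s hs => hs.1) (fun s hs => hu.hasDerivAt hs.1)
  have h1 := h ξ ⟨hξ.1, by linarith [hξ.2]⟩
  rw [hs, hu.zeroAtZero, sub_zero, sub_zero] at h1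
  exact absurd (div_nonneg (hu.nonneg _ hδ2.le) hδ2.le) h1.not_ge

/-- A nontrivial solution is initially increasing, and `f 0 < 0` if it starts with zero slope. -/
lemma initially_pos (hp : 1 < p) (hf : Continuous f) (hsmp : SMP p f)
    (hu : Sol1D p f u u') (hnz : ∃ t ∈ Ici (0 : ℝ), u t ≠ 0) :
    0 ≤ u' 0 ∧ (u' 0 = 0 → f 0 < 0) ∧ ∃ δ > 0, ∀ s ∈ Ioo 0 δ, 0 < u' s := by
  have hc := hu.derivCont 0 self_mem_Ici
  rcases lt_trichotomy (u' 0) 0 with h | h | h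
  · obtain ⟨δ, hδ, hb⟩ := Metric.mem_nhdsWithin_iff.1 (hc.eventually (gt_mem_nhds h))
    refine absurd ⟨δ, hδ, fun s hs => hb ⟨?_, hs.1.le⟩⟩ hu.not_initially_neg
    rw [Metric.mem_ball, Real.dist_eq, sub_zero, abs_of_pos hs.1]
    exact hs.2
  · have hne := hu.apply_ne_zero_of_deriv_eq_zero hp hf hsmp hnz le_rfl h
    obtain ⟨δ, hδ, hb⟩ := hu.deriv_sign_near hp hf le_rfl h hne
    rw [hu.zeroAtZero] at hb hne
    have hb' : ∀ s ∈ Ioo 0 δ, f 0 * u' s < 0 := by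
      intro s hs
      have := hb s hs.1.le (by rw [sub_zero, abs_of_pos hs.1]; exact hs.2) hs.1.ne'
      rw [sub_zero, ← mul_assoc] at this
      exact (pos_iff_neg_of_mul_neg (by linarith : s * (f 0 * u' s) < 0)).1 hs.1
    have hf0 : f 0 < 0 := by
      refine hne.lt_or_gt.resolve_right fun hpos => hu.not_initially_neg ⟨δ, hδ, fun s hs => ?_⟩
      exact (pos_iff_neg_of_mul_neg (hb' s hs)).1 hpos
    exact ⟨h.ge, fun _ => hf0, δ, hδ, fun s hs => (neg_iff_pos_of_mul_neg (hb' s hs)).1 hf0⟩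
  · obtain ⟨δ, hδ, hb⟩ := Metric.mem_nhdsWithin_iff.1 (hc.eventually (lt_mem_nhds h))
    refine ⟨h.le, fun h0 => absurd h0 h.ne', δ, hδ, fun s hs => hb ⟨?_, hs.1.le⟩⟩
    rw [Metric.mem_ball, Real.dist_eq, sub_zero, abs_of_pos hs.1]
    exact hs.2

lemma deriv_eq_zero_of_apply_eq_zero (hu : Sol1D p f u u') {t : ℝ} (ht : 0 < t) (h : u t = 0) :
    u' t = 0 := by
  refine IsLocalMin.hasDerivAt_eq_zero ?_ (hu.hasDerivAt ht)
  filter_upwards [Ici_mem_nhds ht] with s hs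
  rw [h]
  exact hu.nonneg s hs

lemma strictMonoOn (hu : Sol1D p f u u') {T : ℝ} (hpos : ∀ t ∈ Ioo 0 T, 0 < u' t) :
    StrictMonoOn u (Icc 0 T) :=
  strictMonoOn_of_hasDerivAt_pos_Icc (hu.continuousOn.mono fun _ hs => hs.1)
    (fun _ hs => hu.hasDerivAt hs.1) hpos

/-- A solution is symmetric about its first positive critical point. -/
lemma reflection_s8 (hp : 1 < p) (hf : Continuous f) (hsmp : SMP p f)
    (hu : Sol1D p f u u') (hnz : ∃ t ∈ Ici (0 : ℝ), u t ≠ 0) {T : ℝ} (hT : 0 < T)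
    (hpos : ∀ t ∈ Ioo 0 T, 0 < u' t) (hT0 : u' T = 0) :
    0 < f (u T) ∧ ∀ s ∈ Icc 0 T, u (T + s) = u (T - s) := by
  have hne := hu.apply_ne_zero_of_deriv_eq_zero hp hf hsmp hnz hT.le hT0
  obtain ⟨δ, hδ, hb⟩ := hu.deriv_sign_near hp hf hT.le hT0 hne
  have hfpos : 0 < f (u T) := by
    set η := min (δ / 2) (T / 2)
    have h1 : 0 < η := lt_min (by positivity) (by positivity)
    have h2 : η < δ := (min_le_left _ _).trans_lt (by linarith)
    have h3 : η < T := (min_le_right _ _).trans_lt (by linarith)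
    have h4 := hb (T - η) (by linarith) (by
      rw [show T - η - T = -η by ring, abs_neg, abs_of_pos h1]; exact h2) (by linarith)
    have h5 := hpos (T - η) ⟨by linarith, by linarith⟩
    refine (pos_iff_neg_of_mul_neg h4).2 ?_
    nlinarith
  have hafter : ∀ s ∈ Ioo 0 δ, 0 < -u' (T + s) := by
    intro s hs
    have h4 := hb (T + s) (by linarith [hs.1]) (by
      rw [add_sub_cancel_left, abs_of_pos hs.1]; exact hs.2) (by linarith [hs.1])
    rw [add_sub_cancel_left] at h4
    have h5 := (pos_iff_neg_of_mul_neg h4).1 hfpos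
    rw [mul_comm] at h5
    exact neg_pos.2 ((pos_iff_neg_of_mul_neg h5).1 hs.1)
  refine ⟨hfpos, ?_⟩
  have hspeed : ∀ t ∈ Ioo 0 T, speed p f (Fint f (u T)) (u t) = u' t := fun t ht => by
    rw [← hu.abs_deriv_eq_speed hp hf hT.le hT0 ht.1.le, abs_of_pos (hpos t ht)]
  have hmem : ∀ s ∈ Ioo 0 T, T - s ∈ Ioo 0 T := fun s hs => ⟨sub_pos.2 hs.2, by linarith [hs.1]⟩
  have heq := eqOn_of_autonomous (g := fun x => speed p f (Fint f (u T)) (u T - x))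
    (a := fun s => u T - u (T - s)) (b := fun s => u T - u (T + s))
    (b' := fun s => -u' (T + s)) (r := u T) hT
    ((continuous_speed hp hf _).comp (continuous_const.sub continuous_id)).continuousOn
    (continuousOn_const.sub (hu.continuousOn.comp (by fun_prop) fun s hs => sub_nonneg.2 hs.2))
    (by simp) (by simp [hu.zeroAtZero])
    (fun s hs => by
      have := ((hu.hasDerivAt (hmem s hs).1).comp_const_sub T s).const_sub (u T)
      rw [neg_neg] at this
      simpa only [sub_sub_cancel, hspeed _ (hmem s hs)] using this)
    (fun s hs => by
      simpa only [sub_sub_cancel, hspeed _ (hmem s hs)] using hpos _ (hmem s hs))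
    (continuousOn_const.sub (hu.continuousOn.comp (by fun_prop) fun s hs => add_nonneg hT.le hs.1))
    (by simp)
    (fun s hs => ((hu.hasDerivAt (add_pos hT hs.1)).comp_const_add T s).const_sub (u T))
    (hu.derivCont.comp (by fun_prop) fun s hs => add_nonneg hT.le hs.1).neg
    (fun s hs h => by
      have hTs : 0 < T + s := add_pos hT hs.1
      refine ⟨?_, fun h0 => ?_⟩
      · simp only [sub_sub_cancel]
        rw [← hu.abs_deriv_eq_speed hp hf hT.le hT0 hTs.le, abs_of_neg (neg_pos.1 h)]
      · have h1 := hu.deriv_eq_zero_of_apply_eq_zero hTs (sub_eq_self.1 h0)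
        rw [h1, neg_zero] at h
        exact h.false)
    ⟨δ, hδ, hafter⟩
  intro s hs
  exact sub_right_injective (heq hs)

lemma deriv_eq_zero_of_Fint_eq (hp : 1 < p) (hf : Continuous f) (hu : Sol1D p f u u') {s t : ℝ}
    (hs : 0 ≤ s) (hs' : u' s = 0) (ht : 0 ≤ t) (h : Fint f (u t) = Fint f (u s)) : u' t = 0 := by
  have h1 := hu.abs_deriv_rpow hp hf hs hs' ht
  rw [h, sub_self, mul_zero, Real.rpow_eq_zero (abs_nonneg _) (by linarith)] at h1
  exact abs_eq_zero.1 h1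

lemma Fint_lt_of_deriv_pos (hp : 1 < p) (hf : Continuous f) (hu : Sol1D p f u u') {s t : ℝ}
    (hs : 0 ≤ s) (hs' : u' s = 0) (ht : 0 ≤ t) (h : 0 < u' t) :
    Fint f (u t) < Fint f (u s) := by
  have h1 := hu.abs_deriv_rpow hp hf hs hs' ht
  have h2 : 0 < |u' t| ^ p := Real.rpow_pos_of_pos (abs_pos.2 h.ne') _
  rw [h1, mul_pos_iff_of_pos_left (div_pos (by linarith) (sub_pos.2 hp))] at h2
  linarith

/-- The shape of a solution on the interval between `0` and twice its first positive critical
point. -/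
lemma half_period (hp : 1 < p) (hf : Continuous f) (hsmp : SMP p f)
    (hu : Sol1D p f u u') (hnz : ∃ t ∈ Ici (0 : ℝ), u t ≠ 0) {T : ℝ} (hT : 0 < T)
    (hpos : ∀ t ∈ Ioo 0 T, 0 < u' t) (hT0 : u' T = 0) :
    f 0 < 0 ∧ u T ∈ Pf f ∧ u' 0 = 0 ∧ u (2 * T) = 0 ∧ u' (2 * T) = 0 := by
  obtain ⟨hfT, hsymm⟩ := hu.reflection_s8 hp hf hsmp hnz hT hpos hT0
  have h2T : u (2 * T) = 0 := by
    rw [two_mul, hsymm T ⟨hT.le, le_rfl⟩, sub_self, hu.zeroAtZero]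
  have h2T' : u' (2 * T) = 0 := hu.deriv_eq_zero_of_apply_eq_zero (by positivity) h2T
  have h0' : u' 0 = 0 := hu.deriv_eq_zero_of_Fint_eq hp hf (by positivity) h2T' le_rfl
    (by rw [h2T, hu.zeroAtZero])
  have hm := hu.strictMonoOn hpos
  have huT : 0 < u T := by
    have := hm ⟨le_rfl, hT.le⟩ ⟨hT.le, le_rfl⟩ hT
    rwa [hu.zeroAtZero] at this
  have hFT : Fint f (u T) = 0 := by
    have h1 := hu.abs_deriv_rpow hp hf le_rfl h0' hT.le
    rw [hT0, abs_zero, Real.zero_rpow (by linarith), hu.zeroAtZero, Fint_zero, eq_comm,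
      mul_eq_zero] at h1
    have h2 : p / (p - 1) ≠ 0 := (div_pos (by linarith) (sub_pos.2 hp)).ne'
    linarith [h1.resolve_left h2]
  refine ⟨(hu.initially_pos hp hf hsmp hnz).2.1 h0', ⟨huT, hfT, hFT, fun x hx => ?_⟩, h0', h2T,
    h2T'⟩
  obtain ⟨s, hs, rfl⟩ := intermediate_value_Ioo hT.le (hu.continuousOn.mono fun _ hs => hs.1)
    (show x ∈ Ioo (u 0) (u T) by rwa [hu.zeroAtZero])
  exact hFT ▸ hu.Fint_lt_of_deriv_pos hp hf hT.le hT0 hs.1.le (hpos s hs)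

lemma shift (hu : Sol1D p f u u') {c : ℝ} (hc : 0 ≤ c) (h : u c = 0) :
    Sol1D p f (fun s => u (c + s)) (fun s => u' (c + s)) where
  hasDeriv t ht := by
    have hmap : MapsTo (fun s => c + s) (Ici 0) (Ici 0) := fun s hs => add_nonneg hc hs
    have := (hu.hasDeriv (c + t) (hmap ht)).comp t ((hasDerivWithinAt_id t _).const_add c) hmap
    rwa [mul_one] at this
  derivCont := hu.derivCont.comp (by fun_prop) fun s hs => add_nonneg hc hs
  bounded := by
    obtain ⟨M, hM⟩ := hu.bounded
    exact ⟨M, fun t ht => hM _ (add_nonneg hc ht)⟩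
  zeroAtZero := by simpa using h
  nonneg t ht := hu.nonneg _ (add_nonneg hc ht)
  ode t ht := (hu.ode (c + t) (add_pos_of_nonneg_of_pos hc ht)).comp_const_add c t

/-- Two nontrivial solutions starting with zero slope coincide until the first critical point of
one of them. -/
lemma eqOn_of_deriv_zero (hp : 1 < p) (hf : Continuous f) (hsmp : SMP p f)
    (hu : Sol1D p f u u') (hnz : ∃ t ∈ Ici (0 : ℝ), u t ≠ 0) {T : ℝ} (hT : 0 < T)
    (hpos : ∀ t ∈ Ioo 0 T, 0 < u' t) (hT0 : u' T = 0) {v v' : ℝ → ℝ} (hv : Sol1D p f v v')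
    (hvnz : ∃ t ∈ Ici (0 : ℝ), v t ≠ 0) (hv0 : v' 0 = 0) :
    EqOn v u (Icc 0 T) ∧ (∀ t ∈ Ioo 0 T, 0 < v' t) ∧ v' T = 0 := by
  obtain ⟨-, hP, h0, -, -⟩ := hu.half_period hp hf hsmp hnz hT hpos hT0
  have hu0 : ∀ t ∈ Ioo 0 T, speed p f 0 (u t) = u' t := fun t ht => by
    have := hu.abs_deriv_eq_speed hp hf le_rfl h0 ht.1.le
    rw [hu.zeroAtZero, Fint_zero] at this
    rw [← this, abs_of_pos (hpos t ht)]
  have heq := eqOn_of_autonomous (g := speed p f 0) (a := u) (b := v) (b' := v') (r := u T) hT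
    (continuous_speed hp hf _).continuousOn (hu.continuousOn.mono fun s hs => hs.1) hu.zeroAtZero
    rfl (fun s hs => by rw [hu0 s hs]; exact hu.hasDerivAt hs.1)
    (fun s hs => by rw [hu0 s hs]; exact hpos s hs) (hv.continuousOn.mono fun s hs => hs.1)
    hv.zeroAtZero (fun s hs => hv.hasDerivAt hs.1) (hv.derivCont.mono fun s hs => hs.1)
    (fun s hs h => by
      refine ⟨?_, fun hr => ?_⟩
      · have := hv.abs_deriv_eq_speed hp hf le_rfl hv0 hs.1.le
        rwa [hv.zeroAtZero, Fint_zero, abs_of_pos h] at this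
      · refine h.ne' (hv.deriv_eq_zero_of_Fint_eq hp hf le_rfl hv0 hs.1.le ?_)
        rw [hr, hP.2.2.1, hv.zeroAtZero, Fint_zero])
    (hv.initially_pos hp hf hsmp hvnz).2.2
  refine ⟨heq, fun t ht => ?_, hv.deriv_eq_zero_of_Fint_eq hp hf le_rfl hv0 hT.le ?_⟩
  · have h1 : HasDerivAt u (v' t) t := (hv.hasDerivAt ht.1).congr_of_eventuallyEq <| by
      filter_upwards [Icc_mem_nhds ht.1 ht.2] with s hs using (heq hs).symm
    rw [h1.unique (hu.hasDerivAt ht.1)]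
    exact hpos t ht
  · rw [heq ⟨hT.le, le_rfl⟩, hP.2.2.1, hv.zeroAtZero, Fint_zero]

lemma periodic (hp : 1 < p) (hf : Continuous f) (hsmp : SMP p f)
    (hu : Sol1D p f u u') (hnz : ∃ t ∈ Ici (0 : ℝ), u t ≠ 0) {T : ℝ} (hT : 0 < T)
    (hpos : ∀ t ∈ Ioo 0 T, 0 < u' t) (hT0 : u' T = 0) (k : ℕ) :
    ∀ t ∈ Icc 0 T, u (t + 2 * (k : ℝ) * T) = u t ∧ u (t + (2 * (k : ℝ) + 1) * T) = u (T - t) := by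
  have hf0 := (hu.half_period hp hf hsmp hnz hT hpos hT0).1
  have nontrivial : ∀ {v v' : ℝ → ℝ}, Sol1D p f v v' → ∃ t ∈ Ici (0 : ℝ), v t ≠ 0 := by
    intro v v' hv
    by_contra! h
    have h0 : ∀ t > 0, v' t = 0 := fun t ht => hv.deriv_eq_zero_of_apply_eq_zero ht (h t ht.le)
    have hW : HasDerivAt (fun s => |v' s| ^ (p - 2) * v' s) 0 1 :=
      (hasDerivAt_const (1 : ℝ) (0 : ℝ)).congr_of_eventuallyEq <| by
        filter_upwards [Ioi_mem_nhds one_pos] with s hs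
        rw [h0 s hs, mul_zero]
    have := hW.unique (hv.ode 1 (mem_Ioi.2 one_pos))
    rw [h 1 (mem_Ici.2 zero_le_one)] at this
    linarith
  have step : ∀ {v v' : ℝ → ℝ}, Sol1D p f v v' → v' 0 = 0 →
      EqOn v u (Icc 0 T) ∧ (∀ t ∈ Icc 0 T, v (T + t) = u (T - t)) ∧ v (2 * T) = 0 ∧
        v' (2 * T) = 0 := by
    intro v v' hv hv0
    obtain ⟨h1, h2, h3⟩ := hu.eqOn_of_deriv_zero hp hf hsmp hnz hT hpos hT0 hv (nontrivial hv) hv0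
    have h4 := (hv.reflection_s8 hp hf hsmp (nontrivial hv) hT h2 h3).2
    have h5 := hv.half_period hp hf hsmp (nontrivial hv) hT h2 h3
    exact ⟨h1, fun t ht => by rw [h4 t ht, h1 ⟨sub_nonneg.2 ht.2, by linarith [ht.1]⟩],
      h5.2.2.2.1, h5.2.2.2.2⟩
  have base : u (2 * (k : ℝ) * T) = 0 ∧ u' (2 * (k : ℝ) * T) = 0 := by
    induction k with
    | zero =>
      simpa using ⟨hu.zeroAtZero, (hu.half_period hp hf hsmp hnz hT hpos hT0).2.2.1⟩
    | succ k ih =>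
      have h := (step (hu.shift (by positivity) ih.1) (by simpa using ih.2)).2.2
      rw [show 2 * ((k + 1 : ℕ) : ℝ) * T = 2 * (k : ℝ) * T + 2 * T by push_cast; ring]
      exact h
  obtain ⟨h1, h2, -⟩ := step (hu.shift (by positivity) base.1) (by simpa using base.2)
  intro t ht
  refine ⟨?_, ?_⟩
  · rw [add_comm]
    exact h1 ht
  · rw [show t + (2 * (k : ℝ) + 1) * T = 2 * (k : ℝ) * T + (T + t) by ring]
    exact h2 t ht

/-- A solution without positive critical points increases to an element of `Zfstar f`. -/
lemma increasing_case (hp : 1 < p) (hf : Continuous f) (hsmp : SMP p f)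
    (hu : Sol1D p f u u') (hnz : ∃ t ∈ Ici (0 : ℝ), u t ≠ 0) (hpos : ∀ t > 0, 0 < u' t) :
    ∃ ρ : ℝ, Tendsto u atTop (𝓝 ρ) ∧ 0 < ρ ∧ ρ ∈ Zfstar f ∧
      u' 0 = (p / (p - 1) * Fint f ρ) ^ (1 / p) := by
  have hp0 : 0 < p := by linarith
  have hq : 0 < p / (p - 1) := div_pos hp0 (sub_pos.2 hp)
  have hm : ∀ s t, 0 ≤ s → s < t → u s < u t := fun s t hs hst =>
    hu.strictMonoOn (T := t) (fun x hx => hpos x hx.1) ⟨hs, hst.le⟩ ⟨hs.trans hst.le, le_rfl⟩ hst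
  obtain ⟨ρ, hρ, hlt⟩ : ∃ ρ, Tendsto u atTop (𝓝 ρ) ∧ ∀ t, 0 ≤ t → u t < ρ := by
    obtain ⟨M, hM⟩ := hu.bounded
    have hmono : Monotone fun t => u (max t 0) := by
      intro s t hst
      rcases (max_le_max_right 0 hst).eq_or_lt with h | h
      · exact (congrArg u h).le
      · exact (hm _ _ (le_max_right _ _) h).le
    have hb : BddAbove (range fun t => u (max t 0)) :=
      ⟨M, by rintro _ ⟨t, rfl⟩; exact (le_abs_self _).trans (hM _ (mem_Ici.2 (le_max_right _ _)))⟩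
    refine ⟨_, (tendsto_atTop_ciSup hmono hb).congr' ?_, fun t ht => ?_⟩
    · filter_upwards [eventually_ge_atTop 0] with t ht
      rw [max_eq_left ht]
    · have h1 := le_ciSup hb (t + 1)
      simp only [max_eq_left (show 0 ≤ t + 1 by linarith)] at h1
      exact (hm t (t + 1) ht (by linarith)).trans_le h1
  have hρ0 : 0 < ρ := by simpa [hu.zeroAtZero] using hlt 0 le_rfl
  have hFt : Tendsto (fun t => Fint f (u t)) atTop (𝓝 (Fint f ρ)) :=
    ((continuous_Fint hf).tendsto ρ).comp hρ
  have hpow : Tendsto (fun t => |u' t| ^ p) atTop (𝓝 (|u' 0| ^ p - p / (p - 1) * Fint f ρ)) := by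
    refine (tendsto_const_nhds.sub (hFt.const_mul (p / (p - 1)))).congr' ?_
    filter_upwards [eventually_ge_atTop 0] with t ht
    linarith [hu.energy hp hf ht]
  have hu'm : Tendsto u' atTop (𝓝 ((|u' 0| ^ p - p / (p - 1) * Fint f ρ) ^ (p⁻¹))) := by
    refine (hpow.rpow_const (Or.inr (by positivity))).congr' ?_
    filter_upwards [eventually_gt_atTop 0] with t ht
    rw [Real.rpow_rpow_inv (abs_nonneg _) hp0.ne', abs_of_pos (hpos t ht)]
  have hm0 := limit_deriv_eq_zero (fun t ht => hu.hasDerivAt ht) hρ hu'm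
  rw [hm0] at hu'm
  have hE : |u' 0| ^ p = p / (p - 1) * Fint f ρ := by
    have h1 := hu'm.abs.rpow_const (p := p) (Or.inr hp0.le)
    rw [abs_zero, Real.zero_rpow hp0.ne'] at h1
    linarith [tendsto_nhds_unique hpow h1]
  have hfρ : f ρ = 0 := by
    have hW : Tendsto (fun t => |u' t| ^ (p - 2) * u' t) atTop (𝓝 (|(0 : ℝ)| ^ (p - 2) * 0)) :=
      ((continuous_abs_rpow_sub_two_mul hp).tendsto 0).comp hu'm
    exact neg_eq_zero.1 (limit_deriv_eq_zero (fun t ht => hu.ode t ht) hW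
      ((hf.tendsto ρ).comp hρ).neg)
  have hFlt : ∀ x ∈ Ioo 0 ρ, Fint f x < Fint f ρ := by
    intro x hx
    obtain ⟨t, ht0, ht⟩ := ((eventually_ge_atTop 0).and (hρ.eventually (lt_mem_nhds hx.2))).exists
    obtain ⟨s, hs, rfl⟩ := intermediate_value_Ioo ht0 (hu.continuousOn.mono fun _ hs => hs.1)
      (show x ∈ Ioo (u 0) (u t) from ⟨by rw [hu.zeroAtZero]; exact hx.1, ht⟩)
    have h1 := hu.energy hp hf hs.1.le
    have h2 : 0 < |u' s| ^ p := Real.rpow_pos_of_pos (abs_pos.2 (hpos s hs.1).ne') _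
    rw [hE] at h1
    exact lt_of_mul_lt_mul_left (by linarith) hq.le
  obtain ⟨h0, h0f, -⟩ := hu.initially_pos hp hf hsmp hnz
  refine ⟨ρ, hρ, hρ0, ?_, ?_⟩
  · rcases h0.eq_or_lt with h | h
    · rw [← h, abs_zero, Real.zero_rpow hp0.ne', eq_comm, mul_eq_zero] at hE
      have hF0 := hE.resolve_left hq.ne'
      exact Or.inr ⟨⟨hρ0.le, hfρ⟩, h0f h.symm, hF0, fun x hx => hF0 ▸ hFlt x hx⟩
    · refine Or.inl ⟨⟨hρ0.le, hfρ⟩, fun x hx => ?_⟩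
      rcases hx.1.eq_or_lt with rfl | hx0
      · rw [Fint_zero]
        have h1 : 0 < |u' 0| ^ p := Real.rpow_pos_of_pos (abs_pos.2 h.ne') _
        rw [hE] at h1
        exact (mul_pos_iff_of_pos_left hq).1 h1
      · exact hFlt x ⟨hx0, hx.2⟩
  · rw [← hE, one_div, Real.rpow_rpow_inv (abs_nonneg _) hp0.ne', abs_of_nonneg h0]

end Sol1D

/-- The classification for a nonlinearity that is continuous on the whole line. -/
lemma classification_of_continuous {p : ℝ} (hp : 1 < p) {f : ℝ → ℝ} (hf : Continuous f)
    (hsmp : SMP p f) {u u' : ℝ → ℝ} (hu : Sol1D p f u u')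
    (hnz : ∃ t ∈ Ici (0 : ℝ), u t ≠ 0) :
    ((∀ t > (0:ℝ), 0 < u' t) ∧
      ∃ ρ : ℝ, Tendsto u atTop (𝓝 ρ) ∧ 0 < ρ ∧ ρ ∈ Zfstar f ∧
        u' 0 = (p / (p - 1) * Fint f ρ) ^ (1/p)) ∨
    (f 0 < 0 ∧
      ∃ ρ ∈ Pf f, ∃ tstar > (0:ℝ),
        (∀ t ∈ Ioo 0 tstar, 0 < u' t) ∧
        u' 0 = 0 ∧ u' tstar = 0 ∧ u tstar = ρ ∧
        ∀ t ∈ Icc 0 tstar, ∀ k : ℕ,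
          u (t + 2 * (k:ℝ) * tstar) = u t ∧
          u (t + (2 * (k:ℝ) + 1) * tstar) = u (tstar - t)) := by
  by_cases hpos : ∀ t > (0 : ℝ), 0 < u' t
  · exact Or.inl ⟨hpos, hu.increasing_case hp hf hsmp hnz hpos⟩
  · push Not at hpos
    obtain ⟨t₁, ht₁, hle⟩ := hpos
    obtain ⟨T, hT, hT0, hTpos⟩ := exists_first_zero ht₁
      (hu.derivCont.mono fun s (hs : s ∈ Icc 0 t₁) => hs.1)
      (hu.initially_pos hp hf hsmp hnz).2.2 hle
    obtain ⟨h1, h2, h3, -, -⟩ := hu.half_period hp hf hsmp hnz hT.1 hTpos hT0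
    exact Or.inr ⟨h1, u T, h2, T, hT.1, hTpos, h3, hT0, rfl,
      fun t ht k => hu.periodic hp hf hsmp hnz hT.1 hTpos hT0 k t ht⟩

lemma Fint_congr {f g : ℝ → ℝ} (h : EqOn f g (Ici 0)) {t : ℝ} (ht : 0 ≤ t) :
    Fint f t = Fint g t :=
  intervalIntegral.integral_congr fun s hs => h (by
    rw [uIcc_of_le ht] at hs
    exact hs.1)

lemma Zf_congr {f g : ℝ → ℝ} (h : EqOn f g (Ici 0)) : Zf f = Zf g := by
  ext z
  exact and_congr_right fun hz => by rw [h hz]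

lemma SMP_congr {p : ℝ} {f g : ℝ → ℝ} (h : EqOn f g (Ici 0)) (hf : SMP p f) : SMP p g := by
  intro z hz
  obtain ⟨h1, h2⟩ := hf z (Zf_congr h ▸ hz)
  refine ⟨h1.trans_eq (liminf_congr ?_), (limsup_congr ?_).trans_lt h2⟩
  · filter_upwards [self_mem_nhdsWithin] with t ht
    rw [h (hz.1.trans ht.le)]
  · filter_upwards [self_mem_nhdsWithin] with t ht
    rw [h ht.1]

lemma Sol1D.congr {p : ℝ} {f g u u' : ℝ → ℝ} (h : EqOn f g (Ici 0)) (hu : Sol1D p f u u') :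
    Sol1D p g u u' :=
  { hu with ode := fun t ht => h (hu.nonneg t (mem_Ioi.1 ht).le) ▸ hu.ode t ht }

lemma mem_Zfstar_congr {f g : ℝ → ℝ} (h : EqOn f g (Ici 0)) {ρ : ℝ} (hρ : 0 ≤ ρ)
    (hm : ρ ∈ Zfstar f) : ρ ∈ Zfstar g := by
  have hF : ∀ t, 0 ≤ t → Fint f t = Fint g t := fun t ht => Fint_congr h ht
  rcases hm with ⟨h1, h2⟩ | ⟨h1, h2, h3, h4⟩
  · refine Or.inl ⟨Zf_congr h ▸ h1, fun t ht => ?_⟩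
    rw [← hF t ht.1, ← hF ρ hρ]
    exact h2 t ht
  · refine Or.inr ⟨Zf_congr h ▸ h1, h self_mem_Ici ▸ h2, hF ρ hρ ▸ h3, fun t ht => ?_⟩
    rw [← hF t ht.1.le]
    exact h4 t ht

lemma mem_Pf_congr {f g : ℝ → ℝ} (h : EqOn f g (Ici 0)) {ρ : ℝ} (hm : ρ ∈ Pf f) : ρ ∈ Pf g := by
  obtain ⟨h1, h2, h3, h4⟩ := hm
  refine ⟨h1, h (mem_Ici.2 h1.le) ▸ h2, Fint_congr h h1.le ▸ h3, fun t ht => ?_⟩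
  rw [← Fint_congr h ht.1.le]
  exact h4 t ht

theorem stmt8 (p : ℝ) (hp : 1 < p) (f : ℝ → ℝ)
    (hfc : ContinuousOn f (Set.Ici 0))
    (hflip : LocLipOn f (Set.Ici 0 \ Zf f))
    (hsmp : SMP p f)
    (u u' : ℝ → ℝ) (hu : Sol1D p f u u')
    (hnz : ∃ t ∈ Set.Ici (0:ℝ), u t ≠ 0) :
    ((∀ t > (0:ℝ), 0 < u' t) ∧
      ∃ ρ : ℝ, Filter.Tendsto u Filter.atTop (nhds ρ) ∧ ρ ∈ Zfstar f ∧
        u' 0 = (p / (p - 1) * Fint f ρ) ^ (1/p)) ∨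
    (f 0 < 0 ∧
      ∃ ρ ∈ Pf f, ∃ tstar > (0:ℝ),
        (∀ t ∈ Set.Ioo 0 tstar, 0 < u' t) ∧
        u' 0 = 0 ∧ u' tstar = 0 ∧ u tstar = ρ ∧
        ∀ t ∈ Set.Icc 0 tstar, ∀ k : ℕ,
          u (t + 2 * (k:ℝ) * tstar) = u t ∧
          u (t + (2 * (k:ℝ) + 1) * tstar) = u (tstar - t)) := by
  set g : ℝ → ℝ := fun x => f (max x 0) with hg
  have hgc : Continuous g :=
    hfc.comp_continuous (continuous_id.max continuous_const) fun x => mem_Ici.2 (le_max_right _ _)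
  have hfg : EqOn f g (Ici 0) := fun x hx => by simp only [hg, max_eq_left (mem_Ici.1 hx)]
  rcases classification_of_continuous hp hgc (SMP_congr hfg hsmp) (hu.congr hfg) hnz with
    ⟨hpos, ρ, h1, h2, h3, h4⟩ | ⟨h0, ρ, hP, h⟩
  · refine Or.inl ⟨hpos, ρ, h1, mem_Zfstar_congr hfg.symm h2.le h3, ?_⟩
    rw [h4, Fint_congr hfg h2.le]
  · exact Or.inr ⟨hfg.symm self_mem_Ici ▸ h0, ρ, mem_Pf_congr hfg.symm hP, h⟩
end
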